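/- arXiv:1202.0035 — 8 statements merged into one kernel-verified Lean document; each statement's English description precedes it below -/
import Mathlib

section
/- Let n be an integer and y a real number with 1 + y ≠ 0, 1 + 2y ≠ 0 and (1+2y)^n ≠ 1, and set z = y/(1+y). Then n·y·(1 + (1+2y)^n) / ((1+y)·((1+2y)^n − 1)) = n·z·((1+z)^n + (1−z)^n) / ((1+z)^n − (1−z)^n). -/
theorem euler_sect5_6_substitution (n : ℤ) (y : ℝ) (hy : 1 + y ≠ 0) (hy2 : 1 + 2 * y ≠ 0)
    (hpow : (1 + 2 * y) ^ n ≠ 1) (z : ℝ) (hz : z = y / (1 + y)) :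
    (n : ℝ) * y * (1 + (1 + 2 * y) ^ n) / ((1 + y) * ((1 + 2 * y) ^ n - 1)) =
      (n : ℝ) * z * ((1 + z) ^ n + (1 - z) ^ n) / ((1 + z) ^ n - (1 - z) ^ n) := by
  have h_add : 1 + z = (1 + 2 * y) / (1 + y) := by
    rw [hz]
    field_simp
    ring
  have h_sub : 1 - z = 1 / (1 + y) := by
    rw [hz]
    field_simp
    ring
  have hb : (1 + y) ^ n ≠ 0 := zpow_ne_zero n hy
  rw [h_add, h_sub, div_zpow, div_zpow, one_zpow, hz]
  generalize (1 + 2 * y) ^ n = a at hpow ⊢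
  generalize (1 + y) ^ n = b at hb ⊢
  have ha : a - 1 ≠ 0 := sub_ne_zero.mpr hpow
  rw [← add_div, ← sub_div]
  field_simp
  ring
end

section
/- Let n ≥ 1 be a natural number and z > 0 a real number. Consider the generalized continued fraction over ℝ with head term h = 1 whose k-th partial numerator (k = 1, 2, 3, …) is (n² − k²)·z² and whose k-th partial denominator is 2k + 1. Then the sequence of its convergents tends to n·z·((1+z)^n + (1−z)^n) / ((1+z)^n − (1−z)^n). -/
open Filter Topology

/-- Numerators of the Gegenbauer recurrence, normalised by `1, 2 * n + 1`: the coefficients of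
`(1 - 2 * y + Z * y ^ 2) ^ (-(n + 1 / 2))` as a power series in `y`. -/
def geg {F : Type*} [Field F] (n : ℕ) (Z : F) : ℕ → F
  | 0 => 1
  | 1 => 2 * n + 1
  | k + 2 => ((2 * k + 2 * n + 3) * geg n Z (k + 1) - (k + 2 * n + 1) * Z * geg n Z k) / (k + 2)

/-- The solution of the recurrence of `geg` with initial values `0, 1`. -/
def gegSnd {F : Type*} [Field F] (n : ℕ) (Z : F) : ℕ → F
  | 0 => 0
  | 1 => 1
  | k + 2 =>
    ((2 * k + 2 * n + 3) * gegSnd n Z (k + 1) - (k + 2 * n + 1) * Z * gegSnd n Z k) / (k + 2)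

section ContinuedFraction

/-- Summands of the polynomials giving the tails of the terminating continued fraction. -/
noncomputable def tailTerm (x : ℝ) (Z : ℝ) (k i : ℕ) : ℝ :=
  ∏ j ∈ Finset.range i,
    ((x - k - 2 * j) * (x - k - 2 * j - 1) / (2 * (j + 1) * (2 * k + 1 + 2 * j)) * Z)

noncomputable def tailPoly (n : ℕ) (Z : ℝ) (k : ℕ) : ℝ :=
  ∑ i ∈ Finset.range (n + 1), tailTerm n Z k i

lemma tailTerm_succ (x Z : ℝ) (k i : ℕ) : tailTerm x Z k (i + 1) = tailTerm x Z k i *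
    ((x - k - 2 * i) * (x - k - 2 * i - 1) / (2 * (i + 1) * (2 * k + 1 + 2 * i)) * Z) :=
  Finset.prod_range_succ _ _

lemma tailTerm_eq_zero {n k i : ℕ} (Z : ℝ) (hk : k ≤ n) (hi : n < k + 2 * i) :
    tailTerm n Z k i = 0 := by
  obtain ⟨m, rfl⟩ := Nat.exists_eq_add_of_le hk
  refine Finset.prod_eq_zero (i := m / 2) (Finset.mem_range.2 (by omega)) ?_
  rcases Nat.even_or_odd' m with ⟨c, rfl | rfl⟩
  · have : 2 * c / 2 = c := by omega
    rw [this]; push_cast; ring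
  · have : (2 * c + 1) / 2 = c := by omega
    rw [this]; push_cast; ring

lemma tailTerm_contiguous_aux (x Z : ℝ) (k i : ℕ) :
    tailTerm x Z (k + 1) i * (x - k) * (2 * k + 1 + 2 * i)
      = tailTerm x Z k i * (x - k - 2 * i) * (2 * k + 1) := by
  induction i with
  | zero => simp [tailTerm]
  | succ i ih =>
    rw [tailTerm_succ, tailTerm_succ]
    have h1 : (2 * (k : ℝ) + 1 + 2 * i) ≠ 0 := by positivity
    have h2 : (2 * (k : ℝ) + 3 + 2 * i) ≠ 0 := by positivity
    have h3 : (i : ℝ) + 1 ≠ 0 := by positivity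
    push_cast
    have h4 : 2 * ((k : ℝ) + 1) + 1 + 2 * i = 2 * (k : ℝ) + 3 + 2 * i := by ring
    have h5 : 2 * (k : ℝ) + 1 + 2 * (i + 1) = 2 * (k : ℝ) + 3 + 2 * i := by ring
    rw [h4, h5]
    generalize tailTerm x Z (k + 1) i = T₁ at *
    generalize tailTerm x Z k i = T₀ at *
    field_simp
    linear_combination (x - (k + 1) - 2 * i) * (x - (k + 1) - 2 * i - 1) * Z * ih

lemma tailTerm_contiguous {n k : ℕ} (Z : ℝ) (hk : k + 1 ≤ n) (i : ℕ) :
    tailTerm n Z k (i + 1) = tailTerm n Z (k + 1) (i + 1)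
      + ((n : ℝ) ^ 2 - (k + 1) ^ 2) / ((2 * k + 1) * (2 * k + 3)) * Z * tailTerm n Z (k + 2) i := by
  have h0 : (n : ℝ) - k ≠ 0 := by
    have : (k : ℝ) + 1 ≤ n := by exact_mod_cast hk
    linarith
  have e1 := tailTerm_contiguous_aux (n : ℝ) Z k i
  have e2 := tailTerm_contiguous_aux (n : ℝ) Z (k + 1) i
  push_cast at e2
  have h1 : (2 * (k : ℝ) + 1 + 2 * i) ≠ 0 := by positivity
  have h3 : (i : ℝ) + 1 ≠ 0 := by positivity
  have h6 : 2 * (k : ℝ) + 1 ≠ 0 := by positivity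
  have h7 : 2 * (k : ℝ) + 3 ≠ 0 := by positivity
  rcases eq_or_ne ((n : ℝ) - (k + 1)) 0 with h | h
  · have hn : n = k + 1 := by
      have : (n : ℝ) = ((k + 1 : ℕ) : ℝ) := by push_cast; linarith
      exact_mod_cast this
    subst hn
    rw [tailTerm_eq_zero _ (by omega) (by omega), tailTerm_eq_zero _ (by omega) (by omega)]
    push_cast; ring
  · have h8 : (2 * (k : ℝ) + 3 + 2 * i) ≠ 0 := by positivity
    have h9 : 2 * ((k : ℝ) + 1) + 1 + 2 * i = 2 * (k : ℝ) + 3 + 2 * i := by ring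
    rw [tailTerm_succ, tailTerm_succ]
    push_cast
    rw [h9] at e2 ⊢
    change tailTerm n Z (k + 2) i * _ * _ = _ at e2
    generalize tailTerm n Z (k + 2) i = T₂ at *
    generalize tailTerm n Z (k + 1) i = T₁ at *
    generalize tailTerm n Z k i = T₀ at *
    have e1' : T₁ = T₀ * (n - k - 2 * i) * (2 * k + 1) / ((n - k) * (2 * k + 1 + 2 * i)) := by
      rw [eq_div_iff (by positivity)]; linarith
    have e2' : T₂ = T₁ * (n - (k + 1) - 2 * i) * (2 * (k + 1) + 1)
        / ((n - (k + 1)) * (2 * k + 3 + 2 * i)) := by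
      rw [eq_div_iff (mul_ne_zero h h8)]; linear_combination e2
    rw [e2', e1']
    field_simp
    ring

lemma tailPoly_contiguous {n k : ℕ} (Z : ℝ) (hk : k + 1 ≤ n) :
    tailPoly n Z k = tailPoly n Z (k + 1)
      + ((n : ℝ) ^ 2 - (k + 1) ^ 2) / ((2 * k + 1) * (2 * k + 3)) * Z * tailPoly n Z (k + 2) := by
  have hlast : ((n : ℝ) ^ 2 - (k + 1) ^ 2) / ((2 * k + 1) * (2 * k + 3)) * Z
      * tailTerm n Z (k + 2) n = 0 := by
    rcases eq_or_lt_of_le hk with h | h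
    · subst h; push_cast; ring
    · rw [tailTerm_eq_zero _ h (by omega)]; ring
  simp only [tailPoly]
  rw [Finset.sum_range_succ (tailTerm n Z (k + 2)), mul_add, hlast, add_zero,
    Finset.sum_range_succ', Finset.sum_range_succ' (tailTerm n Z (k + 1)),
    Finset.sum_congr rfl fun i _ => tailTerm_contiguous Z hk i, Finset.sum_add_distrib,
    Finset.mul_sum]
  simp only [tailTerm, Finset.range_zero, Finset.prod_empty]
  ring

lemma tailTerm_zero_eq {n : ℕ} (z : ℝ) (i : ℕ) :
    tailTerm n (z ^ 2) 0 i = n.choose (2 * i) * z ^ (2 * i) := by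
  induction i with
  | zero => simp [tailTerm]
  | succ i ih =>
    have h1 : (n.choose (2 * i + 1) : ℝ) * (2 * i + 1) = n.choose (2 * i) * (n - 2 * i) := by
      rcases le_or_gt (2 * i) n with h | h
      · have := Nat.choose_succ_right_eq n (2 * i)
        have h' : ((n - 2 * i : ℕ) : ℝ) = n - 2 * i := by push_cast [h]; ring
        rw [← h']; exact_mod_cast this
      · simp [Nat.choose_eq_zero_of_lt h, Nat.choose_eq_zero_of_lt (h.trans (Nat.lt_succ_self _))]
    have h2 : (n.choose (2 * i + 2) : ℝ) * (2 * i + 2)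
        = n.choose (2 * i + 1) * (n - 2 * i - 1) := by
      rcases le_or_gt (2 * i + 1) n with h | h
      · have := Nat.choose_succ_right_eq n (2 * i + 1)
        have h' : ((n - (2 * i + 1) : ℕ) : ℝ) = n - 2 * i - 1 := by push_cast [h]; ring
        rw [← h']; exact_mod_cast this
      · simp [Nat.choose_eq_zero_of_lt h, Nat.choose_eq_zero_of_lt (h.trans (Nat.lt_succ_self _))]
    rw [tailTerm_succ, ih, show 2 * (i + 1) = 2 * i + 2 by ring]
    have h3 : (i : ℝ) + 1 ≠ 0 := by positivity
    have h4 : 2 * (i : ℝ) + 1 ≠ 0 := by positivity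
    have h1' : (n.choose (2 * i + 1) : ℝ) = n.choose (2 * i) * (n - 2 * i) / (2 * i + 1) := by
      rw [eq_div_iff h4, h1]
    have h2' : (n.choose (2 * i + 2) : ℝ)
        = n.choose (2 * i + 1) * (n - 2 * i - 1) / (2 * (i + 1)) := by
      rw [eq_div_iff (by positivity), ← h2]; ring
    rw [h2', h1']
    push_cast
    simp only [mul_zero, zero_add, sub_zero]
    rw [add_comm (1 : ℝ)]
    field_simp
    ring

lemma tailTerm_one_eq {n : ℕ} (z : ℝ) (i : ℕ) :
    n * z * tailTerm n (z ^ 2) 1 i = n.choose (2 * i + 1) * z ^ (2 * i + 1) := by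
  have h := tailTerm_contiguous_aux n (z ^ 2) 0 i
  rw [tailTerm_zero_eq] at h
  have h1 : (n.choose (2 * i + 1) : ℝ) * (2 * i + 1) = n.choose (2 * i) * (n - 2 * i) := by
    rcases le_or_gt (2 * i) n with h | h
    · have := Nat.choose_succ_right_eq n (2 * i)
      have h' : ((n - 2 * i : ℕ) : ℝ) = n - 2 * i := by push_cast [h]; ring
      rw [← h']; exact_mod_cast this
    · simp [Nat.choose_eq_zero_of_lt h, Nat.choose_eq_zero_of_lt (h.trans (Nat.lt_succ_self _))]
  have h4 : 2 * (i : ℝ) + 1 ≠ 0 := by positivity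
  push_cast at h
  simp only [zero_add, sub_zero, mul_zero, mul_one] at h
  refine mul_right_cancel₀ h4 ?_
  linear_combination (exp := 1) z * h - z * z ^ (2 * i) * h1

lemma sum_range_two_mul {M : Type*} [AddCommMonoid M] (f : ℕ → M) (m : ℕ) :
    ∑ i ∈ Finset.range (2 * m), f i
      = ∑ i ∈ Finset.range m, f (2 * i) + ∑ i ∈ Finset.range m, f (2 * i + 1) := by
  induction m with
  | zero => simp
  | succ m ih =>
    rw [show 2 * (m + 1) = 2 * m + 1 + 1 by ring, Finset.sum_range_succ, Finset.sum_range_succ,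
      Finset.sum_range_succ, Finset.sum_range_succ, ih]
    abel

lemma one_add_pow_eq_tailPoly (n : ℕ) (z : ℝ) :
    (1 + z) ^ n = tailPoly n (z ^ 2) 0 + n * z * tailPoly n (z ^ 2) 1 := by
  have : (1 + z) ^ n = ∑ i ∈ Finset.range (2 * (n + 1)), (n.choose i : ℝ) * z ^ i := by
    rw [add_comm, add_pow, ← Finset.sum_subset (Finset.range_subset_range.2
      (show n + 1 ≤ 2 * (n + 1) by omega))]
    · exact Finset.sum_congr rfl fun i _ => by simp [mul_comm]
    · intro i _ hi
      rw [Nat.choose_eq_zero_of_lt (by simpa using hi)]; simp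
  rw [this, sum_range_two_mul, tailPoly, tailPoly, Finset.mul_sum]
  congr 1
  · exact Finset.sum_congr rfl fun i _ => (tailTerm_zero_eq z i).symm
  · exact Finset.sum_congr rfl fun i _ => (tailTerm_one_eq z i).symm

end ContinuedFraction

section ContinuedFraction

noncomputable def scaledTail (n : ℕ) (Z : ℝ) (k : ℕ) : ℝ :=
  tailPoly n Z k / ∏ j ∈ Finset.range k, (2 * (j : ℝ) + 1)

lemma scaledTail_recurrence {n k : ℕ} (Z : ℝ) (hk : k + 1 ≤ n) :
    scaledTail n Z k = (2 * k + 1) * scaledTail n Z (k + 1)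
      + ((n : ℝ) ^ 2 - (k + 1) ^ 2) * Z * scaledTail n Z (k + 2) := by
  have h : ∏ j ∈ Finset.range k, (2 * (j : ℝ) + 1) ≠ 0 :=
    Finset.prod_ne_zero_iff.2 fun j _ => by positivity
  have h1 : 2 * (k : ℝ) + 1 ≠ 0 := by positivity
  have h2 : 2 * (k : ℝ) + 3 ≠ 0 := by positivity
  rw [scaledTail, scaledTail, scaledTail, Finset.prod_range_succ _ (k + 1),
    Finset.prod_range_succ _ k,
    tailPoly_contiguous Z hk, show 2 * ((k + 1 : ℕ) : ℝ) + 1 = 2 * k + 3 by push_cast; ring]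
  field_simp

lemma cf_invariant {n : ℕ} {Z : ℝ} {X : ℕ → ℝ}
    (hX : ∀ m : ℕ, X (m + 2) = (2 * m + 3) * X (m + 1) + ((n : ℝ) ^ 2 - (m + 1) ^ 2) * Z * X m)
    {m : ℕ} (hm : m + 1 ≤ n) :
    X (m + 1) * scaledTail n Z (m + 1)
        + ((n : ℝ) ^ 2 - (m + 1) ^ 2) * Z * X m * scaledTail n Z (m + 2)
      = X 1 * scaledTail n Z 1 + ((n : ℝ) ^ 2 - 1) * Z * X 0 * scaledTail n Z 2 := by
  induction m with
  | zero => simp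
  | succ m ih =>
    rw [← ih (by omega), hX m, scaledTail_recurrence Z (k := m + 1) (by omega)]
    push_cast
    ring

lemma cf_value {n : ℕ} (hn : 1 ≤ n) {Z : ℝ} {X : ℕ → ℝ}
    (hX : ∀ m : ℕ, X (m + 2) = (2 * m + 3) * X (m + 1) + ((n : ℝ) ^ 2 - (m + 1) ^ 2) * Z * X m) :
    X n * scaledTail n Z n
      = X 1 * scaledTail n Z 1 + ((n : ℝ) ^ 2 - 1) * Z * X 0 * scaledTail n Z 2 := by
  obtain ⟨m, rfl⟩ : ∃ m, n = m + 1 := ⟨n - 1, by omega⟩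
  rw [← cf_invariant hX le_rfl]
  push_cast
  ring

lemma cf_eq_geg {n : ℕ} {Z : ℝ} {X : ℕ → ℝ}
    (hX : ∀ m : ℕ, X (m + 2) = (2 * m + 3) * X (m + 1) + ((n : ℝ) ^ 2 - (m + 1) ^ 2) * Z * X m)
    (hn : 1 ≤ n) (N : ℕ) : X (n + N) = X n * N.factorial * geg n Z N := by
  induction N using Nat.strong_induction_on with
  | _ N ih =>
    match N, ih with
    | 0, _ => simp [geg]
    | 1, _ =>
      obtain ⟨m, rfl⟩ : ∃ m, n = m + 1 := ⟨n - 1, by omega⟩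
      rw [show m + 1 + 1 = m + 2 by ring, hX m, geg]
      push_cast; simp; ring
    | N + 2, ih =>
      have h : (N : ℝ) + 2 ≠ 0 := by positivity
      rw [show n + (N + 2) = n + N + 2 by ring, hX, show n + N + 1 = n + (N + 1) by ring,
        ih N (by omega), ih (N + 1) (by omega), geg, Nat.factorial_succ (N + 1),
        Nat.factorial_succ N]
      push_cast
      field_simp
      ring

lemma tailPoly_zero_eq (n : ℕ) (z : ℝ) :
    (1 + z) ^ n + (1 - z) ^ n = 2 * tailPoly n (z ^ 2) 0 := by
  have h := one_add_pow_eq_tailPoly n (-z)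
  rw [neg_sq, ← sub_eq_add_neg] at h
  rw [h, one_add_pow_eq_tailPoly n z]; ring

lemma tailPoly_one_eq (n : ℕ) (z : ℝ) :
    (1 + z) ^ n - (1 - z) ^ n = 2 * n * z * tailPoly n (z ^ 2) 1 := by
  have h := one_add_pow_eq_tailPoly n (-z)
  rw [neg_sq, ← sub_eq_add_neg] at h
  rw [h, one_add_pow_eq_tailPoly n z]; ring

/-- The convergents are eventually equal to the expected value wherever the denominators,
which are multiples of `geg`, do not vanish. -/
lemma convs_tendsto_of_geg_ne_zero {n : ℕ} (hn : 1 ≤ n) {z : ℝ} (hz : 0 < z)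
    (h : ∀ᶠ N in atTop, geg n (z ^ 2) N ≠ 0) :
    Tendsto
      (GenContFract.convs
        (⟨1, Stream'.Seq.ofStream
            (fun k : ℕ =>
              ⟨((n : ℝ) ^ 2 - ((k : ℝ) + 1) ^ 2) * z ^ 2, 2 * ((k : ℝ) + 1) + 1⟩)⟩ :
          GenContFract ℝ))
      atTop
      (𝓝 ((n : ℝ) * z * ((1 + z) ^ n + (1 - z) ^ n) / ((1 + z) ^ n - (1 - z) ^ n))) := by
  set g : GenContFract ℝ := ⟨1, Stream'.Seq.ofStream
    (fun k : ℕ => ⟨((n : ℝ) ^ 2 - ((k : ℝ) + 1) ^ 2) * z ^ 2, 2 * ((k : ℝ) + 1) + 1⟩)⟩ with hg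
  have hget (m : ℕ) : g.s.get? m =
      some ⟨((n : ℝ) ^ 2 - ((m : ℝ) + 1) ^ 2) * z ^ 2, 2 * ((m : ℝ) + 1) + 1⟩ := rfl
  have hrec (m : ℕ) := GenContFract.contsAux_recurrence (hget m) rfl rfl
  set A : ℕ → ℝ := fun m => (g.contsAux m).a with hA
  set B : ℕ → ℝ := fun m => (g.contsAux m).b with hB
  have hAr (m : ℕ) :
      A (m + 2) = (2 * m + 3) * A (m + 1) + ((n : ℝ) ^ 2 - (m + 1) ^ 2) * z ^ 2 * A m := by
    simp only [hA, hrec m]; ring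
  have hBr (m : ℕ) :
      B (m + 2) = (2 * m + 3) * B (m + 1) + ((n : ℝ) ^ 2 - (m + 1) ^ 2) * z ^ 2 * B m := by
    simp only [hB, hrec m]; ring
  have hA0 : A 0 = 1 := rfl
  have hA1 : A 1 = 1 := rfl
  have hB0 : B 0 = 0 := rfl
  have hB1 : B 1 = 1 := rfl
  have hAn := cf_value hn hAr
  have hBn := cf_value hn hBr
  have h0 := scaledTail_recurrence (k := 0) (z ^ 2) hn
  have hs0 : scaledTail n (z ^ 2) 0 = tailPoly n (z ^ 2) 0 := by simp [scaledTail]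
  have hs1 : scaledTail n (z ^ 2) 1 = tailPoly n (z ^ 2) 1 := by simp [scaledTail]
  have hn0 : (0 : ℝ) < n := by exact_mod_cast hn
  have hP : 0 < tailPoly n (z ^ 2) 1 := by
    have h1 : (1 - z) ^ n < (1 + z) ^ n := by
      refine lt_of_le_of_lt (le_abs_self _) ?_
      rw [abs_pow]
      exact pow_lt_pow_left₀ (abs_lt.2 ⟨by linarith, by linarith⟩) (abs_nonneg _) (by omega)
    have h2 := tailPoly_one_eq n z
    have h3 : 0 < 2 * n * z * tailPoly n (z ^ 2) 1 := by linarith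
    exact pos_of_mul_pos_right h3 (by positivity)
  rw [hB0, hB1, hs1] at hBn
  rw [hA0, hA1] at hAn
  have hAn' : A n * scaledTail n (z ^ 2) n = tailPoly n (z ^ 2) 0 := by
    rw [hAn, ← hs0, h0]; push_cast; ring
  have hs : scaledTail n (z ^ 2) n ≠ 0 := by
    intro h; rw [h] at hBn; simp at hBn; exact hP.ne hBn
  have hBn0 : B n ≠ 0 := by
    intro h; rw [h] at hBn; simp at hBn; exact hP.ne hBn
  have hval : (n : ℝ) * z * ((1 + z) ^ n + (1 - z) ^ n) / ((1 + z) ^ n - (1 - z) ^ n)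
      = A n / B n := by
    rw [tailPoly_zero_eq, tailPoly_one_eq, ← hAn']
    have : tailPoly n (z ^ 2) 1 = B n * scaledTail n (z ^ 2) n := by rw [hBn]; ring
    rw [this]
    field_simp
  rw [hval]
  refine tendsto_const_nhds.congr' ?_
  have h2 : ∀ᶠ m in atTop, geg n (z ^ 2) (m + 1 - n) ≠ 0 :=
    ((tendsto_sub_atTop_nat n).comp (tendsto_add_atTop_nat 1)).eventually h
  filter_upwards [h2, eventually_ge_atTop n] with m hm hmn
  have hmn' : m + 1 = n + (m + 1 - n) := by omega
  rw [GenContFract.conv_eq_conts_a_div_conts_b, GenContFract.nth_cont_eq_succ_nth_contAux]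
  change A n / B n = A (m + 1) / B (m + 1)
  rw [hmn', cf_eq_geg hAr hn, cf_eq_geg hBr hn]
  have : ((m + 1 - n).factorial : ℝ) ≠ 0 := by positivity
  field_simp

end ContinuedFraction

section Recurrence

variable {F : Type*} [Field F]

lemma geg_recurrence [CharZero F] (n : ℕ) (Z : F) (k : ℕ) :
    (k + 2) * geg n Z (k + 2)
      = (2 * k + 2 * n + 3) * geg n Z (k + 1) - (k + 2 * n + 1) * Z * geg n Z k := by
  have h : (k : F) + 2 ≠ 0 := by exact_mod_cast (k + 1).succ_ne_zero
  rw [geg]; field_simp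

lemma gegSnd_recurrence [CharZero F] (n : ℕ) (Z : F) (k : ℕ) :
    (k + 2) * gegSnd n Z (k + 2)
      = (2 * k + 2 * n + 3) * gegSnd n Z (k + 1) - (k + 2 * n + 1) * Z * gegSnd n Z k := by
  have h : (k : F) + 2 ≠ 0 := by exact_mod_cast (k + 1).succ_ne_zero
  rw [gegSnd]; field_simp

lemma eq_geg_of_recurrence [CharZero F] {n : ℕ} {Z : F} {f : ℕ → F}
    (h0 : f 0 = 1) (h1 : f 1 = 2 * n + 1)
    (h : ∀ k : ℕ, (k + 2) * f (k + 2)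
      = (2 * k + 2 * n + 3) * f (k + 1) - (k + 2 * n + 1) * Z * f k) (k : ℕ) :
    f k = geg n Z k := by
  induction k using Nat.twoStepInduction with
  | zero => rw [h0, geg]
  | one => rw [h1, geg]
  | more k ih1 ih2 =>
    have h2 : (k : F) + 2 ≠ 0 := by exact_mod_cast (k + 1).succ_ne_zero
    refine mul_left_cancel₀ h2 ?_
    rw [h, geg_recurrence, ih1, ih2]

lemma eq_gegSnd_of_recurrence [CharZero F] {n : ℕ} {Z : F} {f : ℕ → F}
    (h0 : f 0 = 0) (h1 : f 1 = 1)
    (h : ∀ k : ℕ, (k + 2) * f (k + 2)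
      = (2 * k + 2 * n + 3) * f (k + 1) - (k + 2 * n + 1) * Z * f k) (k : ℕ) :
    f k = gegSnd n Z k := by
  induction k using Nat.twoStepInduction with
  | zero => rw [h0, gegSnd]
  | one => rw [h1, gegSnd]
  | more k ih1 ih2 =>
    have h2 : (k : F) + 2 ≠ 0 := by exact_mod_cast (k + 1).succ_ne_zero
    refine mul_left_cancel₀ h2 ?_
    rw [h, gegSnd_recurrence, ih1, ih2]

lemma map_geg {E : Type*} [Field E] (f : F →+* E) (n : ℕ) (Z : F) (k : ℕ) :
    f (geg n Z k) = geg n (f Z) k := by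
  induction k using Nat.twoStepInduction with
  | zero => simp [geg]
  | one => simp [geg, map_ofNat]
  | more k ih1 ih2 => simp [geg, ih1, ih2, map_ofNat]

lemma add_two_mul_ascFactorial_succ {n : ℕ} (hn : 1 ≤ n) (k : ℕ) :
    (k + 2) * (k + 1 + 2).ascFactorial (2 * n - 1)
      = (k + 2 * n + 1) * (k + 2).ascFactorial (2 * n - 1) := by
  have := Nat.succ_ascFactorial (k + 2) (2 * n - 1)
  rwa [show k + 2 + (2 * n - 1) = k + 2 * n + 1 by omega] at this

lemma geg_casoratian [CharZero F] {n : ℕ} (hn : 1 ≤ n) (Z : F) (k : ℕ) :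
    ((2 * n).factorial : F) * (geg n Z k * gegSnd n Z (k + 1) - geg n Z (k + 1) * gegSnd n Z k)
      = ((k + 2).ascFactorial (2 * n - 1) : ℕ) * Z ^ k := by
  induction k with
  | zero =>
    have := Nat.factorial_mul_ascFactorial 1 (2 * n - 1)
    rw [show 1 + (2 * n - 1) = 2 * n by omega] at this
    simp only [geg, gegSnd, zero_add]
    rw [← this]; simp
  | succ k ih =>
    have h2 : (k : F) + 2 ≠ 0 := by exact_mod_cast (k + 1).succ_ne_zero
    refine mul_left_cancel₀ h2 ?_
    have h3 : ((k : F) + 2) * ((k + 1 + 2).ascFactorial (2 * n - 1) : ℕ)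
        = (k + 2 * n + 1) * ((k + 2).ascFactorial (2 * n - 1) : ℕ) := by
      exact_mod_cast add_two_mul_ascFactorial_succ hn k
    have e1 := geg_recurrence n Z k
    have e2 := gegSnd_recurrence n Z k
    rw [pow_succ]
    linear_combination ((2 * n).factorial : F) * (geg n Z (k + 1) * e2 - gegSnd n Z (k + 1) * e1)
      + (k + 2 * n + 1) * Z * ih - Z ^ k * Z * h3

/-- The value of the Casoratian at an index where `geg` vanishes. -/
lemma geg_mul_gegSnd_of_eq_zero [CharZero F] {n : ℕ} (hn : 1 ≤ n) {Z : F} {k : ℕ}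
    (h : geg n Z (k + 1) = 0) :
    ((2 * n).factorial : F) * (geg n Z k * gegSnd n Z (k + 1))
      = ((k + 2).ascFactorial (2 * n - 1) : ℕ) * Z ^ k := by
  simpa [h] using geg_casoratian hn Z k

lemma geg_pos_of_le_one {F : Type*} [Field F] [LinearOrder F] [IsStrictOrderedRing F] (n : ℕ)
    {Z : F} (hZ : Z ≤ 1) (k : ℕ) : 0 < geg n Z k := by
  have key (k : ℕ) : 0 < geg n Z k ∧ (k + 2 * n + 1) * geg n Z k ≤ (k + 1) * geg n Z (k + 1) := by
    induction k with
    | zero => simp [geg]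
    | succ k ih =>
      obtain ⟨h1, h2⟩ := ih
      have h3 : 0 < geg n Z (k + 1) := by
        have : 0 < ((k : F) + 1) * geg n Z (k + 1) := lt_of_lt_of_le (by positivity) h2
        exact pos_of_mul_pos_right this (by positivity)
      refine ⟨h3, ?_⟩
      have e := geg_recurrence n Z k
      have h4 : (k + 2 * n + 1) * geg n Z k * Z ≤ (k + 2 * n + 1) * geg n Z k :=
        mul_le_of_le_one_right (by positivity) hZ
      push_cast
      rw [show (k : F) + 1 + 1 = k + 2 by ring, show k + 1 + 1 = k + 2 from rfl, e]
      linarith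
  exact (key k).1

lemma exists_polynomial_geg [CharZero F] (n k : ℕ) : ∃ P : Polynomial ℚ,
    P.eval 0 = geg n 0 k ∧ ∀ Z : F, geg n Z k = Polynomial.aeval Z P := by
  induction k using Nat.twoStepInduction with
  | zero => exact ⟨1, by simp [geg], by simp [geg]⟩
  | one => exact ⟨2 * (n : Polynomial ℚ) + 1, by simp [geg], by simp [geg, map_ofNat]⟩
  | more k ih1 ih2 =>
    obtain ⟨P, hP0, hP⟩ := ih1
    obtain ⟨Q, hQ0, hQ⟩ := ih2
    refine ⟨Polynomial.C ((k + 2 : ℚ)⁻¹) *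
      ((2 * (k : Polynomial ℚ) + 2 * (n : Polynomial ℚ) + 3) * Q
        - ((k : Polynomial ℚ) + 2 * (n : Polynomial ℚ) + 1) * Polynomial.X * P), ?_, fun Z => ?_⟩
    · simp [geg, hQ0, ← hP0, div_eq_inv_mul]
    · simp [geg, hQ, hP, div_eq_inv_mul, map_ofNat]

lemma geg_ne_zero_of_transcendental [CharZero F] {n : ℕ} {Z : F} (hZ : Transcendental ℚ Z)
    (k : ℕ) : geg n Z k ≠ 0 := by
  obtain ⟨P, h0, hP⟩ := exists_polynomial_geg (F := F) n k
  intro h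
  have hP0 : P = 0 := by
    by_contra hne
    exact hZ ⟨P, hne, by rw [← hP, h]⟩
  have := geg_pos_of_le_one n (zero_le_one : (0 : ℚ) ≤ 1) k
  rw [← h0, hP0] at this
  simp at this

end Recurrence

section GeneratingFunction

open PowerSeries

variable {F : Type*} [Field F]

/-- Coefficients of the power series `σ` with `σ = q + y * σ + y ^ 2 * σ ^ 2`. -/
def quadCoeff (q : F) : ℕ → F
  | 0 => q
  | k + 1 => quadCoeff q k + ∑ i : Fin k, quadCoeff q i * quadCoeff q (k - 1 - i)

noncomputable def quadSeries (q : F) : F⟦X⟧ := PowerSeries.mk (quadCoeff q)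

lemma quadSeries_eq (q : F) :
    quadSeries q = C q + X * quadSeries q + X ^ 2 * quadSeries q ^ 2 := by
  ext k
  match k with
  | 0 => simp [quadSeries, quadCoeff]
  | 1 =>
    rw [pow_two, mul_assoc]
    simp [quadSeries, quadCoeff, coeff_succ_X_mul]
  | k + 2 =>
    rw [map_add, map_add, coeff_C, if_neg (by omega), coeff_succ_X_mul, pow_two X, mul_assoc,
      coeff_succ_X_mul, coeff_succ_X_mul, pow_two, coeff_mul,
      Finset.Nat.sum_antidiagonal_eq_sum_range_succ_mk]
    simp only [quadSeries, coeff_mk]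
    rw [quadCoeff, zero_add, ← Fin.sum_univ_eq_sum_range
      (fun i => quadCoeff q i * quadCoeff q (k - i))]
    simp

/-- A square root of `1 - 2 * y + (1 - 4 * q) * y ^ 2`. -/
noncomputable def sqrtSeries (q : F) : F⟦X⟧ := 1 - X - 2 * X ^ 2 * quadSeries q

lemma sqrtSeries_sq (q : F) : sqrtSeries q ^ 2 = 1 - 2 * X + C (1 - 4 * q) * X ^ 2 := by
  have h := quadSeries_eq q
  have h4 : C (1 - 4 * q) = 1 - 4 * C q := by simp [map_ofNat]
  rw [sqrtSeries, h4]
  linear_combination -4 * X ^ 2 * h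

lemma constantCoeff_sqrtSeries (q : F) : constantCoeff (sqrtSeries q) = 1 := by
  simp [sqrtSeries]

lemma sqrtSeries_mul_inv (q : F) : sqrtSeries q * (sqrtSeries q)⁻¹ = 1 :=
  PowerSeries.mul_inv_cancel _ (by rw [constantCoeff_sqrtSeries]; exact one_ne_zero)

variable [CharZero F]

lemma sqrtSeries_mul_derivative (q : F) :
    sqrtSeries q * d⁄dX F (sqrtSeries q) = -(1 - C (1 - 4 * q) * X) := by
  have h := congrArg (d⁄dX F) (sqrtSeries_sq q)
  generalize 1 - 4 * q = Z at *
  have e2 : d⁄dX F (2 : F⟦X⟧) = 0 := by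
    have := PowerSeries.derivative_C (R := F) (r := 2)
    rwa [map_ofNat] at this
  simp only [map_add, map_sub, Derivation.leibniz, Derivation.leibniz_pow, derivative_C,
    derivative_X, smul_eq_mul, Derivation.map_one_eq_zero, e2] at h
  have h2 : (C (2 : F)) * C (2 : F)⁻¹ = 1 := by rw [← map_mul]; simp
  have h3 : (C (2 : F)) = 2 := map_ofNat _ 2
  rw [h3] at h2
  simp only [nsmul_eq_mul] at h
  push_cast at h
  simp only [pow_one] at h
  linear_combination C (2 : F)⁻¹ * h - (sqrtSeries q * d⁄dX F (sqrtSeries q) +(1 - C Z * X)) * h2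

lemma derivative_sqrtSeries_inv (q : F) :
    sqrtSeries q ^ 3 * d⁄dX F (sqrtSeries q)⁻¹ = 1 - C (1 - 4 * q) * X := by
  have h1 := sqrtSeries_mul_inv q
  have h2 := sqrtSeries_mul_derivative q
  have h3 := congrArg (d⁄dX F) h1
  simp only [Derivation.leibniz, smul_eq_mul, Derivation.map_one_eq_zero] at h3
  linear_combination sqrtSeries q ^ 2 * h3 - h2 - sqrtSeries q * d⁄dX F (sqrtSeries q) * h1

/-- The recurrence satisfied by the coefficients of a solution of the differential equation of
`(1 - 2 * y + Z * y ^ 2) ^ (-(n + 1 / 2))`. -/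
lemma coeff_recurrence_of_ode {n : ℕ} {Z a : F} {f : F⟦X⟧}
    (h : (1 - 2 * X + C Z * X ^ 2) * d⁄dX F f = (2 * (n : F⟦X⟧) + 1) * (1 - C Z * X) * f + C a) :
    coeff 1 f = (2 * n + 1) * coeff 0 f + a ∧ ∀ k : ℕ, (k + 2) * coeff (k + 2) f
      = (2 * k + 2 * n + 3) * coeff (k + 1) f - (k + 2 * n + 1) * Z * coeff k f := by
  have e2 : (2 : F⟦X⟧) = C (2 : F) := (map_ofNat _ 2).symm
  have e3 : (2 * (n : F⟦X⟧) + 1) = C (2 * n + 1 : F) := by simp [map_ofNat]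
  have hl : (1 - 2 * X + C Z * X ^ 2) * d⁄dX F f
      = d⁄dX F f - C (2 : F) * (X * d⁄dX F f) + C Z * (X * (X * d⁄dX F f)) := by
    rw [e2]; ring
  have hr : (2 * (n : F⟦X⟧) + 1) * (1 - C Z * X) * f + C a
      = C (2 * n + 1 : F) * f - C ((2 * n + 1 : F) * Z) * (X * f) + C a := by
    rw [e3, map_mul]; ring
  rw [hl, hr] at h
  clear hl hr e3
  generalize hc : 2 * (n : F) + 1 = c at *
  constructor
  · have h0 := congrArg (coeff 0) h
    simp only [map_add, map_sub, coeff_C_mul, coeff_zero_X_mul, coeff_derivative, coeff_zero_C,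
      mul_zero, sub_zero, add_zero] at h0
    simpa using h0
  · intro k
    have hk := congrArg (coeff (k + 1)) h
    simp only [map_add, map_sub, coeff_C_mul, coeff_succ_X_mul, coeff_derivative, coeff_C,
      Nat.succ_ne_zero, if_false, add_zero] at hk
    have hX : coeff k (X * d⁄dX F f) = k * coeff k f := by
      cases k with
      | zero => simp
      | succ k => rw [coeff_succ_X_mul, coeff_derivative]; push_cast; ring
    rw [hX, show k + 1 + 1 = k + 2 from rfl] at hk
    push_cast at hk
    linear_combination hk + (coeff (k + 1) f - Z * coeff k f) * (-hc)

noncomputable def gegSeries (n : ℕ) (q : F) : F⟦X⟧ := (sqrtSeries q)⁻¹ ^ (2 * n + 1)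

lemma gegSeries_ode (n : ℕ) (q : F) : (1 - 2 * X + C (1 - 4 * q) * X ^ 2) * d⁄dX F (gegSeries n q)
    = (2 * (n : F⟦X⟧) + 1) * (1 - C (1 - 4 * q) * X) * gegSeries n q := by
  have h1 := sqrtSeries_mul_inv q
  have h2 := derivative_sqrtSeries_inv q
  rw [← sqrtSeries_sq, gegSeries, Derivation.leibniz_pow, Nat.add_sub_cancel, ← h2]
  simp only [smul_eq_mul, nsmul_eq_mul]
  push_cast
  rw [pow_succ _ (2 * n)]
  linear_combination -sqrtSeries q ^ 2
    * ((2 * (n : F⟦X⟧) + 1) * ((sqrtSeries q)⁻¹ ^ (2 * n) * d⁄dX F (sqrtSeries q)⁻¹)) * h1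

lemma coeff_gegSeries (n : ℕ) (q : F) (k : ℕ) :
    coeff k (gegSeries n q) = geg n (1 - 4 * q) k := by
  have h := coeff_recurrence_of_ode (n := n) (Z := 1 - 4 * q) (a := 0) (f := gegSeries n q)
    (by rw [gegSeries_ode, map_zero, add_zero])
  have h0 : coeff 0 (gegSeries n q) = 1 := by
    simp [gegSeries, constantCoeff_sqrtSeries, PowerSeries.constantCoeff_inv]
  exact eq_geg_of_recurrence (f := fun k => coeff k (gegSeries n q)) h0
    (by simpa [h0] using h.1) h.2 k

/-- The formal antiderivative of `sqrtSeries q ^ (2 * n - 1)`. -/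
noncomputable def sqrtPowIntegral (n : ℕ) (q : F) : F⟦X⟧ :=
  PowerSeries.mk fun k => coeff (k - 1) (sqrtSeries q ^ (2 * n - 1)) / k

lemma derivative_sqrtPowIntegral (n : ℕ) (q : F) :
    d⁄dX F (sqrtPowIntegral n q) = sqrtSeries q ^ (2 * n - 1) := by
  ext k
  have : (k : F) + 1 ≠ 0 := by exact_mod_cast k.succ_ne_zero
  rw [coeff_derivative, sqrtPowIntegral, coeff_mk]
  push_cast
  field_simp

lemma coeff_gegSeries_mul_integral {n : ℕ} (hn : 1 ≤ n) (q : F) (k : ℕ) :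
    coeff k (gegSeries n q * sqrtPowIntegral n q) = gegSnd n (1 - 4 * q) k := by
  have h0 : coeff 0 (gegSeries n q * sqrtPowIntegral n q) = 0 := by
    simp [sqrtPowIntegral, coeff_mul]
  have hone : sqrtSeries q ^ 2 * (gegSeries n q * sqrtSeries q ^ (2 * n - 1)) = 1 := by
    obtain ⟨m, rfl⟩ : ∃ m, n = m + 1 := ⟨n - 1, by omega⟩
    rw [gegSeries, show 2 * (m + 1) - 1 = 2 * m + 1 by omega]
    calc _ = (sqrtSeries q * (sqrtSeries q)⁻¹) ^ (2 * (m + 1) + 1) := by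
          rw [mul_pow]; ring
      _ = 1 := by rw [sqrtSeries_mul_inv, one_pow]
  have h := coeff_recurrence_of_ode (n := n) (Z := 1 - 4 * q) (a := 1)
    (f := gegSeries n q * sqrtPowIntegral n q) (by
      have h1 := gegSeries_ode n q
      have h2 := sqrtSeries_sq q
      rw [Derivation.leibniz, derivative_sqrtPowIntegral, map_one]
      simp only [smul_eq_mul]
      linear_combination sqrtPowIntegral n q * h1 + hone
        - gegSeries n q * sqrtSeries q ^ (2 * n - 1) * h2)
  exact eq_gegSnd_of_recurrence
    (f := fun k => coeff k (gegSeries n q * sqrtPowIntegral n q)) h0 (by simpa [h0] using h.1) h.2 k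

lemma gegSnd_eq_sum {n : ℕ} (hn : 1 ≤ n) (q : F) (k : ℕ) :
    gegSnd n (1 - 4 * q) k = ∑ p ∈ Finset.HasAntidiagonal.antidiagonal k,
      geg n (1 - 4 * q) p.1 * (coeff (p.2 - 1) (sqrtSeries q ^ (2 * n - 1)) / p.2) := by
  rw [← coeff_gegSeries_mul_integral hn, coeff_mul]
  exact Finset.sum_congr rfl fun p _ => by rw [coeff_gegSeries, sqrtPowIntegral, coeff_mk]

end GeneratingFunction

section Nonarchimedean

open PowerSeries

variable {F : Type*} [Field F] {v : AbsoluteValue F ℝ}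

lemma IsNonarchimedean.abv_sum_le (hv : IsNonarchimedean v) {ι : Type*} {s : Finset ι}
    {f : ι → F} {C : ℝ} (hC : 0 ≤ C) (h : ∀ i ∈ s, v (f i) ≤ C) : v (∑ i ∈ s, f i) ≤ C := by
  rcases s.eq_empty_or_nonempty with rfl | hs
  · simpa using hC
  · exact (hv.apply_sum_le_sup hs).trans (Finset.sup'_le _ _ h)

lemma IsNonarchimedean.abv_sum_lt (hv : IsNonarchimedean v) {ι : Type*} {s : Finset ι}
    {f : ι → F} {C : ℝ} (hC : 0 < C) (h : ∀ i ∈ s, v (f i) < C) : v (∑ i ∈ s, f i) < C := by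
  rcases s.eq_empty_or_nonempty with rfl | hs
  · simpa using hC
  · exact (hv.apply_sum_le_sup hs).trans_lt ((Finset.sup'_lt_iff _).2 h)

lemma IsNonarchimedean.abv_sub_le (hv : IsNonarchimedean v) (x y : F) :
    v (x - y) ≤ max (v x) (v y) := by
  rw [sub_eq_add_neg, ← v.map_neg y]; exact hv _ _

lemma IsNonarchimedean.abv_natCast_le (hv : IsNonarchimedean v) (k : ℕ) : v (k : F) ≤ 1 :=
  hv.apply_natCast_le_one

/-- Power series whose coefficients grow at most like `H ^ k`. -/
def growthSubring (hv : IsNonarchimedean v) {H : ℝ} (hH : 0 ≤ H) : Subring F⟦X⟧ where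
  carrier := {f | ∀ k, v (coeff k f) ≤ H ^ k}
  zero_mem' k := by simpa using pow_nonneg hH k
  one_mem' k := by
    rw [coeff_one]; split_ifs with h
    · simp [h]
    · simpa using pow_nonneg hH k
  neg_mem' {f} hf k := by simpa using hf k
  add_mem' {f g} hf hg k := by
    rw [map_add]; exact (hv _ _).trans (max_le (hf k) (hg k))
  mul_mem' {f g} hf hg k := by
    rw [coeff_mul]
    refine hv.abv_sum_le (pow_nonneg hH k) fun p hp => ?_
    rw [← Finset.HasAntidiagonal.mem_antidiagonal.1 hp, pow_add, map_mul]
    exact mul_le_mul (hf _) (hg _) (apply_nonneg _ _) (pow_nonneg hH _)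

variable (hv : IsNonarchimedean v) {H : ℝ}

lemma inv_mem_growthSubring {hH : 0 ≤ H} {f : F⟦X⟧} (hf : f ∈ growthSubring hv hH)
    (h0 : constantCoeff f = 1) : f⁻¹ ∈ growthSubring hv hH := by
  intro k
  induction k using Nat.strong_induction_on with
  | _ k ih =>
    rw [coeff_inv, h0]
    split_ifs with h
    · simp [h]
    · rw [inv_one, neg_one_mul, v.map_neg]
      refine hv.abv_sum_le (pow_nonneg hH k) fun p hp => ?_
      split_ifs with hlt
      · rw [← Finset.HasAntidiagonal.mem_antidiagonal.1 hp, pow_add, map_mul]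
        exact mul_le_mul (hf _) (ih _ hlt) (apply_nonneg _ _) (pow_nonneg hH _)
      · simpa using pow_nonneg hH k

include hv in
lemma abv_quadCoeff_le (hH : 1 ≤ H) {q : F} (hq : v q ≤ H ^ 2) (k : ℕ) :
    v (quadCoeff q k) ≤ H ^ (k + 2) := by
  have hH0 : 0 ≤ H := by linarith
  induction k using Nat.strong_induction_on with
  | _ k ih =>
    match k, ih with
    | 0, _ => simpa [quadCoeff] using hq
    | k + 1, ih =>
      rw [quadCoeff]
      refine (hv _ _).trans (max_le ((ih k (by omega)).trans
        (pow_le_pow_right₀ hH (by omega))) ?_)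
      refine hv.abv_sum_le (pow_nonneg hH0 _) fun i _ => ?_
      have hi := i.2
      rw [map_mul, show k + 1 + 2 = (i + 2) + (k - 1 - i + 2) by omega, pow_add]
      exact mul_le_mul (ih _ (by omega)) (ih _ (by omega)) (apply_nonneg _ _) (pow_nonneg hH0 _)

lemma sqrtSeries_mem_growthSubring (hH : 1 ≤ H) {q : F} (hq : v q ≤ H ^ 2) :
    sqrtSeries q ∈ growthSubring hv (zero_le_one.trans hH) := by
  have hH0 : 0 ≤ H := by linarith
  have hX : (X : F⟦X⟧) ∈ growthSubring hv hH0 := by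
    intro k
    rw [coeff_X]; split_ifs with h
    · simpa [h] using hH
    · simpa using pow_nonneg hH0 k
  have hs : X ^ 2 * quadSeries q ∈ growthSubring hv hH0 := by
    intro k
    rw [coeff_X_pow_mul']
    split_ifs with h
    · obtain ⟨j, rfl⟩ := Nat.exists_eq_add_of_le' h
      rw [Nat.add_sub_cancel, quadSeries, coeff_mk]
      exact abv_quadCoeff_le hv hH hq j
    · simpa using pow_nonneg hH0 k
  have h2 : (2 : F⟦X⟧) ∈ growthSubring hv hH0 := ofNat_mem _ 2
  rw [sqrtSeries, mul_assoc]
  exact sub_mem (sub_mem (one_mem _) hX) (mul_mem h2 hs)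

lemma sqrtSeries_inv_mem_growthSubring (hH : 1 ≤ H) {q : F} (hq : v q ≤ H ^ 2) :
    (sqrtSeries q)⁻¹ ∈ growthSubring hv (zero_le_one.trans hH) :=
  inv_mem_growthSubring hv (sqrtSeries_mem_growthSubring hv hH hq) (constantCoeff_sqrtSeries q)

variable [CharZero F]

include hv in
lemma abv_geg_le (hH : 1 ≤ H) {q : F} (hq : v q ≤ H ^ 2) (n k : ℕ) :
    v (geg n (1 - 4 * q) k) ≤ H ^ k := by
  rw [← coeff_gegSeries]
  exact pow_mem (sqrtSeries_inv_mem_growthSubring hv hH hq) _ k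

include hv in
lemma abv_gegSnd_le (hH : 1 ≤ H) {q : F} (hq : v q ≤ H ^ 2) {n : ℕ} (hn : 1 ≤ n) {k : ℕ} {δ : ℝ}
    (hδ : 0 < δ) (h : ∀ j, 1 ≤ j → j ≤ k + 1 → δ ≤ v (j : F)) :
    v (gegSnd n (1 - 4 * q) (k + 1)) * δ ≤ H ^ k := by
  have hH0 : 0 ≤ H := by linarith
  rw [← le_div_iff₀ hδ, gegSnd_eq_sum hn]
  refine hv.abv_sum_le (by positivity) fun p hp => ?_
  have hp' := Finset.HasAntidiagonal.mem_antidiagonal.1 hp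
  rcases Nat.eq_zero_or_pos p.2 with h0 | h0
  · rw [h0]; simp; positivity
  · have h1 : δ ≤ v (p.2 : F) := h _ h0 (by omega)
    have h2 : v (coeff (p.2 - 1) (sqrtSeries q ^ (2 * n - 1))) ≤ H ^ (p.2 - 1) :=
      pow_mem (sqrtSeries_mem_growthSubring hv hH hq) _ _
    rw [map_mul, map_div₀, show k = p.1 + (p.2 - 1) by omega, pow_add, mul_div_assoc]
    exact mul_le_mul (abv_geg_le hv hH hq n _) (div_le_div₀ (by positivity) h2 hδ h1)
      (by positivity) (by positivity)

include hv in
/-- If `geg` vanishes at `k + 1`, then it is not too small at `k`. -/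
lemma le_abv_geg_of_eq_zero (hH : 1 ≤ H) {q : F} (hq : v q ≤ H ^ 2) (hZ : v (1 - 4 * q) = H ^ 2)
    {n : ℕ} (hn : 1 ≤ n) {k : ℕ} {δ : ℝ} (hδ : 0 < δ)
    (h : ∀ j, 1 ≤ j → j ≤ k + 1 → δ ≤ v (j : F)) (h0 : geg n (1 - 4 * q) (k + 1) = 0) :
    δ * v (((k + 2).ascFactorial (2 * n - 1) : ℕ) : F) * H ^ k ≤ v (geg n (1 - 4 * q) k) := by
  have hH0 : 0 < H := by linarith
  have e := congrArg v (geg_mul_gegSnd_of_eq_zero hn h0)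
  have hb := abv_gegSnd_le hv hH hq hn hδ h
  have hf := hv.abv_natCast_le (2 * n).factorial
  simp only [map_mul, map_pow, hZ] at e
  have hpow : 0 < H ^ k := by positivity
  have h1 : v (geg n (1 - 4 * q) k) * v (gegSnd n (1 - 4 * q) (k + 1)) * δ
      ≤ v (geg n (1 - 4 * q) k) * H ^ k := by
    rw [mul_assoc]; exact mul_le_mul_of_nonneg_left hb (apply_nonneg _ _)
  have h2 : v (((2 * n).factorial : ℕ) : F)
        * (v (geg n (1 - 4 * q) k) * v (gegSnd n (1 - 4 * q) (k + 1)))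
      ≤ v (geg n (1 - 4 * q) k) * v (gegSnd n (1 - 4 * q) (k + 1)) :=
    mul_le_of_le_one_left (mul_nonneg (apply_nonneg _ _) (apply_nonneg _ _)) hf
  rw [e] at h2
  refine le_of_mul_le_mul_right ?_ hpow
  calc _ = v (((k + 2).ascFactorial (2 * n - 1) : ℕ) : F) * (H ^ 2) ^ k * δ := by ring
    _ ≤ _ := (mul_le_mul_of_nonneg_right h2 hδ.le).trans h1

omit [CharZero F] in
lemma coeff_quadratic_pow_eq_zero {Z : F} {h m : ℕ} (hm : 2 * h < m) :
    coeff m ((1 - 2 * X + C Z * X ^ 2 : F⟦X⟧) ^ h) = 0 := by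
  have : ((1 - 2 * X + C Z * X ^ 2 : F⟦X⟧) ^ h)
      = (((1 - 2 * Polynomial.X + Polynomial.C Z * Polynomial.X ^ 2) ^ h : Polynomial F) :
          F⟦X⟧) := by
    have e2 : ((2 : Polynomial F) : F⟦X⟧) = 2 := map_ofNat Polynomial.coeToPowerSeries.ringHom 2
    simp [e2]
  rw [this, Polynomial.coeff_coe]
  refine Polynomial.coeff_eq_zero_of_natDegree_lt (lt_of_le_of_lt ?_ hm)
  refine Polynomial.natDegree_pow_le.trans ?_
  rw [mul_comm]
  refine Nat.mul_le_mul_right _ ?_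
  compute_degree

include hv in
/-- Modulo a prime `ℓ`, the coefficient of index `ℓ` of `(1 - 2 * y + Z * y ^ 2) ^ (-(n + 1 / 2))`
is `1`. -/
lemma abv_geg_prime_sub_one_lt {q : F} (hq : v q ≤ 1) {n h : ℕ}
    (hl : (2 * h + 2 * n + 1).Prime) (hvl : v ((2 * h + 2 * n + 1 : ℕ) : F) < 1) :
    v (geg n (1 - 4 * q) (2 * h + 2 * n + 1) - 1) < 1 := by
  set l := 2 * h + 2 * n + 1 with hl_def
  set A := growthSubring hv (zero_le_one' ℝ) with hA
  have hq' : v q ≤ 1 ^ 2 := by simpa using hq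
  have hSmem : sqrtSeries q ∈ A := sqrtSeries_mem_growthSubring hv le_rfl hq'
  have hTmem : (sqrtSeries q)⁻¹ ∈ A := sqrtSeries_inv_mem_growthSubring hv le_rfl hq'
  have hST := sqrtSeries_mul_inv q
  have hT1 : coeff 1 (sqrtSeries q)⁻¹ = 1 := by
    have := coeff_gegSeries 0 q 1
    simpa [gegSeries, geg] using this
  have hT0 : coeff 0 (sqrtSeries q)⁻¹ = 1 := by
    have := coeff_gegSeries 0 q 0
    simpa only [gegSeries, geg, mul_zero, zero_add, pow_one] using this
  set T := (sqrtSeries q)⁻¹ with hT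
  set G : F⟦X⟧ := PowerSeries.mk fun k => coeff (k + 1) T with hG
  have hTG : T = 1 + X * G := by
    ext k
    cases k with
    | zero => rw [hT0]; simp
    | succ k => rw [map_add, coeff_succ_X_mul, hG, coeff_mk, coeff_one]; simp
  have hGmem : X * G ∈ A := by
    have : X * G = T - 1 := by rw [hTG]; ring
    rw [this]; exact sub_mem hTmem (one_mem _)
  obtain ⟨r, hr⟩ := exists_add_pow_prime_eq hl (1 : A) ⟨X * G, hGmem⟩
  have hr' := congrArg (Subtype.val) hr
  simp only [Subring.coe_add, Subring.coe_mul, Subring.coe_pow, Subring.coe_one, one_pow,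
    Subring.coe_natCast, mul_one] at hr'
  rw [← hTG] at hr'
  have hC : gegSeries n q = sqrtSeries q ^ (2 * h) * T ^ l := by
    rw [gegSeries, hl_def]
    calc _ = (sqrtSeries q * T) ^ (2 * h) * T ^ (2 * n + 1) := by rw [hST, one_pow, one_mul]
      _ = _ := by rw [mul_pow]; ring
  have hsplit : gegSeries n q = sqrtSeries q ^ (2 * h) + X ^ l * (sqrtSeries q ^ (2 * h) * G ^ l)
      + C (l : F) * (sqrtSeries q ^ (2 * h) * (X * G) * (r : F⟦X⟧)) := by
    rw [hC, hr', mul_pow, map_natCast]; ring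
  have hcoeff : geg n (1 - 4 * q) l - 1
      = l * coeff l (sqrtSeries q ^ (2 * h) * (X * G) * (r : F⟦X⟧)) := by
    rw [← coeff_gegSeries, hsplit, map_add, map_add, coeff_C_mul, pow_mul (sqrtSeries q) 2,
      sqrtSeries_sq, coeff_quadratic_pow_eq_zero (by omega), ← sqrtSeries_sq]
    have : coeff l (X ^ l * ((sqrtSeries q ^ 2) ^ h * G ^ l)) = 1 := by
      rw [coeff_X_pow_mul', if_pos le_rfl, Nat.sub_self]
      simp [constantCoeff_sqrtSeries, hG, hT1]
    rw [this]; ring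
  rw [hcoeff, map_mul]
  have hmem : sqrtSeries q ^ (2 * h) * (X * G) * (r : F⟦X⟧) ∈ A :=
    mul_mem (mul_mem (pow_mem hSmem _) hGmem) r.2
  have := hmem l
  rw [one_pow] at this
  exact lt_of_le_of_lt (mul_le_of_le_one_right (apply_nonneg _ _) this) hvl

end Nonarchimedean

section GoodPlaces

variable {F : Type*} [Field F] {v : AbsoluteValue F ℝ} (hv : IsNonarchimedean v)

include hv in
lemma abv_natCast_eq_one_of_coprime {p m : ℕ} (hp : v (p : F) < 1) (h : m.Coprime p) :
    v (m : F) = 1 := by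
  refine le_antisymm (hv.abv_natCast_le m) ?_
  by_contra! hm
  have hb := Nat.gcd_eq_gcd_ab m p
  rw [h] at hb
  have h1 : (1 : F) = m * ((m.gcdA p : ℤ) : F) + p * ((m.gcdB p : ℤ) : F) := by
    simpa using congrArg (Int.cast : ℤ → F) hb
  have hi (a : ℤ) : v (a : F) ≤ 1 := hv.apply_intCast_le_one
  have h2 : v (1 : F) < 1 := by
    rw [h1]
    refine (hv _ _).trans_lt (max_lt ?_ ?_) <;> rw [map_mul]
    · exact (mul_le_of_le_one_right (apply_nonneg _ _) (hi _)).trans_lt hm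
    · exact (mul_le_of_le_one_right (apply_nonneg _ _) (hi _)).trans_lt hp
  rw [map_one] at h2
  exact lt_irrefl _ h2

include hv in
lemma abv_natCast_le_of_dvd {a b : ℕ} (h : a ∣ b) : v (b : F) ≤ v (a : F) := by
  obtain ⟨c, rfl⟩ := h
  rw [Nat.cast_mul, map_mul]
  exact mul_le_of_le_one_right (apply_nonneg _ _) (hv.abv_natCast_le c)

include hv in
lemma abv_natCast_eq_pow {p : ℕ} (hpp : p.Prime) (hp : v (p : F) < 1) {j : ℕ} (hj : j ≠ 0) :
    v (j : F) = v (p : F) ^ (j.factorization p) := by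
  conv_lhs => rw [← Nat.ordProj_mul_ordCompl_eq_self j p]
  rw [Nat.cast_mul, map_mul, Nat.cast_pow, map_pow,
    abv_natCast_eq_one_of_coprime hv hp (Nat.coprime_ordCompl hpp hj).symm, mul_one]

/-- A multiple of the parts supported at primes `≤ N / 2` of all integers up to `N`. -/
def lcmPart (N : ℕ) : ℕ :=
  primorial (N / 2) * ∏ i ∈ Finset.Icc 1 N.sqrt, i ^ Nat.log i N

lemma lcmPart_pos (N : ℕ) : 0 < lcmPart N :=
  Nat.mul_pos (primorial_pos _) (Finset.prod_pos fun _ hi =>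
    Nat.pow_pos (Finset.mem_Icc.1 hi).1)

include hv in
lemma abv_lcmPart_le {p : ℕ} (hpp : p.Prime) (hp : v (p : F) < 1) {N j : ℕ} (hpN : p ≤ N / 2)
    (hj : 1 ≤ j) (hjN : j ≤ N) : v (lcmPart N : F) ≤ v (j : F) := by
  rw [abv_natCast_eq_pow hv hpp hp (by omega : j ≠ 0), ← map_pow, ← Nat.cast_pow]
  refine abv_natCast_le_of_dvd hv ?_
  have hle : p ^ j.factorization p ≤ N := (Nat.ordProj_le p (by omega)).trans hjN
  rcases le_or_gt p N.sqrt with h | h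
  · refine Dvd.dvd.mul_left ?_ _
    refine dvd_trans ?_ (Finset.dvd_prod_of_mem _ (Finset.mem_Icc.2 ⟨hpp.one_le, h⟩))
    exact pow_dvd_pow _ (Nat.le_log_of_pow_le hpp.one_lt hle)
  · refine Dvd.dvd.mul_right ?_ _
    have ha : j.factorization p ≤ 1 := by
      by_contra! h2
      have h3 : p ^ 2 ≤ N := (Nat.pow_le_pow_right hpp.pos h2).trans hle
      have h4 := Nat.sqrt_lt'.1 h
      omega
    refine dvd_trans (pow_dvd_pow _ ha) ?_
    rw [pow_one]
    exact Finset.dvd_prod_of_mem _ (by simp [hpp]; omega)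

/-- A lower bound, at all but finitely many places, for the coefficient preceding a vanishing
one. -/
def gegBound (n N : ℕ) : ℕ := lcmPart N * ((N + 1).ascFactorial (2 * n - 1)) ^ 2

variable [CharZero F]

include hv in
lemma one_le_abv_geg_of_eq_zero {q : F} (hq : v q ≤ 1) (hZ : v (1 - 4 * q) = 1) {n h k : ℕ}
    (hl : (2 * h + 2 * n + 1).Prime) (hvl : v ((2 * h + 2 * n + 1 : ℕ) : F) < 1)
    (h1 : 2 * h + 2 * n + 1 ≤ k + 1) (h2 : k + 2 * n < 2 * (2 * h + 2 * n + 1))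
    (h0 : geg n (1 - 4 * q) (k + 1) = 0) : 1 ≤ v (geg n (1 - 4 * q) k) := by
  by_contra! hlt
  have hprime := abv_geg_prime_sub_one_lt hv hq hl hvl
  set l := 2 * h + 2 * n + 1 with hl_def
  have key : ∀ i j : ℕ, j + i = k → l ≤ j →
      v (geg n (1 - 4 * q) j) < 1 ∧ v (geg n (1 - 4 * q) (j + 1)) < 1 := by
    intro i
    induction i with
    | zero => rintro j rfl _; exact ⟨hlt, by rw [add_zero] at h0; simp [h0]⟩
    | succ i ih =>
      intro j hj hlj
      obtain ⟨e1, e2⟩ := ih (j + 1) (by omega) (by omega)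
      refine ⟨?_, e1⟩
      have hr := geg_recurrence n (1 - 4 * q) j
      have hcop : (j + 2 * n + 1).Coprime l := by
        refine ((Nat.Prime.coprime_iff_not_dvd hl).2 fun hd => ?_).symm
        obtain ⟨c, hc⟩ := hd
        have : 1 < c := by by_contra! h; interval_cases c <;> omega
        have : c < 2 := by by_contra! h; nlinarith
        omega
      have h3 := abv_natCast_eq_one_of_coprime hv hvl hcop
      have h4 : v (geg n (1 - 4 * q) j)
          = v (((j + 2 * n + 1 : ℕ) : F) * (1 - 4 * q) * geg n (1 - 4 * q) j) := by
        rw [map_mul, map_mul, h3, hZ]; simp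
      have h5 : ((j + 2 * n + 1 : ℕ) : F) * (1 - 4 * q) * geg n (1 - 4 * q) j
          = ((2 * j + 2 * n + 3 : ℕ) : F) * geg n (1 - 4 * q) (j + 1)
            - ((j + 2 : ℕ) : F) * geg n (1 - 4 * q) (j + 2) := by
        push_cast; linear_combination hr
      rw [h4, h5]
      refine (hv.abv_sub_le _ _).trans_lt (max_lt ?_ ?_) <;> rw [map_mul]
      · exact (mul_le_of_le_one_left (apply_nonneg _ _) (hv.abv_natCast_le _)).trans_lt e1
      · exact (mul_le_of_le_one_left (apply_nonneg _ _) (hv.abv_natCast_le _)).trans_lt e2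
  have hc : v (geg n (1 - 4 * q) l) < 1 := by
    rcases Nat.lt_or_ge k l with hkl | hkl
    · rw [show l = k + 1 by omega, h0]; simp
    · exact (key (k - l) l (by omega) le_rfl).1
  have : v (1 : F) < 1 := by
    rw [show (1 : F) = geg n (1 - 4 * q) l - (geg n (1 - 4 * q) l - 1) by ring]
    exact (hv.abv_sub_le _ _).trans_lt (max_lt hc hprime)
  rw [map_one] at this
  exact lt_irrefl _ this

include hv in
lemma gegBound_le_abv_geg {p : ℕ} (hpp : p.Prime) (hp : v (p : F) < 1) {H : ℝ} (hH : 1 ≤ H)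
    {q : F} (hq : v q ≤ H ^ 2) (hZ : v (1 - 4 * q) = H ^ 2) {n : ℕ} (hn : 1 ≤ n) {k : ℕ}
    (hk : 4 * n + 4 ≤ k) (hlarge : (k + 1) / 2 < p → H = 1)
    (h0 : geg n (1 - 4 * q) (k + 1) = 0) :
    v (gegBound n (k + 1) : F) * H ^ k ≤ v (geg n (1 - 4 * q) k) := by
  have hH0 : 0 ≤ H ^ k := by positivity
  rw [gegBound]
  push_cast
  rw [map_mul, map_pow]
  set a := (k + 1 + 1).ascFactorial (2 * n - 1) with ha
  have ha1 : v (a : F) ≤ 1 := hv.abv_natCast_le a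
  have ha0 : 0 ≤ v (a : F) := apply_nonneg _ _
  have ha2 : v (a : F) ^ 2 ≤ v (a : F) := by nlinarith
  have hL1 : v (lcmPart (k + 1) : F) ≤ 1 := hv.abv_natCast_le _
  have hL0 : 0 < v (lcmPart (k + 1) : F) :=
    v.pos (by exact_mod_cast (lcmPart_pos (k + 1)).ne')
  have hgood {δ : ℝ} (hδ : 0 < δ) (h : ∀ j, 1 ≤ j → j ≤ k + 1 → δ ≤ v (j : F)) :
      δ * v (a : F) * H ^ k ≤ v (geg n (1 - 4 * q) k) :=
    le_abv_geg_of_eq_zero hv hH hq hZ hn hδ h h0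
  rcases le_or_gt p ((k + 1) / 2) with h | h
  · refine le_trans ?_ (hgood hL0 fun j hj hj' => abv_lcmPart_le hv hpp hp h hj hj')
    gcongr
  have hH1 := hlarge h
  subst hH1
  simp only [one_pow, mul_one] at hgood ⊢ hq hZ
  rcases lt_or_ge (k + 1) p with h' | h'
  · refine le_trans ?_ (hgood one_pos fun j hj hj' => ?_)
    · rw [one_mul]; nlinarith
    · rw [abv_natCast_eq_one_of_coprime hv hp]
      exact ((Nat.Prime.coprime_iff_not_dvd hpp).2 (Nat.not_dvd_of_pos_of_lt hj (by omega))).symm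
  by_cases hd : p ∣ a
  · have hpa := abv_natCast_le_of_dvd (F := F) hv hd
    refine le_trans ?_ (hgood (v.pos (by exact_mod_cast hpp.ne_zero : (p : F) ≠ 0))
      fun j hj hj' => ?_)
    · calc _ ≤ 1 * v (a : F) ^ 2 := by gcongr
        _ = v (a : F) * v (a : F) := by ring
        _ ≤ _ := by gcongr
    · by_cases hjp : p ∣ j
      · obtain ⟨c, rfl⟩ := hjp
        have : 1 ≤ c := Nat.pos_of_mul_pos_left hj
        have : c < 2 := by by_contra! hc; nlinarith [show k + 1 < 2 * p by omega]
        rw [show c = 1 by omega, mul_one]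
      · rw [abv_natCast_eq_one_of_coprime hv hp
          ((Nat.Prime.coprime_iff_not_dvd hpp).2 hjp).symm]
        exact hp.le
  · have h2 : k + 2 * n < 2 * p := by
      by_contra! hle
      refine hd ?_
      rw [ha, Nat.ascFactorial_eq_prod_range]
      refine dvd_trans ?_ (Finset.dvd_prod_of_mem _
        (Finset.mem_range.2 (show 2 * p - (k + 2) < 2 * n - 1 by omega)))
      rw [show k + 1 + 1 + (2 * p - (k + 2)) = 2 * p by omega]
      exact dvd_mul_left _ _
    obtain ⟨h, hh⟩ : ∃ h, p = 2 * h + 2 * n + 1 := by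
      rcases hpp.eq_two_or_odd' with rfl | ⟨c, hc⟩
      · omega
      · exact ⟨c - n, by omega⟩
    rw [hh] at hpp hp h2 h'
    refine le_trans ?_ (one_le_abv_geg_of_eq_zero hv hq hZ hpp hp h' h2 h0)
    nlinarith

end GoodPlaces

section Growth

lemma eventually_pow_sqrt_le (C D : ℕ) {b : ℝ} (hb : 1 < b) :
    ∀ᶠ N : ℕ in atTop, ((C : ℝ) * (N + D)) ^ (C * N.sqrt + D) ≤ b ^ N := by
  have hlb := Real.log_pos hb
  set ε : ℝ := Real.log b / (2 * (C + D + 1)) with hε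
  have hε0 : 0 < ε := by positivity
  have h := ((isLittleO_log_rpow_atTop (half_pos one_pos)).bound hε0)
  filter_upwards [tendsto_natCast_atTop_atTop.eventually h, eventually_ge_atTop (C + D + C * D + 1)]
    with N hN hN'
  have hN1 : (1 : ℝ) ≤ N := by exact_mod_cast (by omega : 1 ≤ N)
  have hN0 : (0 : ℝ) < N := by linarith
  have hs : (N.sqrt : ℝ) ≤ √N := Real.nat_sqrt_le_real_sqrt
  have hs1 : 1 ≤ √(N : ℝ) := Real.one_le_sqrt.2 hN1
  have hss : √(N : ℝ) * √N = N := Real.mul_self_sqrt hN0.le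
  rw [← Real.sqrt_eq_rpow, Real.norm_of_nonneg (Real.log_nonneg hN1),
    Real.norm_of_nonneg (Real.sqrt_nonneg _)] at hN
  have hbase : (C : ℝ) * (N + D) ≤ N ^ 2 := by
    have : ((C + D + C * D + 1 : ℕ) : ℝ) ≤ N := by exact_mod_cast hN'
    push_cast at this
    have hC : (0 : ℝ) ≤ C := by positivity
    have hD : (0 : ℝ) ≤ D := by positivity
    nlinarith [mul_nonneg hC hD]
  calc ((C : ℝ) * (N + D)) ^ (C * N.sqrt + D) ≤ ((N : ℝ) ^ 2) ^ (C * N.sqrt + D) := by gcongr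
    _ = Real.exp (Real.log N * (2 * (C * N.sqrt + D))) := by
        rw [← pow_mul, ← Real.rpow_natCast, Real.rpow_def_of_pos hN0]; push_cast; rfl
    _ ≤ Real.exp (Real.log b * N) := by
        refine Real.exp_le_exp.2 ?_
        have h1 : 2 * ((C : ℝ) * N.sqrt + D) ≤ 2 * (C + D + 1) * √N := by
          have hC : (0 : ℝ) ≤ C := by positivity
          have hD : (0 : ℝ) ≤ D := by positivity
          nlinarith
        calc Real.log N * (2 * (C * N.sqrt + D)) ≤ (ε * √N) * (2 * (C + D + 1) * √N) := by gcongr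
          _ = ε * (2 * (C + D + 1)) * (√N * √N) := by ring
          _ = Real.log b * N := by rw [hss, hε, div_mul_cancel₀ _ (by positivity)]
    _ = b ^ N := by rw [← Real.rpow_natCast, Real.rpow_def_of_pos (by linarith)]

lemma lcmPart_le (N : ℕ) : lcmPart N ≤ 2 ^ N * N ^ N.sqrt := by
  refine Nat.mul_le_mul ?_ ?_
  · calc primorial (N / 2) ≤ 4 ^ (N / 2) := primorial_le_four_pow _
      _ = 2 ^ (2 * (N / 2)) := by rw [pow_mul]; norm_num
      _ ≤ 2 ^ N := Nat.pow_le_pow_right (by norm_num) (by omega)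
  · calc ∏ i ∈ Finset.Icc 1 N.sqrt, i ^ Nat.log i N ≤ ∏ i ∈ Finset.Icc 1 N.sqrt, N := by
          refine Finset.prod_le_prod' fun i hi => ?_
          have h := Finset.mem_Icc.1 hi
          refine Nat.pow_log_le_self i ?_
          rintro rfl
          simp at h; omega
      _ = N ^ N.sqrt := by simp

lemma gegBound_pos (n N : ℕ) : 0 < gegBound n N :=
  Nat.mul_pos (lcmPart_pos N) (Nat.pow_pos (Nat.ascFactorial_pos _ _))

lemma eventually_gegBound_le (n : ℕ) {b : ℝ} (hb : 1 < b) :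
    ∀ᶠ N in atTop, (gegBound n N : ℝ) ≤ b ^ N * 2 ^ N := by
  filter_upwards [eventually_pow_sqrt_le 1 (4 * n + 1) hb] with N hN
  refine le_trans ?_ (mul_le_mul_of_nonneg_right hN (by positivity))
  have h2 : gegBound n N ≤ (1 * (N + (4 * n + 1))) ^ (1 * N.sqrt + (4 * n + 1)) * 2 ^ N := by
    calc gegBound n N ≤ (2 ^ N * N ^ N.sqrt) * ((N + (2 * n - 1)) ^ (2 * n - 1)) ^ 2 :=
          Nat.mul_le_mul (lcmPart_le N)
            (Nat.pow_le_pow_left (Nat.ascFactorial_le_pow_add N (2 * n - 1)) 2)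
      _ ≤ (2 ^ N * (1 * (N + (4 * n + 1))) ^ N.sqrt) *
          (1 * (N + (4 * n + 1))) ^ (4 * n + 1) := by
          rw [← pow_mul]
          refine Nat.mul_le_mul (Nat.mul_le_mul le_rfl (Nat.pow_le_pow_left (by omega) _)) ?_
          exact (Nat.pow_le_pow_left (by omega) _).trans
            (Nat.pow_le_pow_right (by omega) (by omega))
      _ = _ := by rw [one_mul (N.sqrt), pow_add]; ring
  exact_mod_cast h2

end Growth

section ExplicitFormulas

variable {F : Type*} [Field F] [CharZero F]

open Nat in
/-- The coefficients of `(1 - 4 * w) ^ (-(n + 1 / 2))`. -/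
def invSqrtCoeff (F : Type*) [Field F] (n m : ℕ) : F :=
  (2 * n + 2 * m)! * n ! / ((2 * n)! * (n + m)! * m !)

lemma invSqrtCoeff_succ (n m : ℕ) : (m + 1) * invSqrtCoeff F n (m + 1)
    = 2 * (2 * n + 2 * m + 1) * invSqrtCoeff F n m := by
  have h1 := Nat.cast_ne_zero (R := F).2 (Nat.factorial_ne_zero (2 * n))
  have h2 := Nat.cast_ne_zero (R := F).2 (Nat.factorial_ne_zero (n + m))
  have h3 := Nat.cast_ne_zero (R := F).2 (Nat.factorial_ne_zero m)
  have h4 : ((n + m : ℕ) : F) + 1 ≠ 0 := by exact_mod_cast (n + m).succ_ne_zero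
  have h5 : (m : F) + 1 ≠ 0 := by exact_mod_cast m.succ_ne_zero
  rw [invSqrtCoeff, invSqrtCoeff, show 2 * n + 2 * (m + 1) = (2 * n + 2 * m + 1) + 1 by ring,
    ← add_assoc n m 1]
  simp only [Nat.factorial_succ]
  push_cast at h4 ⊢
  field_simp
  ring

lemma invSqrtCoeff_zero (n : ℕ) : invSqrtCoeff F n 0 = 1 := by
  have h1 := Nat.cast_ne_zero (R := F).2 (Nat.factorial_ne_zero (2 * n))
  have h2 := Nat.cast_ne_zero (R := F).2 (Nat.factorial_ne_zero n)
  simp [invSqrtCoeff, div_self (mul_ne_zero h1 h2)]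

omit [CharZero F] in
lemma sum_range_eq_of_le {t : ℕ → F} {a M : ℕ} (h : a ≤ M) (ht : ∀ k, a ≤ k → t k = 0) :
    ∑ k ∈ Finset.range a, t k = ∑ k ∈ Finset.range M, t k :=
  Finset.sum_subset (Finset.range_subset_range.2 h) fun k _ hk => ht k (by simpa using hk)

lemma geg_eq_sum_range (n : ℕ) (Z : F) (j : ℕ) : geg n Z j = ∑ k ∈ Finset.range (j + 1),
    invSqrtCoeff F n (j - k) / 2 ^ (j - k) * (j - k).choose k * (-Z / 2) ^ k := by
  set t : ℕ → ℕ → F := fun j k =>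
    invSqrtCoeff F n (j - k) / 2 ^ (j - k) * (j - k).choose k * (-Z / 2) ^ k with ht
  have hvan (j k : ℕ) (hk : j + 1 ≤ k) : t j k = 0 := by
    simp [ht, Nat.choose_eq_zero_of_lt (show j - k < k by omega)]
  refine (eq_geg_of_recurrence (f := fun j => ∑ k ∈ Finset.range (j + 1), t j k) ?_ ?_ ?_ j).symm
  · simp [ht, invSqrtCoeff_zero]
  · have := invSqrtCoeff_succ (F := F) n 0
    simp only [Nat.cast_zero, zero_add, one_mul, mul_zero, add_zero, invSqrtCoeff_zero] at this
    simp [ht, Finset.sum_range_succ, this]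
  intro j
  have hrec (k : ℕ) : (j + 2) * t (j + 2) (k + 1)
      = (2 * j + 2 * n + 3) * t (j + 1) (k + 1) - (j + 2 * n + 1) * Z * t j k := by
    rcases le_or_gt k j with hk | hk
    · obtain ⟨m, rfl⟩ := Nat.exists_eq_add_of_le' hk
      simp only [ht]
      rw [show m + k + 2 - (k + 1) = m + 1 by omega, show m + k + 1 - (k + 1) = m by omega,
        show m + k - k = m by omega]
      have hg := invSqrtCoeff_succ (F := F) n m
      have h5 : (m : F) + 1 ≠ 0 := by exact_mod_cast m.succ_ne_zero
      have h6 : (k : F) + 1 ≠ 0 := by exact_mod_cast k.succ_ne_zero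
      have hp : ((m + 1).choose (k + 1) : F) = m.choose k + m.choose (k + 1) := by
        rw [Nat.choose_succ_succ]; push_cast; rfl
      have ha : ((m : F) + 1) * m.choose k = (m + 1).choose (k + 1) * (k + 1) := by
        exact_mod_cast Nat.add_one_mul_choose_eq m k
      rw [hp] at ha ⊢
      rw [show invSqrtCoeff F n (m + 1) = 2 * (2 * n + 2 * m + 1) * invSqrtCoeff F n m / (m + 1) by
        rw [← hg]; field_simp]
      rw [show (m.choose (k + 1) : F) = ((m : F) - k) * m.choose k / (k + 1) by
        field_simp; linear_combination -ha]
      generalize invSqrtCoeff F n m = G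
      generalize (m.choose k : F) = A
      push_cast
      field_simp
      ring
    · simp only [ht]
      rw [Nat.choose_eq_zero_of_lt (show j + 2 - (k + 1) < k + 1 by omega),
        Nat.choose_eq_zero_of_lt (show j + 1 - (k + 1) < k + 1 by omega),
        Nat.choose_eq_zero_of_lt (show j - k < k by omega)]
      simp
  have h0 : (j + 2) * t (j + 2) 0 = (2 * j + 2 * n + 3) * t (j + 1) 0 := by
    have hg := invSqrtCoeff_succ (F := F) n (j + 1)
    simp only [ht, Nat.sub_zero, Nat.choose_zero_right, pow_zero, Nat.cast_one, mul_one]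
    push_cast at hg
    rw [pow_succ _ (j + 1)]
    field_simp
    linear_combination hg
  rw [sum_range_eq_of_le (show j + 1 ≤ j + 2 by omega) (hvan j),
    sum_range_eq_of_le (show j + 1 + 1 ≤ j + 3 by omega) (hvan (j + 1)),
    show j + 2 + 1 = j + 3 from rfl, Finset.sum_range_succ', Finset.sum_range_succ' (t (j + 1)),
    mul_add, mul_add, h0, Finset.mul_sum, Finset.sum_congr rfl fun k _ => hrec k,
    Finset.sum_sub_distrib, Finset.mul_sum, Finset.mul_sum]
  ring

lemma geg_eq_sum_quadratic {n : ℕ} (hn : 1 ≤ n) (q : F) (j : ℕ) : geg n (1 - 4 * q) j =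
    ∑ m ∈ Finset.range (j + 1),
      invSqrtCoeff F n m * (j + 2 * n).choose (2 * n + 2 * m) * q ^ m := by
  set t : ℕ → ℕ → F := fun j m =>
    invSqrtCoeff F n m * (j + 2 * n).choose (2 * n + 2 * m) * q ^ m with ht
  have hvan (j m : ℕ) (hm : j + 1 ≤ m) : t j m = 0 := by
    simp [ht, Nat.choose_eq_zero_of_lt (show j + 2 * n < 2 * n + 2 * m by omega)]
  refine (eq_geg_of_recurrence (f := fun j => ∑ m ∈ Finset.range (j + 1), t j m) ?_ ?_ ?_ j).symm
  · simp [ht, invSqrtCoeff_zero]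
  · rw [Finset.sum_range_succ, Finset.sum_range_one]
    simp only [ht]
    rw [Nat.choose_eq_zero_of_lt (show 1 + 2 * n < 2 * n + 2 * 1 by omega), add_comm 1]
    simp [invSqrtCoeff_zero]
  intro j
  have hchoose (r : ℕ) : ((r : F) + 1) * ((j + 2) * (j + 2 + 2 * n).choose (r + 2)
      - (2 * j + 2 * n + 3) * (j + 1 + 2 * n).choose (r + 2)
      + (j + 2 * n + 1) * (j + 2 * n).choose (r + 2))
      = (j + 2 * n + 1) * (r + 2 - 2 * n) * (j + 2 * n).choose r := by
    have ha : ((j + 2 * n : ℕ) + 1 : F) * (j + 2 * n).choose r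
        = ((j + 2 * n).choose r + (j + 2 * n).choose (r + 1)) * (r + 1) := by
      exact_mod_cast Nat.choose_succ_succ (j + 2 * n) r ▸ Nat.add_one_mul_choose_eq (j + 2 * n) r
    rw [show j + 2 + 2 * n = j + 2 * n + 1 + 1 by ring, show j + 1 + 2 * n = j + 2 * n + 1 by ring]
    simp only [Nat.choose_succ_succ]
    push_cast at ha ⊢
    linear_combination (2 * n - 1) * ha
  have hrec (m : ℕ) : (j + 2) * t (j + 2) (m + 1) = (2 * j + 2 * n + 3) * t (j + 1) (m + 1)
      - (j + 2 * n + 1) * t j (m + 1) + 4 * q * (j + 2 * n + 1) * t j m := by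
    have hg := invSqrtCoeff_succ (F := F) n m
    have hc := hchoose (2 * n + 2 * m)
    have h5 : 2 * (n : F) + 2 * m + 1 ≠ 0 := by exact_mod_cast (2 * n + 2 * m).succ_ne_zero
    simp only [ht]
    rw [show 2 * n + 2 * (m + 1) = 2 * n + 2 * m + 2 by ring]
    refine mul_left_cancel₀ h5 ?_
    push_cast at hc
    linear_combination invSqrtCoeff F n (m + 1) * q ^ (m + 1) * hc
      + 2 * q ^ (m + 1) * (j + 2 * n + 1) * ((j + 2 * n).choose (2 * n + 2 * m)) * hg
  have h0 : (j + 2) * t (j + 2) 0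
      = (2 * j + 2 * n + 3) * t (j + 1) 0 - (j + 2 * n + 1) * t j 0 := by
    obtain ⟨c, rfl⟩ := Nat.exists_eq_add_of_le' hn
    have hc := hchoose (2 * c)
    have h5 : 2 * (c : F) + 1 ≠ 0 := by exact_mod_cast (2 * c).succ_ne_zero
    simp only [ht, invSqrtCoeff_zero, one_mul, pow_zero, mul_one, mul_zero, add_zero,
      show 2 * (c + 1) = 2 * c + 2 by ring] at hc ⊢
    refine mul_left_cancel₀ h5 ?_
    push_cast at hc ⊢
    linear_combination hc
  rw [show j + 2 + 1 = j + 3 from rfl,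
    sum_range_eq_of_le (show j + 1 + 1 ≤ j + 3 by omega) (hvan (j + 1)),
    Finset.sum_range_succ', Finset.sum_range_succ' (t (j + 1)),
    mul_add, mul_add, h0, Finset.mul_sum, Finset.sum_congr rfl fun k _ => hrec k,
    Finset.sum_add_distrib, Finset.sum_sub_distrib, ← Finset.mul_sum, ← Finset.mul_sum,
    ← Finset.mul_sum]
  have e1 := sum_range_eq_of_le (show j + 1 ≤ j + 2 by omega) (hvan j)
  have e2 := sum_range_eq_of_le (show j + 1 ≤ j + 3 by omega) (hvan j)
  rw [Finset.sum_range_succ' _ (j + 2)] at e2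
  linear_combination (j + 2 * n + 1 : F) * e2 - 4 * q * (j + 2 * n + 1) * e1

end ExplicitFormulas

section BadPlaces

variable {F : Type*} [Field F] [CharZero F] {v : AbsoluteValue F ℝ} (hv : IsNonarchimedean v)

include hv in
/-- Absolute values of natural numbers decay at most polynomially. -/
lemma exists_one_le_abv_mul_pow {p : ℕ} (hpp : p.Prime) (hp : v (p : F) < 1) :
    ∃ D : ℕ, ∀ x a : ℕ, x ≠ 0 → p ^ x.factorization p ≤ a → 1 ≤ v (x : F) * (a : ℝ) ^ D := by
  have hp0 : 0 < v (p : F) := v.pos (by exact_mod_cast hpp.ne_zero)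
  obtain ⟨D, hD⟩ := pow_unbounded_of_one_lt (v (p : F))⁻¹
    (show (1 : ℝ) < p by exact_mod_cast hpp.one_lt)
  refine ⟨D, fun x a hx hxa => ?_⟩
  have h1 : 1 ≤ v (p : F) * (p : ℝ) ^ D := by
    rw [inv_lt_iff_one_lt_mul₀ hp0] at hD; linarith [mul_comm ((p : ℝ) ^ D) (v (p : F))]
  rw [abv_natCast_eq_pow hv hpp hp hx]
  calc (1 : ℝ) ≤ (v (p : F) * (p : ℝ) ^ D) ^ x.factorization p := one_le_pow₀ h1
    _ = v (p : F) ^ x.factorization p * ((p ^ x.factorization p : ℕ) : ℝ) ^ D := by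
        push_cast; rw [mul_pow, ← pow_mul, ← pow_mul, mul_comm D]
    _ ≤ _ := by gcongr

include hv in
lemma abv_choose_eq_one {p : ℕ} (hpp : p.Prime) (hp : v (p : F) < 1) {t m i : ℕ}
    (h : p ^ t ∣ m + 1) (hi : i < p ^ t) : v (m.choose i : F) = 1 := by
  have hp0 : 0 < v (p : F) := v.pos (by exact_mod_cast hpp.ne_zero)
  induction i with
  | zero => simp
  | succ i ih =>
    have ih := ih (by omega)
    have hm : v ((m + 1 : ℕ) : F) ≤ v (p : F) ^ t := by
      rw [← map_pow, ← Nat.cast_pow]; exact abv_natCast_le_of_dvd hv h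
    have hi1 : v (p : F) ^ t < v ((i + 1 : ℕ) : F) := by
      rw [abv_natCast_eq_pow hv hpp hp i.succ_ne_zero]
      refine pow_lt_pow_right_of_lt_one₀ hp0 hp ?_
      refine (Nat.pow_lt_pow_iff_right hpp.one_lt).1 (lt_of_le_of_lt ?_ hi)
      exact Nat.ordProj_le p i.succ_ne_zero
    have h1 : v ((m + 1).choose (i + 1) : F) < 1 := by
      have e := congrArg (fun x : ℕ => v (x : F)) (Nat.add_one_mul_choose_eq m i)
      simp only [Nat.cast_mul, map_mul, ih, mul_one] at e
      by_contra! hge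
      nlinarith [apply_nonneg v ((i + 1 : ℕ) : F)]
    have e : (m.choose (i + 1) : F) = (m + 1).choose (i + 1) - m.choose i := by
      rw [Nat.choose_succ_succ]; push_cast; ring
    refine le_antisymm (hv.abv_natCast_le _) ?_
    by_contra! hlt
    have e2 : (m.choose i : F) = (m + 1).choose (i + 1) - m.choose (i + 1) := by rw [e]; ring
    have := (hv.abv_sub_le _ _).trans_lt (max_lt h1 hlt)
    rw [← e2, ih] at this
    exact lt_irrefl _ this

include hv in
lemma abv_geg_le_pow_mul {n : ℕ} {Z : F} {k : ℕ} {M : ℝ} (hM : 1 ≤ M)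
    (h : ∀ l < k, 1 ≤ M * v (((l + 2 * n + 1 : ℕ) : F) * Z)) (h0 : geg n Z (k + 1) = 0) :
    ∀ i j : ℕ, j + i = k → v (geg n Z j) ≤ M ^ i * v (geg n Z k) ∧
      v (geg n Z (j + 1)) ≤ M ^ i * v (geg n Z k) := by
  have hM0 : 0 ≤ M := by linarith
  intro i
  induction i with
  | zero => rintro j rfl; rw [add_zero] at h0 ⊢; simp [h0]
  | succ i ih =>
    intro j hj
    obtain ⟨e1, e2⟩ := ih (j + 1) (by omega)
    have hle : M ^ i * v (geg n Z k) ≤ M ^ (i + 1) * v (geg n Z k) := by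
      have := pow_le_pow_right₀ hM i.le_succ
      gcongr
    refine ⟨?_, e1.trans hle⟩
    have h5 : ((j + 2 * n + 1 : ℕ) : F) * Z * geg n Z j
        = ((2 * j + 2 * n + 3 : ℕ) : F) * geg n Z (j + 1)
          - ((j + 2 : ℕ) : F) * geg n Z (j + 2) := by
      have hr := geg_recurrence n Z j
      push_cast; linear_combination hr
    have h6 : v (((j + 2 * n + 1 : ℕ) : F) * Z) * v (geg n Z j) ≤ M ^ i * v (geg n Z k) := by
      rw [← map_mul, h5]
      refine (hv.abv_sub_le _ _).trans (max_le ?_ ?_) <;> rw [map_mul]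
      · exact (mul_le_of_le_one_left (apply_nonneg _ _) (hv.abv_natCast_le _)).trans e1
      · exact (mul_le_of_le_one_left (apply_nonneg _ _) (hv.abv_natCast_le _)).trans e2
    calc v (geg n Z j) ≤ (M * v (((j + 2 * n + 1 : ℕ) : F) * Z)) * v (geg n Z j) :=
          le_mul_of_one_le_left (apply_nonneg _ _) (h j (by omega))
      _ = M * (v (((j + 2 * n + 1 : ℕ) : F) * Z) * v (geg n Z j)) := by ring
      _ ≤ M * (M ^ i * v (geg n Z k)) := by gcongr
      _ = _ := by ring

include hv in
/-- If `geg` is not too small at some index slightly below `k`, and vanishes at `k + 1`, then it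
is not too small at `k`. -/
lemma eventually_pow_le_abv_geg_of_near {p : ℕ} (hpp : p.Prime) (hp : v (p : F) < 1) {n : ℕ}
    {Z : F} (hZ : Z ≠ 0) {H : ℝ} (hH : 1 ≤ H) (A : ℕ)
    (h : ∀ᶠ k : ℕ in atTop, ∃ j i, j + i = k ∧ i ≤ A * k.sqrt + A ∧
      H ^ j ≤ ((A : ℝ) * (k + A)) ^ A * v (geg n Z j)) {b : ℝ} (hb : 1 < b) :
    ∀ᶠ k : ℕ in atTop, geg n Z (k + 1) = 0 → H ^ k ≤ b ^ k * v (geg n Z k) := by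
  obtain ⟨D, hD⟩ := exists_one_le_abv_mul_pow hv hpp hp
  obtain ⟨W, hW⟩ := exists_nat_ge (max H (v Z)⁻¹)
  have hWH : H ≤ W := (le_max_left _ _).trans hW
  have hW1 : (1 : ℝ) ≤ W := hH.trans hWH
  have hWZ : 1 ≤ W * v Z := by
    have := (le_max_right _ _).trans hW
    rwa [inv_le_iff_one_le_mul₀ (v.pos hZ)] at this
  set E : ℕ := W + 2 * n + A + (D + 2) * A + 1 with hE
  filter_upwards [h, eventually_pow_sqrt_le E E hb, eventually_ge_atTop 1]
    with k ⟨j, i, hji, hi, hj⟩ hk hk1 h0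
  set B : ℝ := (E : ℝ) * (k + E) with hB
  have hk0 : (1 : ℝ) ≤ k := by exact_mod_cast hk1
  have hE' : (E : ℝ) = W + 2 * n + A + (D + 2) * A + 1 := by rw [hE]; push_cast; ring
  have hn0 : (0 : ℝ) ≤ n := by positivity
  have hA0 : (0 : ℝ) ≤ A := by positivity
  have hDA : (0 : ℝ) ≤ (D + 2) * A := by positivity
  have hE1 : (1 : ℝ) ≤ E := by rw [hE']; nlinarith
  have hB1 : (k : ℝ) + E ≤ B := le_mul_of_one_le_left (by linarith) hE1
  have hBW : (W : ℝ) ≤ B := by linarith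
  have hBk : ((k : ℝ) + 2 * n) ≤ B := by linarith
  have hBA : (A : ℝ) * (k + A) ≤ B := by
    rw [hB]; have : (A : ℝ) ≤ E := by linarith
    gcongr
  have hB11 : 1 ≤ B := by linarith
  have hM1 : 1 ≤ B ^ (D + 1) := one_le_pow₀ hB11
  have hback := (abv_geg_le_pow_mul hv hM1 (fun l hl => ?_) h0 i j hji).1
  · calc H ^ k = H ^ j * H ^ i := by rw [← hji, pow_add]
      _ ≤ (((A : ℝ) * (k + A)) ^ A * v (geg n Z j)) * B ^ i := by
          have : H ≤ B := by linarith
          gcongr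
      _ ≤ (B ^ A * ((B ^ (D + 1)) ^ i * v (geg n Z k))) * B ^ i := by gcongr
      _ = B ^ (A + (D + 2) * i) * v (geg n Z k) := by
          rw [← pow_mul, show A + (D + 2) * i = A + ((D + 1) * i + i) by ring, pow_add, pow_add]
          ring
      _ ≤ B ^ (E * k.sqrt + E) * v (geg n Z k) := by
          refine mul_le_mul_of_nonneg_right (pow_le_pow_right₀ hB11 ?_) (apply_nonneg _ _)
          calc A + (D + 2) * i ≤ A + (D + 2) * (A * k.sqrt + A) := by gcongr
            _ = ((D + 2) * A) * k.sqrt + (A + (D + 2) * A) := by ring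
            _ ≤ E * k.sqrt + E :=
                Nat.add_le_add (Nat.mul_le_mul_right _ (by omega)) (by omega)
      _ ≤ b ^ k * v (geg n Z k) := by gcongr
  · have hl1 := hD (l + 2 * n + 1) (l + 2 * n + 1) (by omega) (Nat.ordProj_le p (by omega))
    have hl2 : ((l + 2 * n + 1 : ℕ) : ℝ) ≤ B := by
      have : ((l + 1 : ℕ) : ℝ) ≤ k := by exact_mod_cast hl
      push_cast at this ⊢; linarith
    have hl3 : (1 : ℝ) ≤ v ((l + 2 * n + 1 : ℕ) : F) * B ^ D := hl1.trans (by gcongr)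
    rw [map_mul, pow_succ]
    calc (1 : ℝ) ≤ (v ((l + 2 * n + 1 : ℕ) : F) * B ^ D) * (W * v Z) :=
          one_le_mul_of_one_le_of_one_le hl3 hWZ
      _ ≤ (v ((l + 2 * n + 1 : ℕ) : F) * B ^ D) * (B * v Z) := by gcongr
      _ = _ := by ring

include hv in
lemma exists_one_le_abv_invSqrtCoeff_mul_pow {p : ℕ} (hpp : p.Prime) (hp : v (p : F) < 1)
    {n : ℕ} (hn : 1 ≤ n) : ∃ A₀ : ℕ, ∀ A m k : ℕ, A₀ ≤ A → m ≤ k →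
      1 ≤ ((A : ℝ) * (k + A)) ^ A * v (invSqrtCoeff F n m) := by
  obtain ⟨D, hD⟩ := exists_one_le_abv_mul_pow hv hpp hp
  have hf := hD n.factorial n.factorial n.factorial_ne_zero (Nat.ordProj_le p n.factorial_ne_zero)
  refine ⟨2 * n + n.factorial + 4 * D + 2, fun A m k hA hmk => ?_⟩
  set B : ℝ := (A : ℝ) * (k + A) with hB
  have hA' : 2 * (n : ℝ) + n.factorial + 4 * D + 2 ≤ A := by exact_mod_cast hA
  have hn0 : (0 : ℝ) ≤ n := by positivity
  have hD0 : (0 : ℝ) ≤ D := by positivity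
  have hk0 : (0 : ℝ) ≤ k := by positivity
  have hmk' : (m : ℝ) ≤ k := by exact_mod_cast hmk
  have hf0 : (1 : ℝ) ≤ n.factorial := by exact_mod_cast n.factorial_pos
  have hB1 : 2 * ((k : ℝ) + A) ≤ B := by rw [hB]; nlinarith
  have hB11 : 1 ≤ B := by linarith
  have hc1 := hD ((2 * (n + m)).choose (n + m)) (2 * (n + m))
    (Nat.choose_pos (by omega)).ne' (Nat.pow_factorization_choose_le (by omega))
  have hc2 := hD ((m + n).choose n) (m + n)
    (Nat.choose_pos (by omega)).ne' (Nat.pow_factorization_choose_le (by omega))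
  have e : ((2 * n).factorial : F) * invSqrtCoeff F n m
      = (2 * (n + m)).choose (n + m) * ((n.factorial : F) ^ 2 * (m + n).choose n) := by
    have h1 := Nat.cast_ne_zero (R := F).2 (Nat.factorial_ne_zero (2 * n))
    have h2 := Nat.cast_ne_zero (R := F).2 (Nat.factorial_ne_zero (n + m))
    have h3 := Nat.cast_ne_zero (R := F).2 (Nat.factorial_ne_zero m)
    have h4 := Nat.cast_ne_zero (R := F).2 (Nat.factorial_ne_zero n)
    rw [invSqrtCoeff, two_mul (n + m), Nat.cast_add_choose, add_comm m n, Nat.cast_add_choose,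
      show n + m + (n + m) = 2 * n + 2 * m by ring]
    field_simp
  have e' := congrArg v e
  simp only [map_mul, map_pow] at e'
  have hle : v ((2 * n).factorial : F) * v (invSqrtCoeff F n m) ≤ v (invSqrtCoeff F n m) :=
    mul_le_of_le_one_left (apply_nonneg _ _) (hv.abv_natCast_le _)
  have hx1 : ((2 * (n + m) : ℕ) : ℝ) ≤ B := by push_cast; linarith
  have hx2 : ((m + n : ℕ) : ℝ) ≤ B := by push_cast; linarith
  have hx3 : ((n.factorial : ℕ) : ℝ) ≤ B := by linarith
  set c1 := v ((2 * (n + m)).choose (n + m) : F)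
  set c2 := v ((m + n).choose n : F)
  set c3 := v (n.factorial : F)
  have hc1' : 1 ≤ c1 * B ^ D := hc1.trans (by gcongr)
  have hc2' : 1 ≤ c2 * B ^ D := hc2.trans (by gcongr)
  have hc3' : 1 ≤ c3 * B ^ D := hf.trans (by gcongr)
  calc (1 : ℝ) ≤ ((c1 * B ^ D) * (c2 * B ^ D)) * ((c3 * B ^ D) * (c3 * B ^ D)) :=
        one_le_mul_of_one_le_of_one_le (one_le_mul_of_one_le_of_one_le hc1' hc2')
          (one_le_mul_of_one_le_of_one_le hc3' hc3')
    _ = B ^ (4 * D) * (c1 * (c3 ^ 2 * c2)) := by ring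
    _ ≤ B ^ A * v (invSqrtCoeff F n m) := by
        have : B ^ (4 * D) ≤ B ^ A := pow_le_pow_right₀ hB11 (by omega)
        rw [← e']
        gcongr

end BadPlaces

section LeadingTerms

variable {F : Type*} [Field F] [CharZero F]

lemma invSqrtCoeff_mul_choose (n i l : ℕ) :
    invSqrtCoeff F n (i + l) * (i + l).choose i * (2 * (2 * i + l + n)).choose (2 * i)
      = invSqrtCoeff F n (2 * i + l) * ((2 * i + l).choose (2 * i) * (2 * i + l + n).choose i) := by
  have hf (a : ℕ) : (a.factorial : F) ≠ 0 := Nat.cast_ne_zero.2 a.factorial_ne_zero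
  rw [show 2 * (2 * i + l + n) = 2 * i + (2 * n + 2 * (i + l)) by ring,
    show 2 * i + l + n = i + (n + (i + l)) by ring]
  simp only [Nat.cast_add_choose, invSqrtCoeff]
  rw [show 2 * n + 2 * (2 * i + l) = 2 * i + (2 * n + 2 * (i + l)) by ring,
    show n + (2 * i + l) = i + (n + (i + l)) by ring]
  have h1 := hf (i + (n + (i + l)))
  have h2 := hf (n + (i + l))
  have h3 := hf (i + l)
  have h4 := hf (2 * n)
  have h5 := hf (2 * i)
  have h6 := hf l
  have h7 := hf i
  have h8 := hf (2 * i + l)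
  have h9 := hf (2 * n + 2 * (i + l))
  field_simp

lemma invSqrtCoeff_mul_centralBinom (n i m : ℕ) :
    invSqrtCoeff F n m * (2 * (i + m) + 2 * n).choose (2 * n + 2 * m) * (2 * i).choose i
      = invSqrtCoeff F n (i + m) * ((i + m).choose i * (i + m + n).choose i) := by
  have hf (a : ℕ) : (a.factorial : F) ≠ 0 := Nat.cast_ne_zero.2 a.factorial_ne_zero
  rw [show 2 * (i + m) + 2 * n = (2 * n + 2 * m) + 2 * i by ring, two_mul i,
    show i + m + n = i + (n + m) by ring]
  simp only [Nat.cast_add_choose, invSqrtCoeff]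
  rw [show 2 * n + 2 * (i + m) = (2 * n + 2 * m) + (i + i) by ring,
    show n + (i + m) = i + (n + m) by ring]
  have h1 := hf (i + (n + m))
  have h2 := hf (n + m)
  have h3 := hf (i + m)
  have h4 := hf (2 * n)
  have h5 := hf (i + i)
  have h6 := hf m
  have h7 := hf i
  have h9 := hf (2 * n + 2 * m)
  field_simp

variable {v : AbsoluteValue F ℝ} (hv : IsNonarchimedean v)

omit [CharZero F] in
include hv in
lemma abv_one_add_sum_eq_one {ι : Type*} {s : Finset ι} {f : ι → F} (h : ∀ i ∈ s, v (f i) < 1) :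
    v (1 + ∑ i ∈ s, f i) = 1 := by
  have := hv.add_eq_left_of_lt (x := 1) (y := ∑ i ∈ s, f i)
    (by rw [map_one]; exact hv.abv_sum_lt one_pos h)
  rw [this, map_one]

include hv in
lemma abv_geg_eq_of_dvd {p : ℕ} (hpp : p.Prime) (hp : v (p : F) < 1) {n j t D : ℕ} {Z : F}
    (hZ : v Z < 1) (hdvd : p ^ t ∣ 2 * (j + n) + 1)
    (hD : ∀ i ≤ 2 * (j + n), 1 ≤ v ((2 * (j + n)).choose i : F) * (2 * (j + n) : ℝ) ^ D)
    (hi : ∀ i, p ^ t ≤ 2 * i → (2 * (j + n) : ℝ) ^ D * v Z ^ i < 1) :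
    v (geg n Z j) = v (invSqrtCoeff F n j / 2 ^ j) := by
  have hsum : geg n Z j = invSqrtCoeff F n j / 2 ^ j * (1 + ∑ i ∈ Finset.range j,
      (j.choose (2 * (i + 1)) * (j + n).choose (i + 1) : ℕ) /
        (2 * (j + n)).choose (2 * (i + 1)) * (-Z) ^ (i + 1)) := by
    rw [geg_eq_sum_range, Finset.sum_range_succ', mul_add, add_comm, Finset.mul_sum]
    congr 1
    · simp
    refine Finset.sum_congr rfl fun i hij => ?_
    rw [Finset.mem_range] at hij
    have hc : ((2 * (j + n)).choose (2 * (i + 1)) : F) ≠ 0 :=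
      Nat.cast_ne_zero.2 (Nat.choose_pos (by omega)).ne'
    rcases le_or_gt (2 * (i + 1)) j with h | h
    · obtain ⟨l, rfl⟩ := Nat.exists_eq_add_of_le h
      have := invSqrtCoeff_mul_choose (F := F) n (i + 1) l
      rw [show 2 * (i + 1) + l - (i + 1) = i + 1 + l by omega]
      rw [show 2 * (i + 1) + l = (i + 1 + l) + (i + 1) by ring] at this hc ⊢
      push_cast
      rw [div_pow, pow_add 2]
      field_simp
      linear_combination (-Z) ^ (i + 1) * 2 ^ (2 * (i + 1) + l) * this
    · rw [Nat.choose_eq_zero_of_lt (show j - (i + 1) < i + 1 by omega),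
        Nat.choose_eq_zero_of_lt h]
      simp
  rw [hsum, map_mul, abv_one_add_sum_eq_one hv, mul_one]
  intro i hij
  rw [Finset.mem_range] at hij
  have hc0 : 0 < v ((2 * (j + n)).choose (2 * (i + 1)) : F) :=
    v.pos (Nat.cast_ne_zero.2 (Nat.choose_pos (by omega)).ne')
  rw [map_mul, map_div₀, map_pow, v.map_neg]
  have hnat : v ((j.choose (2 * (i + 1)) * (j + n).choose (i + 1) : ℕ) : F) ≤ 1 :=
    hv.abv_natCast_le _
  have hZi : 0 ≤ v Z ^ (i + 1) := by positivity
  rw [div_mul_eq_mul_div, div_lt_one hc0]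
  refine (mul_le_of_le_one_left hZi hnat).trans_lt ?_
  rcases lt_or_ge (2 * (i + 1)) (p ^ t) with h | h
  · rw [abv_choose_eq_one hv hpp hp hdvd h]
    exact pow_lt_one₀ (apply_nonneg _ _) hZ i.succ_ne_zero
  · have h1 := hi (i + 1) h
    have h2 := hD (2 * (i + 1)) (by omega)
    have h3 : 0 < (2 * (j + n) : ℝ) ^ D := by
      by_contra! h3
      nlinarith
    by_contra! h4
    nlinarith

include hv in
lemma abv_geg_two_mul_eq {n l D : ℕ} (hn : 1 ≤ n) {q : F}
    (hD : ∀ i : ℕ, 1 ≤ i → 1 ≤ v (i * (2 * i).choose i : F) * (2 * i : ℝ) ^ D)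
    (hi : ∀ i : ℕ, 1 ≤ i → v (l : F) * (2 * i : ℝ) ^ D < v q ^ i) :
    v (geg n (1 - 4 * q) (2 * l)) = v (invSqrtCoeff F n l) * v q ^ l := by
  have hq0 : q ≠ 0 := by
    rintro rfl
    have := hi 1 le_rfl
    simp at this
    have : 0 ≤ v (l : F) * 2 ^ D := by positivity
    linarith
  have hsum : geg n (1 - 4 * q) (2 * l) = invSqrtCoeff F n l * q ^ l *
      (1 + ∑ i ∈ Finset.range l, (l.choose (i + 1) * (l + n).choose (i + 1) : ℕ) /
        (2 * (i + 1)).choose (i + 1) / q ^ (i + 1)) := by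
    rw [geg_eq_sum_quadratic hn, ← sum_range_eq_of_le (show l + 1 ≤ 2 * l + 1 by omega)
      fun m hm => by rw [Nat.choose_eq_zero_of_lt (by omega)]; simp]
    rw [← Finset.sum_range_reflect, Finset.sum_range_succ', mul_add, add_comm, Finset.mul_sum]
    congr 1
    · simp [show 2 * l + 2 * n = 2 * n + 2 * l by ring]
    refine Finset.sum_congr rfl fun i hij => ?_
    rw [Finset.mem_range] at hij
    obtain ⟨m, rfl⟩ := Nat.exists_eq_add_of_le (show i + 1 ≤ l by omega)
    have hc : ((2 * (i + 1)).choose (i + 1) : F) ≠ 0 :=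
      Nat.cast_ne_zero.2 (Nat.choose_pos (by omega)).ne'
    have := invSqrtCoeff_mul_centralBinom (F := F) n (i + 1) m
    rw [show i + 1 + m + 1 - 1 - (i + 1) = m by omega]
    push_cast
    rw [pow_add q]
    field_simp
    linear_combination this
  rw [hsum, map_mul, map_mul, map_pow, abv_one_add_sum_eq_one hv, mul_one]
  intro i hij
  rw [Finset.mem_range] at hij
  have h1 := hD (i + 1) (by omega)
  have h2 := hi (i + 1) (by omega)
  have hc0 : 0 < v ((2 * (i + 1)).choose (i + 1) : F) :=
    v.pos (Nat.cast_ne_zero.2 (Nat.choose_pos (by omega)).ne')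
  have hi0 : 0 < v ((i + 1 : ℕ) : F) := v.pos (Nat.cast_ne_zero.2 i.succ_ne_zero)
  have hq : 0 < v q ^ (i + 1) := pow_pos (v.pos hq0) _
  rw [map_div₀, map_div₀, map_pow, div_div, div_lt_one (by positivity)]
  have hl : v ((l.choose (i + 1) * (l + n).choose (i + 1) : ℕ) : F) * v ((i + 1 : ℕ) : F)
      ≤ v (l : F) := by
    rw [← map_mul, ← Nat.cast_mul]
    refine abv_natCast_le_of_dvd hv ?_
    obtain ⟨c, rfl⟩ := Nat.exists_eq_add_of_le' (show 1 ≤ l by omega)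
    have := Nat.add_one_mul_choose_eq c i
    exact ⟨c.choose i * (c + 1 + n).choose (i + 1), by
      linear_combination (c + 1 + n).choose (i + 1) * this.symm⟩
  rw [map_mul] at h1
  push_cast at h1 h2 hi0 hl ⊢
  set P := (2 * ((i : ℝ) + 1)) ^ D
  have hP : 0 < P := by positivity
  set a := v ((i : F) + 1)
  set c := v ((2 * (i + 1)).choose (i + 1) : F)
  set x := v ((l.choose (i + 1) : F) * (l + n).choose (i + 1))
  calc x ≤ x * (a * c * P) := le_mul_of_one_le_right (apply_nonneg _ _) h1
    _ = x * a * (c * P) := by ring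
    _ ≤ v (l : F) * (c * P) := by gcongr
    _ = c * (v (l : F) * P) := by ring
    _ < c * v q ^ (i + 1) := by gcongr

end LeadingTerms

lemma exists_one_lt_pow_lt {x : ℝ} (hx : 1 < x) (m : ℕ) : ∃ b : ℝ, 1 < b ∧ b ^ m < x := by
  have h : ∀ᶠ b : ℝ in 𝓝[>] 1, b ^ m < x :=
    ((continuous_pow m).tendsto 1).mono_left nhdsWithin_le_nhds |>.eventually
      (gt_mem_nhds (by simpa using hx))
  obtain ⟨b, hb, hb'⟩ := (h.and self_mem_nhdsWithin).exists
  exact ⟨b, hb', hb⟩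

section BadPlaces

variable {F : Type*} [Field F] [CharZero F] {v : AbsoluteValue F ℝ} (hv : IsNonarchimedean v)

include hv in
lemma eventually_abv_geg_of_abv_lt_one {p : ℕ} (hpp : p.Prime) (hp : v (p : F) < 1) (hp2 : p ≠ 2)
    {n : ℕ} (hn : 1 ≤ n) {Z : F} (hZ0 : Z ≠ 0) (hZ : v Z < 1) {b : ℝ} (hb : 1 < b) :
    ∀ᶠ k : ℕ in atTop, geg n Z (k + 1) = 0 → (1 : ℝ) ^ k ≤ b ^ k * v (geg n Z k) := by
  obtain ⟨A₀, hA₀⟩ := exists_one_le_abv_invSqrtCoeff_mul_pow hv hpp hp hn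
  obtain ⟨D, hD⟩ := exists_one_le_abv_mul_pow hv hpp hp
  refine eventually_pow_le_abv_geg_of_near hv hpp hp hZ0 le_rfl (A₀ + 1) ?_ hb
  have hvZ : 0 < v Z := v.pos hZ0
  obtain ⟨β, hβ, hβ'⟩ := exists_one_lt_pow_lt ((one_lt_inv₀ hvZ).2 hZ) (2 * p)
  have hsqrt : Tendsto Nat.sqrt atTop atTop :=
    tendsto_atTop.2 fun m => (eventually_ge_atTop (m * m)).mono fun k hk => Nat.le_sqrt.2 hk
  filter_upwards [hsqrt.eventually (eventually_pow_sqrt_le 2 (n + 1 + 2 * D) hβ),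
    eventually_ge_atTop 1] with k hk hk1
  set r := k.sqrt with hr
  have hr1 : 1 ≤ r := Nat.le_sqrt.2 (by omega)
  have hrk : r ≤ k := Nat.sqrt_le_self k
  set t := Nat.log p r with ht
  have hP1 : p ^ t ≤ r := Nat.pow_log_le_self p (by omega)
  have hP2 : r < p ^ t * p := by rw [← pow_succ]; exact Nat.lt_pow_succ_log_self hpp.one_lt r
  have hodd : Odd (p ^ t) := (hpp.odd_of_ne_two hp2).pow
  obtain ⟨c, hc⟩ := hodd
  have hi := Nat.mod_lt (k + n - c) (show 0 < p ^ t by omega)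
  have hmd := Nat.mod_add_div (k + n - c) (p ^ t)
  set i := (k + n - c) % p ^ t with hi_def
  set d := (k + n - c) / p ^ t
  have hik : i ≤ k := by omega
  clear_value i d
  obtain ⟨j, rfl⟩ := Nat.exists_eq_add_of_le' hik
  have hj : j + n = p ^ t * d + c := by omega
  have hdvd : p ^ t ∣ 2 * (j + n) + 1 := by
    rw [hj, show 2 * (p ^ t * d + c) + 1 = p ^ t * (2 * d) + (2 * c + 1) by ring, ← hc]
    exact dvd_add (dvd_mul_right _ _) dvd_rfl
  refine ⟨j, i, rfl, by nlinarith, ?_⟩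
  rw [abv_geg_eq_of_dvd hv hpp hp (D := D) hZ hdvd, map_div₀, one_pow]
  · have h2 : v ((2 : F) ^ j) ≤ 1 := by
      have := hv.abv_natCast_le (2 ^ j)
      push_cast at this; exact this
    have h20 : 0 < v ((2 : F) ^ j) := v.pos (pow_ne_zero _ two_ne_zero)
    refine (hA₀ (A₀ + 1) j (j + i) (by omega) (by omega)).trans ?_
    gcongr
    exact le_div_self (apply_nonneg _ _) h20 h2
  · intro m hm
    have := hD ((2 * (j + n)).choose m) (2 * (j + n)) (Nat.choose_pos hm).ne'
      (Nat.pow_factorization_choose_le (by omega))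
    exact_mod_cast this
  · intro m hm
    have hrm : r ≤ 2 * p * m := by nlinarith [hpp.pos]
    have hm0 : m ≠ 0 := by rintro rfl; omega
    have hkr : j + i < (r + 1) * (r + 1) := Nat.lt_succ_sqrt (j + i)
    have hB0 : (1 : ℝ) ≤ (2 : ℕ) * ((r : ℝ) + (n + 1 + 2 * D : ℕ)) := by
      push_cast
      have : (0 : ℝ) ≤ r := by positivity
      have : (0 : ℝ) ≤ n := by positivity
      have : (0 : ℝ) ≤ D := by positivity
      linarith
    have hbase : (2 * (j + n) : ℝ) ≤ ((2 : ℕ) * ((r : ℝ) + (n + 1 + 2 * D : ℕ))) ^ 2 := by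
      have : 2 * (j + n) ≤ (2 * (r + (n + 1 + 2 * D))) ^ 2 := by
        have : j ≤ (r + 1) * (r + 1) := by omega
        have h3 := Nat.pow_le_pow_left (show 2 * (r + 1 + n) ≤ 2 * (r + (n + 1 + 2 * D)) by omega) 2
        nlinarith
      exact_mod_cast this
    calc (2 * (j + n) : ℝ) ^ D * v Z ^ m ≤ β ^ (2 * p * m) * v Z ^ m := by
          gcongr
          refine (pow_le_pow_left₀ (by positivity) hbase D).trans ?_
          rw [← pow_mul]
          exact ((pow_le_pow_right₀ hB0 (by omega)).trans hk).trans (pow_le_pow_right₀ hβ.le hrm)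
      _ = (β ^ (2 * p) * v Z) ^ m := by rw [mul_pow, ← pow_mul]
      _ < 1 := pow_lt_one₀ (by positivity) (by rwa [← one_div, lt_div_iff₀ hvZ] at hβ') hm0

include hv in
lemma eventually_abv_geg_of_one_lt {n : ℕ} (hn : 1 ≤ n) {q : F} (h2 : v ((2 : ℕ) : F) < 1)
    (hq : 1 < v q) (hZ0 : 1 - 4 * q ≠ 0) {H : ℝ} (hH : 1 ≤ H) (hHq : v q = H ^ 2)
    {b : ℝ} (hb : 1 < b) : ∀ᶠ k : ℕ in atTop,
      geg n (1 - 4 * q) (k + 1) = 0 → H ^ k ≤ b ^ k * v (geg n (1 - 4 * q) k) := by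
  obtain ⟨A₀, hA₀⟩ := exists_one_le_abv_invSqrtCoeff_mul_pow hv Nat.prime_two h2 hn
  obtain ⟨D, hD⟩ := exists_one_le_abv_mul_pow hv Nat.prime_two h2
  have htend := tendsto_pow_const_div_const_pow_of_one_lt (2 * D) hq
  obtain ⟨S, hS⟩ := htend.bddAbove_range
  have hS' (i : ℕ) : (i : ℝ) ^ (2 * D) ≤ S * v q ^ i := by
    have := hS ⟨i, rfl⟩
    rwa [div_le_iff₀ (by positivity)] at this
  have hS0 : 0 ≤ S := by
    have := hS' 1
    simp at this
    nlinarith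
  obtain ⟨t, ht⟩ := exists_pow_lt_of_lt_one (show 0 < (S * 2 ^ (2 * D) + 1)⁻¹ by positivity) h2
  rw [← one_div, lt_div_iff₀ (by positivity)] at ht
  refine eventually_pow_le_abv_geg_of_near hv Nat.prime_two h2 hZ0 hH (A₀ + 2 * 2 ^ t) ?_ hb
  refine Eventually.of_forall fun k => ?_
  have hi := Nat.mod_lt k (show 0 < 2 * 2 ^ t by positivity)
  have hmd := Nat.mod_add_div k (2 * 2 ^ t)
  set i := k % (2 * 2 ^ t)
  set d := k / (2 * 2 ^ t)
  have hk : 2 * (2 ^ t * d) + i = k := by rw [← mul_assoc]; omega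
  refine ⟨2 * (2 ^ t * d), i, hk,
    hi.le.trans ((Nat.le_add_left _ _).trans (Nat.le_add_left _ _)), ?_⟩
  set l := 2 ^ t * d with hl
  rw [abv_geg_two_mul_eq hv (D := 2 * D) hn, pow_mul, ← hHq, ← mul_assoc]
  · exact le_mul_of_one_le_left (by positivity) (hA₀ _ _ _ (by omega) (by omega))
  · intro i hi
    have h1 := hD i (2 * i) (by omega) ((Nat.ordProj_le 2 (by omega)).trans (by omega))
    have h3 := hD ((2 * i).choose i) (2 * i) (Nat.choose_pos (by omega)).ne'
      (Nat.pow_factorization_choose_le (by omega))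
    rw [map_mul, mul_comm 2 D, pow_mul, sq]
    push_cast at h1 h3
    refine (one_le_mul_of_one_le_of_one_le h1 h3).trans_eq ?_
    ring
  · intro i hi
    have hvl : v (l : F) ≤ v ((2 : ℕ) : F) ^ t := by
      rw [← map_pow, ← Nat.cast_pow]
      exact abv_natCast_le_of_dvd hv (dvd_mul_right _ _)
    have hqi : 0 < v q ^ i := by positivity
    calc v (l : F) * (2 * i : ℝ) ^ (2 * D)
        ≤ v ((2 : ℕ) : F) ^ t * (2 ^ (2 * D) * (S * v q ^ i)) := by
          rw [mul_pow]; gcongr; exact hS' i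
      _ = v ((2 : ℕ) : F) ^ t * (S * 2 ^ (2 * D)) * v q ^ i := by ring
      _ < 1 * v q ^ i := by
          gcongr
          refine lt_of_le_of_lt ?_ ht
          gcongr
          linarith
      _ = v q ^ i := one_mul _

include hv in
lemma eventually_abv_geg_of_abv_lt {p : ℕ} (hpp : p.Prime) (hp : v (p : F) < 1)
    {n : ℕ} (hn : 1 ≤ n) {q : F} (hZ0 : 1 - 4 * q ≠ 0) {H : ℝ} (hH0 : 0 ≤ H)
    (hH : H ^ 2 = max 1 (v q)) (hlt : v (1 - 4 * q) < H ^ 2) {b : ℝ} (hb : 1 < b) :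
    ∀ᶠ k : ℕ in atTop,
      geg n (1 - 4 * q) (k + 1) = 0 → H ^ k ≤ b ^ k * v (geg n (1 - 4 * q) k) := by
  have h4 : v 4 * v q ≤ max 1 (v (1 - 4 * q)) := by
    have := hv.abv_sub_le 1 (1 - 4 * q)
    rwa [sub_sub_cancel, map_mul, map_one] at this
  have h2 : v (4 : F) = v ((2 : ℕ) : F) ^ 2 := by rw [← map_pow]; norm_num
  rcases le_or_gt (v q) 1 with hq | hq
  · rw [max_eq_left hq] at hH
    obtain rfl : H = 1 := by nlinarith
    refine eventually_abv_geg_of_abv_lt_one hv hpp hp ?_ hn hZ0 (by simpa using hlt) hb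
    rintro rfl
    have h4q : v (4 * q) < 1 := by
      rw [map_mul, h2]
      have := mul_le_of_le_one_right (sq_nonneg (v ((2 : ℕ) : F))) hq
      nlinarith [apply_nonneg v ((2 : ℕ) : F)]
    have := hv (1 - 4 * q) (4 * q)
    rw [sub_add_cancel, map_one] at this
    have := this.trans_lt (max_lt (by simpa using hlt) h4q)
    exact this.false
  · rw [max_eq_right hq.le] at hH
    refine eventually_abv_geg_of_one_lt hv hn ?_ hq hZ0 (by nlinarith) hH.symm hb
    have h5 : v 4 * v q < v q := h4.trans_lt (max_lt hq (hH ▸ hlt))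
    rw [h2] at h5
    by_contra! h6
    nlinarith [apply_nonneg v ((2 : ℕ) : F), one_le_pow₀ h6 (n := 2)]

end BadPlaces

section Archimedean

lemma gegSnd_energy_le {n : ℕ} (hn : 1 ≤ n) {Z : ℝ} (hZ : 1 ≤ Z) (k : ℕ) :
    (gegSnd n Z (k + 1) ^ 2 - 2 * gegSnd n Z (k + 1) * gegSnd n Z k + Z * gegSnd n Z k ^ 2)
        * ((2 * n).factorial : ℝ) ^ 2
      ≤ ((k + 2).ascFactorial (2 * n - 1) : ℕ) ^ 2 * Z ^ k := by
  induction k with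
  | zero =>
    have := Nat.factorial_mul_ascFactorial 1 (2 * n - 1)
    rw [show 1 + (2 * n - 1) = 2 * n by omega] at this
    simp only [gegSnd, zero_add]
    rw [← this]; simp
  | succ k ih =>
    have h3 : ((k : ℝ) + 2) * ((k + 1 + 2).ascFactorial (2 * n - 1) : ℕ)
        = (k + 2 * n + 1) * ((k + 2).ascFactorial (2 * n - 1) : ℕ) := by
      exact_mod_cast add_two_mul_ascFactorial_succ hn k
    have h2 : (0 : ℝ) < (k : ℝ) + 2 := by positivity
    have e := gegSnd_recurrence n Z k
    have hn' : (1 : ℝ) ≤ n := by exact_mod_cast hn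
    set x := gegSnd n Z k
    set y := gegSnd n Z (k + 1)
    set w := gegSnd n Z (k + 2)
    set A : ℝ := (((k + 1 + 2).ascFactorial (2 * n - 1) : ℕ) : ℝ)
    set B : ℝ := (((k + 2).ascFactorial (2 * n - 1) : ℕ) : ℝ)
    set P : ℝ := ((2 * n).factorial : ℝ)
    have hstep : (k + 2) ^ 2 * (w ^ 2 - 2 * w * y + Z * y ^ 2)
        ≤ (k + 2 * n + 1) ^ 2 * (Z * (y ^ 2 - 2 * y * x + Z * x ^ 2)) := by
      have h4 : 0 ≤ ((k + 2 * n + 1) ^ 2 - (k + 2) ^ 2) * ((Z - 1) * y ^ 2) := by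
        refine mul_nonneg ?_ (mul_nonneg (by linarith) (sq_nonneg y))
        nlinarith [(Nat.cast_nonneg k : (0 : ℝ) ≤ k)]
      have h5 : (k + 2) * (w - y) = (k + 2) * (y - Z * x) + (2 * n - 1) * (y - Z * x) := by
        linear_combination e
      have h6 : (k + 2) ^ 2 * (w ^ 2 - 2 * w * y + Z * y ^ 2)
          = ((k + 2) * (w - y)) ^ 2 + (k + 2) ^ 2 * ((Z - 1) * y ^ 2) := by ring
      rw [h6, h5]
      nlinarith
    refine le_of_mul_le_mul_left ?_ (pow_pos h2 2)
    calc _ = (k + 2) ^ 2 * (w ^ 2 - 2 * w * y + Z * y ^ 2) * P ^ 2 := by ring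
      _ ≤ (k + 2 * n + 1) ^ 2 * (Z * (y ^ 2 - 2 * y * x + Z * x ^ 2)) * P ^ 2 := by gcongr
      _ = (k + 2 * n + 1) ^ 2 * Z * ((y ^ 2 - 2 * y * x + Z * x ^ 2) * P ^ 2) := by ring
      _ ≤ (k + 2 * n + 1) ^ 2 * Z * (B ^ 2 * Z ^ k) := by gcongr
      _ = ((k + 2 * n + 1) * B) ^ 2 * Z ^ (k + 1) := by ring
      _ = (k + 2) ^ 2 * (A ^ 2 * Z ^ (k + 1)) := by rw [← h3]; ring

lemma le_geg_sq_of_eq_zero {n : ℕ} (hn : 1 ≤ n) {Z : ℝ} (hZ : 1 < Z) {k : ℕ}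
    (h : geg n Z (k + 1) = 0) : (Z - 1) * Z ^ k ≤ Z * geg n Z k ^ 2 := by
  have h1 := geg_mul_gegSnd_of_eq_zero hn h
  have h2 := gegSnd_energy_le hn hZ.le k
  set B : ℝ := (((k + 2).ascFactorial (2 * n - 1) : ℕ) : ℝ) with hB
  have hB0 : 0 < B := by
    rw [hB]; exact_mod_cast Nat.ascFactorial_pos _ _
  set P : ℝ := ((2 * n).factorial : ℝ)
  set y := gegSnd n Z (k + 1)
  set x := gegSnd n Z k
  set c := geg n Z k
  have hZk : 0 < Z ^ k := by positivity
  have h3 : (Z - 1) * y ^ 2 ≤ Z * (y ^ 2 - 2 * y * x + Z * x ^ 2) := by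
    nlinarith [sq_nonneg (y - Z * x)]
  refine le_of_mul_le_mul_left ?_ (show 0 < B ^ 2 * Z ^ k by positivity)
  calc B ^ 2 * Z ^ k * ((Z - 1) * Z ^ k) = (Z - 1) * (B * Z ^ k) ^ 2 := by ring
    _ = (P * c) ^ 2 * ((Z - 1) * y ^ 2) := by rw [← h1]; ring
    _ ≤ (P * c) ^ 2 * (Z * (y ^ 2 - 2 * y * x + Z * x ^ 2)) := by gcongr
    _ = c ^ 2 * Z * ((y ^ 2 - 2 * y * x + Z * x ^ 2) * P ^ 2) := by ring
    _ ≤ c ^ 2 * Z * (B ^ 2 * Z ^ k) := by gcongr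
    _ = B ^ 2 * Z ^ k * (Z * c ^ 2) := by ring

/-- The zeros of `geg n · (k + 1)` in the complex numbers are real. -/
lemma im_eq_zero_of_geg_eq_zero {n : ℕ} {x : ℂ} (hx : x ≠ 0) {k : ℕ}
    (h : geg n (x ^ 2)⁻¹ (k + 1) = 0) : x.im = 0 := by
  by_contra him
  set c : ℕ → ℂ := fun k => x ^ k * geg n (x ^ 2)⁻¹ k with hc
  have hrec (k : ℕ) : c (k + 2) = ((2 * k + 2 * n + 3 : ℝ) * (x * c (k + 1))
      - (k + 2 * n + 1 : ℝ) * c k) / ((k + 2 : ℝ) : ℂ) := by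
    have h2 : (k : ℂ) + 2 ≠ 0 := by exact_mod_cast (k + 1).succ_ne_zero
    have e := geg_recurrence n (x ^ 2)⁻¹ k
    simp only [hc]
    push_cast
    rw [eq_div_iff h2]
    have hx2 : x ^ 2 * (x ^ 2)⁻¹ = 1 := mul_inv_cancel₀ (pow_ne_zero _ hx)
    linear_combination x ^ (k + 2) * e
      - (k + 2 * n + 1) * x ^ k * geg n (x ^ 2)⁻¹ k * hx2
  have key (k : ℕ) : 0 < x.im * (c (k + 1) * (starRingEnd ℂ) (c k)).im := by
    induction k with
    | zero =>
      have : (c 1 * (starRingEnd ℂ) (c 0)).im = (2 * n + 1) * x.im := by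
        simp [hc, geg]; ring
      rw [zero_add, this]
      have : 0 < x.im ^ 2 := by positivity
      have : (0 : ℝ) ≤ n := by positivity
      nlinarith
    | succ k ih =>
      have hk : (0 : ℝ) < k + 2 := by positivity
      have e : x.im * (c (k + 2) * (starRingEnd ℂ) (c (k + 1))).im
          = ((2 * k + 2 * n + 3) * (x.im ^ 2 * Complex.normSq (c (k + 1)))
            + (k + 2 * n + 1) * (x.im * (c (k + 1) * (starRingEnd ℂ) (c k)).im)) / (k + 2) := by
        rw [hrec k]
        generalize c (k + 1) = y
        generalize c k = u
        rw [eq_div_iff hk.ne', div_mul_eq_mul_div, Complex.div_ofReal_im,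
          mul_assoc, div_mul_cancel₀ _ hk.ne', sub_mul, Complex.sub_im, mul_assoc, mul_assoc,
          mul_assoc, Complex.im_ofReal_mul, Complex.im_ofReal_mul]
        simp only [Complex.mul_im, Complex.mul_re, Complex.conj_re, Complex.conj_im,
          Complex.normSq_apply]
        ring
      rw [e]
      have := Complex.normSq_nonneg (c (k + 1))
      positivity
  have := key k
  simp [hc, h] at this

lemma eventually_pow_le_norm_geg {n : ℕ} (hn : 1 ≤ n) {Z : ℂ} (hZ0 : Z ≠ 0) {b : ℝ} (hb : 1 < b) :
    ∀ᶠ k : ℕ in atTop, geg n Z (k + 1) = 0 →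
      ∃ r : ℝ, Z = r ∧ 1 < r ∧ r ^ k ≤ (b ^ k * ‖geg n Z k‖) ^ 2 := by
  by_cases hex : ∃ r : ℝ, Z = r ∧ 1 < r
  · obtain ⟨r, rfl, hr⟩ := hex
    have hev := (tendsto_pow_atTop_atTop_of_one_lt hb).eventually_ge_atTop (r / (r - 1))
    filter_upwards [hev] with k hk h
    refine ⟨r, rfl, hr, ?_⟩
    have hmap (j : ℕ) : geg n (r : ℂ) j = (geg n r j : ℝ) :=
      (map_geg Complex.ofRealHom n r j).symm
    rw [hmap, Complex.ofReal_eq_zero] at h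
    have h1 := le_geg_sq_of_eq_zero hn hr h
    rw [hmap, Complex.norm_real, mul_pow, Real.norm_eq_abs, sq_abs]
    have hbk : 1 ≤ b ^ k := one_le_pow₀ hb.le
    rw [div_le_iff₀ (by linarith)] at hk
    have hr1 : 0 < r - 1 := by linarith
    refine le_of_mul_le_mul_left ?_ hr1
    calc (r - 1) * r ^ k ≤ r * geg n r k ^ 2 := h1
      _ ≤ b ^ k * (r - 1) * geg n r k ^ 2 := by gcongr
      _ ≤ b ^ k * (b ^ k * ((r - 1) * geg n r k ^ 2)) := by
          rw [mul_assoc]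
          exact mul_le_mul_of_nonneg_left (le_mul_of_one_le_left (by positivity) hbk)
            (by positivity)
      _ = _ := by ring
  · refine Eventually.of_forall fun k h => (hex ?_).elim
    obtain ⟨x, hx⟩ := IsAlgClosed.exists_pow_nat_eq Z⁻¹ two_pos
    obtain rfl : Z = (x ^ 2)⁻¹ := by rw [hx, inv_inv]
    have hx0 : x ≠ 0 := by rintro rfl; simp at hZ0
    have hxr : ((x.re : ℝ) : ℂ) = x :=
      Complex.ext (by simp) (by simp [im_eq_zero_of_geg_eq_zero hx0 h])
    refine ⟨(x.re ^ 2)⁻¹, by push_cast; rw [hxr], ?_⟩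
    by_contra! hle
    refine (geg_pos_of_le_one n hle (k + 1)).ne' ?_
    have := map_geg Complex.ofRealHom n (x.re ^ 2)⁻¹ (k + 1)
    simp only [Complex.ofRealHom_eq_coe, Complex.ofReal_inv, Complex.ofReal_pow, hxr, h,
      Complex.ofReal_eq_zero] at this
    exact this

end Archimedean

section FinitePlaces

lemma pow_card_le_finprod {α : Type*} {f : α → ℝ} (hf : f.HasFiniteMulSupport) {s : Finset α}
    {c : ℝ} (hc : 0 ≤ c) (h1 : ∀ a ∉ s, 1 ≤ f a) (h2 : ∀ a ∈ s, c ≤ f a) :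
    c ^ s.card ≤ ∏ᶠ a, f a := by
  classical
  obtain ⟨t, ht⟩ := Set.Finite.exists_finset_coe hf
  rw [finprod_eq_prod_of_mulSupport_subset f (s := s ∪ t) (by
    rw [Finset.coe_union, ht]; exact Set.subset_union_right),
    ← Finset.prod_sdiff (Finset.subset_union_left (s₁ := s) (s₂ := t))]
  have h3 : c ^ s.card ≤ ∏ a ∈ s, f a := by
    rw [← Finset.prod_const]
    exact Finset.prod_le_prod (fun _ _ => hc) h2
  refine h3.trans (le_mul_of_one_le_left ((pow_nonneg hc _).trans h3) ?_)
  rw [← Finset.prod_const_one (s := (s ∪ t) \ s)]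
  exact Finset.prod_le_prod (fun _ _ => zero_le_one)
    fun a ha => h1 a (Finset.mem_sdiff.1 ha).2

lemma NumberField.FinitePlace.exists_prime_abv_lt_one {K : Type*} [Field K] [NumberField K]
    (v : NumberField.FinitePlace K) : ∃ p : ℕ, p.Prime ∧ v.1 (p : K) < 1 := by
  by_contra! h
  have hone (m : ℕ) (hm : m ≠ 0) : 1 ≤ v.1 (m : K) := by
    induction m using induction_on_primes with
    | zero => exact (hm rfl).elim
    | one => simp
    | prime_mul p a hp ih =>
      rw [Nat.cast_mul, map_mul]
      exact one_le_mul_of_one_le_of_one_le (h p hp) (ih (right_ne_zero_of_mul hm))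
  set P := v.maximalIdeal
  have hmem : ((Ideal.absNorm P.asIdeal : ℕ) : NumberField.RingOfIntegers K) ∈ P.asIdeal :=
    Ideal.absNorm_mem _
  rw [← NumberField.FinitePlace.norm_lt_one_iff_mem K, NumberField.FinitePlace.norm_embedding_eq,
    map_natCast] at hmem
  exact (hone _ (zero_lt_one.trans (NumberField.HeightOneSpectrum.one_lt_absNorm P)).ne').not_gt
    hmem

variable {F : Type*} [Field F] [CharZero F] {v : AbsoluteValue F ℝ} (hv : IsNonarchimedean v)

include hv in
lemma eventually_abv_gegBound_mul_pow_le {p : ℕ} (hpp : p.Prime) (hp : v (p : F) < 1)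
    {n : ℕ} (hn : 1 ≤ n) {q : F} (hZ0 : 1 - 4 * q ≠ 0) {H : ℝ} (hH0 : 0 ≤ H)
    (hH : H ^ 2 = max 1 (v q)) {b : ℝ} (hb : 1 < b) :
    ∀ᶠ k : ℕ in atTop, geg n (1 - 4 * q) (k + 1) = 0 →
      v (gegBound n (k + 1) : F) * H ^ k ≤ b ^ k * v (geg n (1 - 4 * q) k) := by
  have hH1 : 1 ≤ H := by
    have : 1 ≤ H ^ 2 := hH ▸ le_max_left _ _
    nlinarith
  have hqH : v q ≤ H ^ 2 := hH ▸ le_max_right _ _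
  have hle : v (1 - 4 * q) ≤ H ^ 2 := by
    refine (hv.abv_sub_le 1 (4 * q)).trans ?_
    rw [hH, map_one, map_mul]
    refine max_le_max le_rfl (mul_le_of_le_one_left (apply_nonneg _ _) ?_)
    exact_mod_cast hv.abv_natCast_le 4
  rcases hle.lt_or_eq with hlt | heq
  · filter_upwards [eventually_abv_geg_of_abv_lt hv hpp hp hn hZ0 hH0 hH hlt hb] with k hk h
    exact (mul_le_of_le_one_left (by positivity) (hv.abv_natCast_le _)).trans (hk h)
  · filter_upwards [eventually_ge_atTop (4 * n + 4), eventually_ge_atTop (2 * p)] with k hk1 hk2 h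
    refine (gegBound_le_abv_geg hv hpp hp hH1 hqH heq hn hk1 (fun h => by omega) h).trans ?_
    exact le_mul_of_one_le_left (apply_nonneg _ _) (one_le_pow₀ hb.le)

lemma one_le_pow_mul_div {L H B c t : ℝ} {k : ℕ} (hL : 0 < L) (hH : 1 ≤ H) (ht0 : 0 < t)
    (ht : t ≤ H ^ 2) (h : L * H ^ k ≤ B * c) :
    1 ≤ B ^ 10 * (c ^ 10 / (L ^ 10 * t ^ (4 * k))) := by
  rw [← mul_div_assoc, one_le_div (by positivity), ← mul_pow]
  calc L ^ 10 * t ^ (4 * k) ≤ L ^ 10 * (H ^ 2) ^ (4 * k) := by gcongr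
    _ = L ^ 10 * H ^ (8 * k) := by rw [← pow_mul]; ring_nf
    _ ≤ L ^ 10 * H ^ (k * 10) :=
        mul_le_mul_of_nonneg_left (pow_le_pow_right₀ hH (by omega)) (by positivity)
    _ = (L * H ^ k) ^ 10 := by rw [mul_pow, ← pow_mul]
    _ ≤ (B * c) ^ 10 := by gcongr

end FinitePlaces

section NumberFields

lemma le_one_add_four_mul_pow_five {t : ℝ} (ht : 0 ≤ t) : 5 ^ 5 * t ^ 4 ≤ (1 + 4 * t) ^ 5 := by
  have : 0 ≤ (t - 1) ^ 2 * (1024 * t ^ 3 + 203 * t ^ 2 + 22 * t + 1) := by positivity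
  linarith

lemma le_pow_div_pow {r t b c L : ℝ} {k : ℕ} (hr : r = 1 + 4 * t) (ht : 0 < t) (hb : 0 < b)
    (hL0 : 0 < L) (hL : L ≤ b ^ (k + 1) * 2 ^ (k + 1)) (hc : r ^ k ≤ (b ^ k * c) ^ 2) :
    (5 ^ 5 / (b ^ 20 * 2 ^ 10)) ^ k / (b ^ 10 * 2 ^ 10) ≤ c ^ 10 / (L ^ 10 * t ^ (4 * k)) := by
  have h1 : (5 ^ 5) ^ k * t ^ (4 * k) ≤ b ^ (10 * k) * c ^ 10 := by
    calc (5 ^ 5) ^ k * t ^ (4 * k) = (5 ^ 5 * t ^ 4) ^ k := by rw [mul_pow, ← pow_mul t]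
      _ ≤ (r ^ 5) ^ k := by
          rw [hr]; exact pow_le_pow_left₀ (by positivity) (le_one_add_four_mul_pow_five ht.le) k
      _ = (r ^ k) ^ 5 := by rw [← pow_mul, ← pow_mul, mul_comm]
      _ ≤ ((b ^ k * c) ^ 2) ^ 5 := by
          have : 0 < r := by linarith
          gcongr
      _ = b ^ (10 * k) * c ^ 10 := by ring
  rw [div_pow, div_div, div_le_div_iff₀ (by positivity) (by positivity)]
  calc (5 ^ 5) ^ k * (L ^ 10 * t ^ (4 * k)) = (5 ^ 5) ^ k * t ^ (4 * k) * L ^ 10 := by ring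
    _ ≤ b ^ (10 * k) * c ^ 10 * (b ^ (k + 1) * 2 ^ (k + 1)) ^ 10 := by gcongr
    _ = c ^ 10 * ((b ^ 20 * 2 ^ 10) ^ k * (b ^ 10 * 2 ^ 10)) := by
        generalize (2 : ℝ) = s
        ring

variable {K : Type*} [Field K] [NumberField K]

open NumberField in
lemma InfinitePlace.le_prod_pow_mult {y : K} {x : ℝ} (hx : 1 ≤ x)
    (h : ∀ w : InfinitePlace K, x ≤ w y) : x ≤ ∏ w : InfinitePlace K, w y ^ w.mult := by
  classical
  have h1 (w : InfinitePlace K) : x ≤ w y ^ w.mult :=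
    (h w).trans (le_self_pow₀ (hx.trans (h w)) w.mult_ne_zero)
  obtain ⟨w⟩ := (inferInstance : Nonempty (InfinitePlace K))
  rw [← Finset.mul_prod_erase _ _ (Finset.mem_univ w)]
  refine (h1 w).trans (le_mul_of_one_le_right (zero_le_one.trans (hx.trans (h1 w))) ?_)
  rw [← Finset.prod_const_one (s := Finset.univ.erase w)]
  exact Finset.prod_le_prod (fun _ _ => zero_le_one) fun w' _ => hx.trans (h1 w')

lemma geg_ne_zero_of_succ_eq_zero {n : ℕ} (hn : 1 ≤ n) {Z : K} (hZ : Z ≠ 0) {k : ℕ}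
    (h : geg n Z (k + 1) = 0) : geg n Z k ≠ 0 := by
  intro h0
  have := geg_mul_gegSnd_of_eq_zero hn h
  rw [h0, zero_mul, mul_zero, eq_comm, mul_eq_zero, Nat.cast_eq_zero] at this
  exact this.elim (Nat.ascFactorial_pos _ _).ne' (pow_ne_zero _ hZ)

open NumberField in
theorem eventually_geg_ne_zero {n : ℕ} (hn : 1 ≤ n) {q : K} (hq : q ≠ 0) (hZ : 1 - 4 * q ≠ 0) :
    ∀ᶠ k : ℕ in atTop, geg n (1 - 4 * q) (k + 1) ≠ 0 := by
  have hfinset : {v : FinitePlace K | v q ≠ 1 ∨ v (1 - 4 * q) ≠ 1}.Finite :=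
    (FinitePlace.hasFiniteMulSupport hq).union (FinitePlace.hasFiniteMulSupport hZ)
  set E := hfinset.toFinset with hE
  obtain ⟨b, hb1, hb⟩ := exists_one_lt_pow_lt (show (1 : ℝ) < 5 ^ 5 / 2 ^ 10 by norm_num)
    (20 + 10 * E.card)
  have hb0 : 0 < b := by linarith
  have hna (v : FinitePlace K) : IsNonarchimedean v.1 := v.add_le
  set H : FinitePlace K → ℝ := fun v => √(max 1 (v q)) with hH
  have hH2 (v : FinitePlace K) : H v ^ 2 = max 1 (v q) := Real.sq_sqrt (by positivity)
  have hH1 (v : FinitePlace K) : 1 ≤ H v := Real.one_le_sqrt.2 (le_max_left _ _)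
  have hqH (v : FinitePlace K) : v q ≤ H v ^ 2 := hH2 v ▸ le_max_right _ _
  have hbad : ∀ᶠ k : ℕ in atTop, ∀ v ∈ E, geg n (1 - 4 * q) (k + 1) = 0 →
      v.1 (gegBound n (k + 1) : K) * H v ^ k ≤ b ^ k * v.1 (geg n (1 - 4 * q) k) := by
    rw [eventually_all_finset]
    intro v _
    obtain ⟨p, hpp, hp⟩ := v.exists_prime_abv_lt_one
    exact eventually_abv_gegBound_mul_pow_le (hna v) hpp hp hn hZ (zero_le_one.trans (hH1 v))
      (hH2 v) hb1
  have hinf : ∀ᶠ k : ℕ in atTop, ∀ w : InfinitePlace K,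
      geg n (w.embedding (1 - 4 * q)) (k + 1) = 0 →
      ∃ r : ℝ, w.embedding (1 - 4 * q) = r ∧ 1 < r ∧
        r ^ k ≤ (b ^ k * ‖geg n (w.embedding (1 - 4 * q)) k‖) ^ 2 :=
    eventually_all.2 fun w => eventually_pow_le_norm_geg hn ((map_ne_zero w.embedding).2 hZ) hb1
  have hbase : 1 < 5 ^ 5 / (b ^ 20 * 2 ^ 10) / (b ^ 10) ^ E.card := by
    rw [div_div, lt_div_iff₀ (by positivity), ← pow_mul]
    rw [lt_div_iff₀ (by positivity), pow_add] at hb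
    linarith
  have hbase' : 1 < 5 ^ 5 / (b ^ 20 * 2 ^ 10) :=
    hbase.trans_le (div_le_self (by positivity) (one_le_pow₀ (one_le_pow₀ hb1.le)))
  filter_upwards [hbad, hinf, eventually_ge_atTop (4 * n + 4),
    (tendsto_add_atTop_nat 1).eventually (eventually_gegBound_le n hb1),
    (tendsto_pow_atTop_atTop_of_one_lt hbase).eventually_gt_atTop (b ^ 10 * 2 ^ 10),
    (tendsto_pow_atTop_atTop_of_one_lt hbase').eventually_ge_atTop (b ^ 10 * 2 ^ 10)]
    with k hbad hinf hk hL hbig hbig' h0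
  have hc0 := geg_ne_zero_of_succ_eq_zero hn hZ h0
  have hLpos := gegBound_pos n (k + 1)
  have hL0 : (gegBound n (k + 1) : K) ≠ 0 := by exact_mod_cast hLpos.ne'
  set c := geg n (1 - 4 * q) k with hc
  set L := gegBound n (k + 1)
  set y : K := c ^ 10 / ((L : K) ^ 10 * q ^ (4 * k)) with hy
  have hy0 : y ≠ 0 := by positivity
  set x := (5 ^ 5 / (b ^ 20 * 2 ^ 10)) ^ k / (b ^ 10 * 2 ^ 10) with hx
  have hx1 : 1 ≤ x := (one_le_div (by positivity)).2 hbig'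
  have hprod := prod_abs_eq_one hy0
  have hI : x ≤ ∏ w : InfinitePlace K, w y ^ w.mult := by
    refine InfinitePlace.le_prod_pow_mult hx1 fun w => ?_
    obtain ⟨r, hr, hr1, hrk⟩ := hinf w (by rw [← map_geg, h0, map_zero])
    rw [← map_geg, InfinitePlace.norm_embedding_eq] at hrk
    have hwq : w q = (r - 1) / 4 := by
      rw [← InfinitePlace.norm_embedding_eq]
      have : w.embedding q = (((1 - r) / 4 : ℝ) : ℂ) := by
        push_cast
        rw [← hr]
        simp [map_ofNat]
      rw [this, Complex.norm_real, Real.norm_eq_abs, abs_of_neg (by linarith)]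
      ring
    have hwL : w (L : K) = L := by
      rw [← InfinitePlace.norm_embedding_eq]; simp
    simp only [hy, map_div₀, map_mul, map_pow, hwL]
    exact le_pow_div_pow (by rw [hwq]; ring) (by rw [hwq]; linarith) hb0
      (by exact_mod_cast hLpos) hL hrk
  have hvy (v : FinitePlace K) : v y = v c ^ 10 / (v (L : K) ^ 10 * v q ^ (4 * k)) := by
    simp only [hy, map_div₀, map_mul, map_pow]
  have hF : ((b ^ k) ^ 10)⁻¹ ^ E.card ≤ ∏ᶠ v : FinitePlace K, v y := by
    refine pow_card_le_finprod (FinitePlace.hasFiniteMulSupport hy0) (by positivity) ?_ ?_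
    · intro v hvE
      obtain ⟨p, hpp, hp⟩ := v.exists_prime_abv_lt_one
      have hvE' : v q = 1 ∧ v (1 - 4 * q) = 1 := by
        simpa [hE, not_or] using hvE
      have := gegBound_le_abv_geg (hna v) hpp hp le_rfl (q := q)
        (hvE'.1.le.trans_eq (one_pow 2).symm)
        (hvE'.2.trans (one_pow 2).symm) hn hk (fun _ => rfl) h0
      have := one_le_pow_mul_div (B := 1) (c := v c) (FinitePlace.pos_iff.2 hL0) le_rfl
        (FinitePlace.pos_iff.2 hq) (hvE'.1.le.trans_eq (one_pow 2).symm)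
        (by rw [one_mul]; exact this)
      rwa [one_pow, one_mul, ← hvy] at this
    · intro v hvE
      have := one_le_pow_mul_div (FinitePlace.pos_iff.2 hL0) (hH1 v) (FinitePlace.pos_iff.2 hq)
        (hqH v) (hbad v hvE h0)
      rw [inv_le_iff_one_le_mul₀' (by positivity), hvy]
      exact this
  have hcontra : x * ((b ^ k) ^ 10)⁻¹ ^ E.card ≤ 1 := by
    rw [← hprod]
    exact mul_le_mul hI hF (by positivity) (by linarith)
  rw [hx, inv_pow, ← div_eq_mul_inv, div_right_comm, div_le_one (by positivity)] at hcontra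
  refine hbig.not_ge (le_trans (le_of_eq ?_) hcontra)
  rw [div_pow _ ((b ^ 10) ^ E.card)]
  congr 1
  ring

end NumberFields

lemma eventually_geg_ne_zero_of_pos {n : ℕ} (hn : 1 ≤ n) {Z : ℝ} (hZ : 0 < Z) :
    ∀ᶠ N : ℕ in atTop, geg n Z N ≠ 0 := by
  rcases le_or_gt Z 1 with hZ1 | hZ1
  · exact Eventually.of_forall fun N => (geg_pos_of_le_one n hZ1 N).ne'
  by_cases halg : IsAlgebraic ℚ Z
  · have : FiniteDimensional ℚ (IntermediateField.adjoin ℚ {Z}) :=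
      IntermediateField.adjoin.finiteDimensional halg.isIntegral
    have : NumberField (IntermediateField.adjoin ℚ {Z}) := ⟨⟩
    set g := IntermediateField.AdjoinSimple.gen ℚ Z
    have hg : algebraMap (IntermediateField.adjoin ℚ {Z}) ℝ g = Z :=
      IntermediateField.AdjoinSimple.algebraMap_gen ℚ Z
    have hgq : 1 - 4 * ((1 - g) / 4) = g := by ring
    have hg0 : g ≠ 0 := by
      rintro h; rw [h, map_zero] at hg; exact hZ.ne hg
    have hg1 : (1 - g) / 4 ≠ 0 := by
      refine div_ne_zero (sub_ne_zero.2 ?_) (by norm_num)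
      intro h; rw [← h, map_one] at hg; exact hZ1.ne hg
    have h := eventually_geg_ne_zero hn hg1 (by rwa [hgq])
    rw [hgq] at h
    rw [← map_add_atTop_eq_nat 1, eventually_map]
    filter_upwards [h] with k hk h0
    rw [← hg, ← map_geg, map_eq_zero] at h0
    exact hk h0
  · exact Eventually.of_forall (geg_ne_zero_of_transcendental halg)

theorem euler_sect6_main_cf (n : ℕ) (hn : 1 ≤ n) (z : ℝ) (hz : 0 < z) :
    Filter.Tendsto
      (GenContFract.convs
        (⟨1, Stream'.Seq.ofStream
            (fun k : ℕ =>
              ⟨((n : ℝ) ^ 2 - ((k : ℝ) + 1) ^ 2) * z ^ 2, 2 * ((k : ℝ) + 1) + 1⟩)⟩ :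
          GenContFract ℝ))
      Filter.atTop
      (𝓝 ((n : ℝ) * z * ((1 + z) ^ n + (1 - z) ^ n) / ((1 + z) ^ n - (1 - z) ^ n))) :=
  convs_tendsto_of_geg_ne_zero hn hz (eventually_geg_ne_zero_of_pos hn (by positivity))
end

section
/- Let n be a natural number and φ a real number with cos φ ≠ 0 and sin(n·φ) ≠ 0, and set t = tan φ. Then in the complex numbers, n·(t·i)·((1 + t·i)^n + (1 − t·i)^n) / ((1 + t·i)^n − (1 − t·i)^n) = n·t·cos(n·φ)/sin(n·φ) (the right-hand side being a real number regarded as complex). -/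
theorem Complex.one_add_tan_mul_I_pow (n : ℕ) {z : ℂ} (hz : Complex.cos z ≠ 0) :
    (1 + Complex.tan z * Complex.I) ^ n =
      (Complex.cos (n * z) + Complex.sin (n * z) * Complex.I) / Complex.cos z ^ n := by
  rw [← Complex.cos_add_sin_mul_I_pow, ← div_pow, Complex.tan_eq_sin_div_cos]
  congr 1
  field_simp

theorem Complex.one_sub_tan_mul_I_pow (n : ℕ) {z : ℂ} (hz : Complex.cos z ≠ 0) :
    (1 - Complex.tan z * Complex.I) ^ n =
      (Complex.cos (n * z) - Complex.sin (n * z) * Complex.I) / Complex.cos z ^ n := by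
  have h := Complex.one_add_tan_mul_I_pow n (z := -z) (by rwa [Complex.cos_neg])
  simpa only [Complex.tan_neg, Complex.cos_neg, Complex.sin_neg, mul_neg, neg_mul,
    ← sub_eq_add_neg] using h

theorem euler_sect10_real_value (n : ℕ) (φ : ℝ) (hφ : Real.cos φ ≠ 0)
    (hs : Real.sin (n * φ) ≠ 0) (t : ℝ) (ht : t = Real.tan φ) :
    (n : ℂ) * ((t : ℂ) * Complex.I) *
        ((1 + (t : ℂ) * Complex.I) ^ n + (1 - (t : ℂ) * Complex.I) ^ n) /
        ((1 + (t : ℂ) * Complex.I) ^ n - (1 - (t : ℂ) * Complex.I) ^ n) =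
      (((n : ℝ) * t * Real.cos (n * φ) / Real.sin (n * φ) : ℝ) : ℂ) := by
  have hc : Complex.cos φ ≠ 0 := by exact_mod_cast hφ
  have hsin : Complex.sin (n * φ) ≠ 0 := by exact_mod_cast hs
  subst ht
  push_cast
  rw [Complex.one_add_tan_mul_I_pow n hc, Complex.one_sub_tan_mul_I_pow n hc, ← add_div,
    ← sub_div, add_add_sub_cancel, add_sub_sub_cancel, ← two_mul, ← two_mul]
  have hI := Complex.I_ne_zero
  field_simp
end

section
/- Let t be a real number. Consider the generalized continued fraction over ℝ with head term 0, first partial numerator a₁ = t and first partial denominator b₁ = 1, and for k ≥ 1, (k+1)-th partial numerator a_{k+1} = k²·t² and (k+1)-th partial denominator b_{k+1} = 2k + 1. Then the sequence of its convergents tends to arctan t. -/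
open Filter Topology

namespace ArctanContFract

/-- Euler's arctangent continued fraction. -/
noncomputable def gcf (t : ℝ) : GenContFract ℝ :=
  ⟨0, Stream'.Seq.ofStream
    (fun k : ℕ =>
      if k = 0 then ⟨t, 1⟩
      else ⟨(k : ℝ) ^ 2 * t ^ 2, 2 * (k : ℝ) + 1⟩)⟩

/-- Numerators of the convergents. -/
def num (t : ℝ) : ℕ → ℝ
  | 0 => 0
  | 1 => t
  | n + 2 => (2 * n + 3) * num t (n + 1) + (n + 1) ^ 2 * t ^ 2 * num t n

/-- Denominators of the convergents. -/
def den (t : ℝ) : ℕ → ℝ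
  | 0 => 1
  | 1 => 1
  | n + 2 => (2 * n + 3) * den t (n + 1) + (n + 1) ^ 2 * t ^ 2 * den t n

/-- The remainders `(-1) ^ n * (den t n * arctan t - num t n)`, defined by their recurrence. -/
noncomputable def rem : ℕ → ℝ → ℝ
  | 0 => fun t => Real.arctan t
  | 1 => fun t => t - Real.arctan t
  | n + 2 => fun t => -(2 * n + 3) * rem (n + 1) t + (n + 1) ^ 2 * t ^ 2 * rem n t

theorem gcf_get?_zero (t : ℝ) : (gcf t).s.get? 0 = some ⟨t, 1⟩ := rfl

theorem gcf_get?_succ (t : ℝ) (n : ℕ) :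
    (gcf t).s.get? (n + 1) = some ⟨((n : ℝ) + 1) ^ 2 * t ^ 2, 2 * (n : ℝ) + 3⟩ := by
  have h : (gcf t).s.get? (n + 1) =
      some ⟨((n + 1 : ℕ) : ℝ) ^ 2 * t ^ 2, 2 * ((n + 1 : ℕ) : ℝ) + 1⟩ := rfl
  rw [h]
  push_cast
  ring_nf

theorem conts_gcf (t : ℝ) (n : ℕ) : (gcf t).conts n = ⟨num t n, den t n⟩ := by
  induction n using Nat.twoStepInduction with
  | zero => simp [num, den, gcf]
  | one =>
    rw [GenContFract.first_cont_eq (gcf_get?_zero t)]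
    simp [num, den, gcf]
  | more n h0 h1 => rw [GenContFract.conts_recurrence (gcf_get?_succ t n) h0 h1]; rfl

theorem convs_gcf (t : ℝ) (n : ℕ) : (gcf t).convs n = num t n / den t n := by
  rw [GenContFract.conv_eq_conts_a_div_conts_b, conts_gcf]

theorem num_neg (t : ℝ) (n : ℕ) : num (-t) n = -num t n := by
  induction n using Nat.twoStepInduction with
  | zero => simp [num]
  | one => simp [num]
  | more n h0 h1 => simp only [num, h0, h1]; ring

theorem den_neg (t : ℝ) (n : ℕ) : den (-t) n = den t n := by
  induction n using Nat.twoStepInduction with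
  | zero => simp [den]
  | one => simp [den]
  | more n h0 h1 => simp only [den, h0, h1]; ring

theorem den_pos (t : ℝ) (n : ℕ) : 0 < den t n := by
  induction n using Nat.twoStepInduction with
  | zero => simp [den]
  | one => simp [den]
  | more n h0 h1 => simp only [den]; positivity

theorem rem_eq (t : ℝ) (n : ℕ) :
    rem n t = (-1) ^ n * (den t n * Real.arctan t - num t n) := by
  induction n using Nat.twoStepInduction with
  | zero => simp [rem, num, den]
  | one => simp [rem, num, den]
  | more n h0 h1 => simp only [rem, num, den, h0, h1]; ring

theorem rem_zero_right (n : ℕ) : rem n 0 = 0 := by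
  induction n using Nat.twoStepInduction with
  | zero => simp [rem]
  | one => simp [rem]
  | more n h0 h1 => simp [rem, h0, h1]

theorem hasDerivAt_rem_succ (t : ℝ) (n : ℕ) :
    HasDerivAt (rem (n + 1))
      ((n + 1) * t * (rem (n + 1) t + (n + 1) * rem n t) / (1 + t ^ 2)) t := by
  have hpos : (1 + t ^ 2 : ℝ) ≠ 0 := by positivity
  have hsq : HasDerivAt (fun x : ℝ => x ^ 2) (2 * t) t := by simpa using hasDerivAt_pow 2 t
  have step (k : ℕ) {d0 d1 : ℝ} (h0 : HasDerivAt (rem k) d0 t)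
      (h1 : HasDerivAt (rem (k + 1)) d1 t) :
      HasDerivAt (rem (k + 2)) (-(2 * k + 3) * d1 +
        ((k + 1) ^ 2 * (2 * t) * rem k t + (k + 1) ^ 2 * t ^ 2 * d0)) t :=
    (h1.const_mul _).add ((hsq.const_mul _).mul h0)
  have hzero : HasDerivAt (rem 0) (1 / (1 + t ^ 2)) t := Real.hasDerivAt_arctan t
  have hone : HasDerivAt (rem 1) (1 - 1 / (1 + t ^ 2)) t :=
    (hasDerivAt_id t).sub (Real.hasDerivAt_arctan t)
  induction n using Nat.twoStepInduction with
  | zero =>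
    convert hone using 1
    simp only [rem]
    field_simp
    push_cast
    ring
  | one =>
    convert step 0 hzero hone using 1
    simp only [rem]
    field_simp
    push_cast
    ring
  | more n h0 h1 =>
    convert step (n + 1) h0 h1 using 1
    simp only [rem]
    field_simp
    push_cast
    ring

theorem rem_nonneg {t : ℝ} (ht : 0 ≤ t) (n : ℕ) : 0 ≤ rem n t := by
  induction n generalizing t with
  | zero => simpa [rem] using ht
  | succ n ih =>
    have hd (x : ℝ) : HasDerivAt (fun x => rem (n + 1) x / √(1 + x ^ 2) ^ (n + 1))
        ((n + 1) ^ 2 * x * rem n x / (1 + x ^ 2) / √(1 + x ^ 2) ^ (n + 1)) x := by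
      have hpos : (0 : ℝ) < 1 + x ^ 2 := by positivity
      have hs : HasDerivAt (fun x : ℝ => √(1 + x ^ 2)) (x / √(1 + x ^ 2)) x := by
        convert (((hasDerivAt_pow 2 x).const_add 1).sqrt hpos.ne') using 1
        field_simp
        simp [mul_comm]
      have hu : 0 < √(1 + x ^ 2) := Real.sqrt_pos.2 hpos
      have hsq : √(1 + x ^ 2) ^ 2 = 1 + x ^ 2 := Real.sq_sqrt hpos.le
      refine ((hasDerivAt_rem_succ x n).div (hs.pow (n + 1))
        (pow_ne_zero _ hu.ne')).congr_deriv ?_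
      simp only [Pi.pow_apply, Nat.add_sub_cancel]
      generalize √(1 + x ^ 2) = u at hu hsq
      rw [← hsq]
      field_simp
      push_cast
      ring
    have hmono : MonotoneOn (fun x => rem (n + 1) x / √(1 + x ^ 2) ^ (n + 1)) (Set.Ici 0) := by
      refine monotoneOn_of_deriv_nonneg (convex_Ici 0)
        (fun x _ => (hd x).continuousAt.continuousWithinAt)
        (fun x _ => (hd x).differentiableAt.differentiableWithinAt) fun x hx => ?_
      rw [interior_Ici, Set.mem_Ioi] at hx
      rw [(hd x).deriv]
      have := ih hx.le
      positivity
    have h := hmono Set.self_mem_Ici (Set.mem_Ici.2 ht) ht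
    simp only [rem_zero_right, zero_div] at h
    have hu : 0 < √(1 + t ^ 2) ^ (n + 1) := by positivity
    simpa [hu.ne'] using mul_nonneg h hu.le

theorem rem_mul_den_add (t : ℝ) (n : ℕ) :
    rem n t * den t (n + 1) + rem (n + 1) t * den t n = (n.factorial : ℝ) ^ 2 * t ^ (2 * n + 1) := by
  induction n with
  | zero => simp [rem, den]
  | succ n ih =>
    rw [Nat.factorial_succ]
    push_cast
    simp only [rem, den]
    linear_combination ((n : ℝ) + 1) ^ 2 * t ^ 2 * ih

theorem factorial_mul_pow_le_den {t : ℝ} (ht : 0 ≤ t) (n : ℕ) :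
    (n.factorial : ℝ) * t ^ n ≤ (1 + t) * (n + 1) * den t n := by
  induction n using Nat.twoStepInduction with
  | zero => simpa [den] using ht
  | one => simp [den]; linarith
  | more n h0 _ =>
    have hd := den_pos t (n + 1)
    have hd' := den_pos t n
    calc ((n + 2).factorial : ℝ) * t ^ (n + 2)
        = (n + 2) * (n + 1) * t ^ 2 * (n.factorial * t ^ n) := by
          rw [Nat.factorial_succ, Nat.factorial_succ]; push_cast; ring
      _ ≤ (n + 2) * (n + 1) * t ^ 2 * ((1 + t) * (n + 1) * den t n) := by gcongr
      _ = (1 + t) * (n + 2) * ((n + 1) ^ 2 * t ^ 2 * den t n) := by ring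
      _ ≤ (1 + t) * (n + 3) * ((2 * n + 3) * den t (n + 1) + (n + 1) ^ 2 * t ^ 2 * den t n) := by
          gcongr
          · norm_num
          · have : 0 ≤ (2 * (n : ℝ) + 3) * den t (n + 1) := by positivity
            linarith
      _ = (1 + t) * ((n + 2 : ℕ) + 1) * den t (n + 2) := by
          simp only [den]; push_cast; ring

theorem harmonic_le_den_mul_den {t : ℝ} (ht : 0 ≤ t) (n : ℕ) :
    (∑ i ∈ Finset.range n, 1 / ((i : ℝ) + 1)) * ((n.factorial : ℝ) ^ 2 * t ^ (2 * n)) ≤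
      2 * (1 + t) ^ 2 * (den t n * den t (n + 1)) := by
  induction n with
  | zero => simp [den]; positivity
  | succ n ih =>
    have hd := den_pos t (n + 1)
    have hsq : ((n + 1).factorial * t ^ (n + 1)) ^ 2 ≤
        ((1 + t) * ((n + 1 : ℕ) + 1) * den t (n + 1)) ^ 2 := by
      exact pow_le_pow_left₀ (by positivity) (factorial_mul_pow_le_den ht (n + 1)) 2
    have hfrac : 1 / ((n : ℝ) + 1) * ((n + 1).factorial * t ^ (n + 1)) ^ 2 ≤
        2 * (1 + t) ^ 2 * ((2 * n + 3) * den t (n + 1) ^ 2) := by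
      rw [one_div, inv_mul_le_iff₀ (by positivity)]
      refine hsq.trans ?_
      have : ((n : ℝ) + 2) ^ 2 ≤ (n + 1) * (2 * (2 * n + 3)) := by
        nlinarith [sq_nonneg (n : ℝ), (Nat.cast_nonneg n : (0 : ℝ) ≤ n)]
      calc ((1 + t) * ((n + 1 : ℕ) + 1) * den t (n + 1)) ^ 2
          = ((n : ℝ) + 2) ^ 2 * ((1 + t) ^ 2 * den t (n + 1) ^ 2) := by push_cast; ring
        _ ≤ (n + 1) * (2 * (2 * n + 3)) * ((1 + t) ^ 2 * den t (n + 1) ^ 2) := by gcongr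
        _ = _ := by ring
    have hih := mul_le_mul_of_nonneg_left ih (by positivity : 0 ≤ ((n : ℝ) + 1) ^ 2 * t ^ 2)
    rw [Finset.sum_range_succ, add_mul]
    rw [Nat.factorial_succ] at hfrac ⊢
    push_cast at hfrac ⊢
    simp only [den]
    refine le_of_eq_of_le ?_ ((add_le_add hih hfrac).trans_eq ?_) <;> ring

theorem abs_convs_sub_arctan_le {t : ℝ} (ht : 0 ≤ t) {n : ℕ} (hn : n ≠ 0) :
    |num t n / den t n - Real.arctan t| ≤
      2 * (1 + t) ^ 2 * t * (∑ i ∈ Finset.range n, 1 / ((i : ℝ) + 1))⁻¹ := by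
  have hd := den_pos t n
  have hd' := den_pos t (n + 1)
  have hH : 0 < ∑ i ∈ Finset.range n, 1 / ((i : ℝ) + 1) :=
    Finset.sum_pos (fun i _ => by positivity) (Finset.nonempty_range_iff.2 hn)
  have habs : |num t n / den t n - Real.arctan t| = rem n t / den t n := by
    have : num t n / den t n - Real.arctan t =
        -((den t n * Real.arctan t - num t n) / den t n) := by field_simp; ring
    rw [this, abs_neg, abs_div, abs_of_pos hd, ← abs_of_nonneg (rem_nonneg ht n), rem_eq]
    simp [abs_mul]
  rw [habs, ← div_eq_mul_inv, div_le_div_iff₀ hd hH]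
  have hle : rem n t * den t (n + 1) ≤ (n.factorial : ℝ) ^ 2 * t ^ (2 * n + 1) := by
    rw [← rem_mul_den_add]
    have := mul_nonneg (rem_nonneg ht (n + 1)) hd.le
    linarith
  refine le_of_mul_le_mul_right ?_ hd'
  calc rem n t * (∑ i ∈ Finset.range n, 1 / ((i : ℝ) + 1)) * den t (n + 1)
      = (∑ i ∈ Finset.range n, 1 / ((i : ℝ) + 1)) * (rem n t * den t (n + 1)) := by ring
    _ ≤ (∑ i ∈ Finset.range n, 1 / ((i : ℝ) + 1)) *
        ((n.factorial : ℝ) ^ 2 * t ^ (2 * n + 1)) := by gcongr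
    _ = t * ((∑ i ∈ Finset.range n, 1 / ((i : ℝ) + 1)) *
        ((n.factorial : ℝ) ^ 2 * t ^ (2 * n))) := by ring
    _ ≤ t * (2 * (1 + t) ^ 2 * (den t n * den t (n + 1))) :=
        mul_le_mul_of_nonneg_left (harmonic_le_den_mul_den ht n) ht
    _ = _ := by ring

theorem tendsto_num_div_den_of_nonneg {t : ℝ} (ht : 0 ≤ t) :
    Tendsto (fun n => num t n / den t n) atTop (𝓝 (Real.arctan t)) := by
  rw [tendsto_iff_dist_tendsto_zero]
  refine squeeze_zero' (Eventually.of_forall fun _ => dist_nonneg)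
    ((eventually_ne_atTop 0).mono fun n hn => abs_convs_sub_arctan_le ht hn) ?_
  simpa using (tendsto_inv_atTop_zero.comp
    Real.tendsto_sum_range_one_div_nat_succ_atTop).const_mul (2 * (1 + t) ^ 2 * t)

theorem tendsto_num_div_den (t : ℝ) :
    Tendsto (fun n => num t n / den t n) atTop (𝓝 (Real.arctan t)) := by
  rcases le_total 0 t with ht | ht
  · exact tendsto_num_div_den_of_nonneg ht
  · have h := (tendsto_num_div_den_of_nonneg (neg_nonneg.2 ht)).neg
    simpa [num_neg, den_neg, neg_div] using h

end ArctanContFract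

theorem euler_sect11_arctan_cf (t : ℝ) :
    Filter.Tendsto
      (GenContFract.convs
        (⟨0, Stream'.Seq.ofStream
            (fun k : ℕ =>
              if k = 0 then ⟨t, 1⟩
              else ⟨(k : ℝ) ^ 2 * t ^ 2, 2 * (k : ℝ) + 1⟩)⟩ :
          GenContFract ℝ))
      Filter.atTop (𝓝 (Real.arctan t)) :=
  (ArctanContFract.tendsto_num_div_den t).congr fun n => (ArctanContFract.convs_gcf t n).symm
end

section
/- Let θ be a real number with −π/2 < θ < π/2. Consider the generalized continued fraction over ℝ with head term 0, first partial numerator a₁ = θ and first partial denominator b₁ = 1, and for k ≥ 1, (k+1)-th partial numerator a_{k+1} = −θ² and (k+1)-th partial denominator b_{k+1} = 2k + 1. Then the sequence of its convergents tends to tan θ. -/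
open Filter Topology

open Real in
/-- The normalised integral `(2 ^ (n + 1) * n!)⁻¹ * ∫ x in -1..1, (1 - x²) ^ n * cos (θ x)`, which
equals `θ⁻ⁿ` times the spherical Bessel function of order `n` at `θ`. -/
noncomputable def besselInt (θ : ℝ) (n : ℕ) : ℝ :=
  (∫ x in (-1 : ℝ)..1, (1 - x ^ 2) ^ n * cos (θ * x)) / (2 ^ (n + 1) * n.factorial)

namespace besselInt

open Real

variable (θ : ℝ)

lemma intervalIntegrable_kernel (n : ℕ) (a b : ℝ) :
    IntervalIntegrable (fun x : ℝ ↦ (1 - x ^ 2) ^ n * cos (θ * x)) MeasureTheory.volume a b :=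
  Continuous.intervalIntegrable (by fun_prop) a b

lemma hasDerivAt_sin_mul (x : ℝ) : HasDerivAt (fun x ↦ sin (θ * x)) (θ * cos (θ * x)) x := by
  simpa [mul_comm] using ((hasDerivAt_id x).const_mul θ).sin

lemma hasDerivAt_cos_mul (x : ℝ) : HasDerivAt (fun x ↦ cos (θ * x)) (-(θ * sin (θ * x))) x := by
  simpa [mul_comm] using ((hasDerivAt_id x).const_mul θ).cos

lemma hasDerivAt_one_sub_sq_pow (n : ℕ) (x : ℝ) :
    HasDerivAt (fun x : ℝ ↦ (1 - x ^ 2) ^ (n + 1)) (-(2 * (n + 1) * x * (1 - x ^ 2) ^ n)) x := by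
  have h := ((hasDerivAt_pow 2 x).const_sub 1).fun_pow (n + 1)
  refine h.congr_deriv ?_
  push_cast
  simp
  ring

lemma mul_zero_eq_sin : θ * besselInt θ 0 = sin θ := by
  have h := intervalIntegral.integral_eq_sub_of_hasDerivAt
    (fun x _ ↦ hasDerivAt_sin_mul θ x)
    (Continuous.intervalIntegrable (by fun_prop) (-1 : ℝ) 1)
  rw [intervalIntegral.integral_const_mul] at h
  simp only [mul_one, mul_neg, sin_neg] at h
  simp only [besselInt, pow_zero, one_mul, Nat.factorial_zero]
  push_cast
  linarith

lemma cube_mul_one_eq : θ ^ 3 * besselInt θ 1 = sin θ - θ * cos θ := by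
  have hd (x : ℝ) : HasDerivAt
      (fun x ↦ θ ^ 2 * ((1 - x ^ 2) ^ (0 + 1) * sin (θ * x)) - 2 * θ * (x * cos (θ * x)))
      (θ ^ 3 * ((1 - x ^ 2) ^ 1 * cos (θ * x)) - 2 * θ * ((1 - x ^ 2) ^ 0 * cos (θ * x))) x := by
    refine ((((hasDerivAt_one_sub_sq_pow 0 x).fun_mul (hasDerivAt_sin_mul θ x)).const_mul
      (θ ^ 2)).fun_sub (((hasDerivAt_id' x).fun_mul (hasDerivAt_cos_mul θ x)).const_mul
      (2 * θ))).congr_deriv ?_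
    push_cast
    ring
  have h := intervalIntegral.integral_eq_sub_of_hasDerivAt (fun x _ ↦ hd x)
    (Continuous.intervalIntegrable (by fun_prop) (-1 : ℝ) 1)
  rw [intervalIntegral.integral_sub ((intervalIntegrable_kernel θ 1 _ _).const_mul _)
    ((intervalIntegrable_kernel θ 0 _ _).const_mul _),
    intervalIntegral.integral_const_mul, intervalIntegral.integral_const_mul] at h
  have h0 := mul_zero_eq_sin θ
  simp only [besselInt, Nat.factorial_zero, Nat.factorial_one] at h0 ⊢
  norm_num at h h0 ⊢
  linarith

lemma recurrence (n : ℕ) :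
    θ ^ 2 * besselInt θ (n + 2) = (2 * n + 3) * besselInt θ (n + 1) - besselInt θ n := by
  have hd (x : ℝ) : HasDerivAt
      (fun x ↦ θ * ((1 - x ^ 2) ^ (n + 1 + 1) * sin (θ * x)) -
        2 * (n + 2) * ((x * (1 - x ^ 2) ^ (n + 1)) * cos (θ * x)))
      (θ ^ 2 * ((1 - x ^ 2) ^ (n + 2) * cos (θ * x)) -
        2 * (n + 2) * (2 * n + 3) * ((1 - x ^ 2) ^ (n + 1) * cos (θ * x)) +
        4 * (n + 2) * (n + 1) * ((1 - x ^ 2) ^ n * cos (θ * x))) x := by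
    refine ((((hasDerivAt_one_sub_sq_pow (n + 1) x).fun_mul
      (hasDerivAt_sin_mul θ x)).const_mul θ).fun_sub
      ((((hasDerivAt_id' x).fun_mul (hasDerivAt_one_sub_sq_pow n x)).fun_mul
      (hasDerivAt_cos_mul θ x)).const_mul (2 * ((n : ℝ) + 2)))).congr_deriv ?_
    push_cast
    ring
  have h := intervalIntegral.integral_eq_sub_of_hasDerivAt (fun x _ ↦ hd x)
    (Continuous.intervalIntegrable (by fun_prop) (-1 : ℝ) 1)
  rw [intervalIntegral.integral_add
      (((intervalIntegrable_kernel θ _ _ _).const_mul _).sub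
        ((intervalIntegrable_kernel θ _ _ _).const_mul _))
      ((intervalIntegrable_kernel θ _ _ _).const_mul _),
    intervalIntegral.integral_sub ((intervalIntegrable_kernel θ _ _ _).const_mul _)
      ((intervalIntegrable_kernel θ _ _ _).const_mul _),
    intervalIntegral.integral_const_mul, intervalIntegral.integral_const_mul,
    intervalIntegral.integral_const_mul] at h
  simp only [one_pow, neg_sq, sub_self, pow_succ _ (n + 1), pow_succ _ n, mul_zero, zero_mul] at h
  simp only [besselInt, Nat.factorial_succ]
  push_cast
  have hn : (n.factorial : ℝ) ≠ 0 := by positivity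
  have hn1 : (n : ℝ) + 1 ≠ 0 := by positivity
  have hn2 : (n : ℝ) + 1 + 1 ≠ 0 := by positivity
  field_simp
  simp only [pow_succ _ (n + 1), pow_succ _ n]
  linear_combination (8 * 2 ^ (2 * n)) * h

lemma pos {θ : ℝ} (h1 : -(π / 2) < θ) (h2 : θ < π / 2) (n : ℕ) : 0 < besselInt θ n := by
  refine div_pos ?_ (by positivity)
  refine intervalIntegral.intervalIntegral_pos_of_pos_on (intervalIntegrable_kernel θ n _ _)
    (fun x hx ↦ ?_) (by norm_num)
  have hx1 : |x| ≤ 1 := abs_le.2 ⟨hx.1.le, hx.2.le⟩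
  have hθ : |θ * x| < π / 2 := by
    rw [abs_mul]
    exact (mul_le_of_le_one_right (abs_nonneg θ) hx1).trans_lt (abs_lt.2 ⟨h1, h2⟩)
  exact mul_pos (pow_pos (by nlinarith [hx.1, hx.2]) n) (cos_pos_of_mem_Ioo (abs_lt.1 hθ))

lemma le_inv_factorial (n : ℕ) : besselInt θ n ≤ 1 / n.factorial := by
  have h : ‖∫ x in (-1 : ℝ)..1, (1 - x ^ 2) ^ n * cos (θ * x)‖ ≤ 1 * |(1 : ℝ) - (-1)| := by
    refine intervalIntegral.norm_integral_le_of_norm_le_const fun x hx ↦ ?_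
    rw [Set.uIoc_of_le (by norm_num)] at hx
    have hu : |1 - x ^ 2| ≤ 1 := abs_le.2 ⟨by nlinarith [hx.1, hx.2], by nlinarith [hx.1, hx.2]⟩
    rw [norm_mul, norm_pow, Real.norm_eq_abs, Real.norm_eq_abs]
    exact mul_le_one₀ (pow_le_one₀ (abs_nonneg _) hu) (abs_nonneg _) (abs_cos_le_one _)
  have h' := (le_abs_self _).trans h
  norm_num at h'
  have hp : (1 : ℝ) ≤ 2 ^ n := one_le_pow₀ (by norm_num)
  have hn : (0 : ℝ) < n.factorial := by positivity
  rw [besselInt, div_le_div_iff₀ (by positivity) hn, one_mul, pow_succ]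
  nlinarith

end besselInt

/-- If `A` and `B` satisfy the recurrence of the continuants of Lambert's continued fraction for the
tangent, then `A n / B n` tends to `tan θ`. -/
lemma tendsto_div_tan_of_recurrence {θ : ℝ} (h1 : -(Real.pi / 2) < θ) (h2 : θ < Real.pi / 2)
    {A B : ℕ → ℝ} (hA0 : A 0 = 0) (hB0 : B 0 = 1) (hA1 : A 1 = θ) (hB1 : B 1 = 1)
    (hA : ∀ n : ℕ, A (n + 2) = (2 * n + 3) * A (n + 1) - θ ^ 2 * A n)
    (hB : ∀ n : ℕ, B (n + 2) = (2 * n + 3) * B (n + 1) - θ ^ 2 * B n) :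
    Tendsto (fun n ↦ A n / B n) atTop (𝓝 (Real.tan θ)) := by
  have hc : 0 < Real.cos θ := Real.cos_pos_of_mem_Ioo ⟨h1, h2⟩
  have hj := besselInt.pos h1 h2
  have hR (n : ℕ) : A n * Real.cos θ - B n * Real.sin θ = -(θ ^ (2 * n + 1) * besselInt θ n) := by
    induction n using Nat.twoStepInduction with
    | zero => simp [hA0, hB0, besselInt.mul_zero_eq_sin]
    | one =>
      rw [hA1, hB1]
      linear_combination besselInt.cube_mul_one_eq θ
    | more n ih0 ih1 =>
      rw [hA, hB]
      linear_combination (2 * (n : ℝ) + 3) * ih1 - θ ^ 2 * ih0 +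
        θ ^ (2 * n + 3) * besselInt.recurrence θ n
  have hdet (n : ℕ) :
      besselInt θ n * B (n + 1) - θ ^ 2 * besselInt θ (n + 1) * B n = Real.cos θ := by
    induction n with
    | zero =>
      have h0 := besselInt.mul_zero_eq_sin θ
      have h3 := besselInt.cube_mul_one_eq θ
      rw [hB0, zero_add, hB1]
      rcases eq_or_ne θ 0 with rfl | hθ
      · simp [besselInt]
      · apply mul_left_cancel₀ hθ
        linear_combination h0 - h3
    | succ n ih =>
      rw [hB]
      linear_combination ih - B (n + 1) * besselInt.recurrence θ n
  have hBpos (n : ℕ) : 0 < B n := by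
    induction n with
    | zero => simp [hB0]
    | succ n ih =>
      have : 0 ≤ θ ^ 2 * besselInt θ (n + 1) * B n :=
        mul_nonneg (mul_nonneg (sq_nonneg θ) (hj _).le) ih.le
      exact pos_of_mul_pos_right (by linarith [hdet n]) (hj n).le
  have hBlow (n : ℕ) : Real.cos θ ≤ B (n + 1) := by
    have h : 0 ≤ θ ^ 2 * besselInt θ (n + 1) * B n :=
      mul_nonneg (mul_nonneg (sq_nonneg θ) (hj _).le) (hBpos n).le
    have hj1 : besselInt θ n ≤ 1 := (besselInt.le_inv_factorial θ n).trans <|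
      div_le_one_of_le₀ (by exact_mod_cast n.factorial_pos) (by positivity)
    nlinarith [hdet n, hBpos (n + 1)]
  have hlim : Tendsto (fun n : ℕ ↦ |θ| / Real.cos θ ^ 2 * ((θ ^ 2) ^ n / n.factorial)) atTop
      (𝓝 0) := by
    simpa using (FloorSemiring.tendsto_pow_div_factorial_atTop (θ ^ 2)).const_mul
      (|θ| / Real.cos θ ^ 2)
  rw [tendsto_iff_dist_tendsto_zero]
  refine squeeze_zero' (Eventually.of_forall fun n ↦ dist_nonneg) ?_ hlim
  filter_upwards [eventually_ge_atTop 1] with n hn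
  obtain ⟨n, rfl⟩ := Nat.exists_eq_add_of_le' hn
  set m := n + 1
  have hBm : Real.cos θ ≤ B m := hBlow n
  have heq : A m / B m - Real.tan θ =
      -(θ ^ (2 * m + 1) * besselInt θ m) / (B m * Real.cos θ) := by
    rw [← hR, Real.tan_eq_sin_div_cos, div_sub_div _ _ (hBpos m).ne' hc.ne']
  rw [Real.dist_eq, heq, abs_div, abs_neg, abs_mul, abs_of_pos (hj m),
    abs_of_pos (mul_pos (hBpos m) hc), abs_pow, pow_succ, pow_mul, sq_abs]
  calc (θ ^ 2) ^ m * |θ| * besselInt θ m / (B m * Real.cos θ)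
      ≤ (θ ^ 2) ^ m * |θ| * (1 / m.factorial) / (Real.cos θ * Real.cos θ) := by
        gcongr
        exact besselInt.le_inv_factorial θ m
    _ = |θ| / Real.cos θ ^ 2 * ((θ ^ 2) ^ m / m.factorial) := by
        field_simp

theorem euler_sect12_tan_cf (θ : ℝ) (h1 : -(Real.pi / 2) < θ) (h2 : θ < Real.pi / 2) :
    Filter.Tendsto
      (GenContFract.convs
        (⟨0, Stream'.Seq.ofStream
            (fun k : ℕ =>
              if k = 0 then ⟨θ, 1⟩
              else ⟨-θ ^ 2, 2 * (k : ℝ) + 1⟩)⟩ :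
          GenContFract ℝ))
      Filter.atTop (𝓝 (Real.tan θ)) := by
  set g : GenContFract ℝ := ⟨0, Stream'.Seq.ofStream
    (fun k : ℕ => if k = 0 then ⟨θ, 1⟩ else ⟨-θ ^ 2, 2 * (k : ℝ) + 1⟩)⟩ with hg
  have hs0 : g.s.get? 0 = some ⟨θ, 1⟩ := rfl
  have hs (n : ℕ) : g.s.get? (n + 1) = some ⟨-θ ^ 2, 2 * ((n + 1 : ℕ) : ℝ) + 1⟩ := rfl
  refine tendsto_div_tan_of_recurrence h1 h2 (A := g.nums) (B := g.dens)
    GenContFract.zeroth_num_eq_h GenContFract.zeroth_den_eq_one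
    (by simpa [hg] using GenContFract.first_num_eq hs0) (GenContFract.first_den_eq hs0)
    (fun n ↦ ?_) (fun n ↦ ?_)
  · have h : g.nums (n + 2) = _ := GenContFract.nums_recurrence (hs n) rfl rfl
    rw [h]
    push_cast
    ring
  · have h : g.dens (n + 2) = _ := GenContFract.dens_recurrence (hs n) rfl rfl
    rw [h]
    push_cast
    ring
end

section
/- Let z be a real number with −1 < z < 1 and z ≠ 0. Then the function n ↦ n·z·((1+z)^n + (1−z)^n) / ((1+z)^n − (1−z)^n) (with real exponent n, using real powers) tends to 2z / log((1+z)/(1−z)) as n tends to 0 through nonzero values. -/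
open Filter Topology

theorem euler_sect13_limit (z : ℝ) (h1 : -1 < z) (h2 : z < 1) (hz : z ≠ 0) :
    Filter.Tendsto
      (fun n : ℝ =>
        n * z * ((1 + z) ^ n + (1 - z) ^ n) / ((1 + z) ^ n - (1 - z) ^ n))
      (𝓝[≠] 0) (𝓝 (2 * z / Real.log ((1 + z) / (1 - z)))) := by
  have ha : 0 < 1 + z := by linarith
  have hb : 0 < 1 - z := by linarith
  have hlog : Real.log (1 + z) - Real.log (1 - z) ≠ 0 := fun h =>
    hz (by linarith [Real.log_injOn_pos ha hb (sub_eq_zero.mp h)])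
  have da := (Real.hasStrictDerivAt_const_rpow ha 0).hasDerivAt
  have db := (Real.hasStrictDerivAt_const_rpow hb 0).hasDerivAt
  have hden : Tendsto (fun n : ℝ => n⁻¹ * ((1 + z) ^ n - (1 - z) ^ n)) (𝓝[≠] 0)
      (𝓝 (Real.log (1 + z) - Real.log (1 - z))) := by
    simpa using hasDerivAt_iff_tendsto_slope_zero.mp (da.fun_sub db)
  have hnum : Tendsto (fun n : ℝ => z * ((1 + z) ^ n + (1 - z) ^ n)) (𝓝[≠] 0)
      (𝓝 (2 * z)) := by
    have h : Tendsto (fun n : ℝ => z * ((1 + z) ^ n + (1 - z) ^ n)) (𝓝 0)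
        (𝓝 (z * ((1 + z) ^ (0 : ℝ) + (1 - z) ^ (0 : ℝ)))) :=
      (da.continuousAt.tendsto.add db.continuousAt.tendsto).const_mul z
    rw [Real.rpow_zero, Real.rpow_zero, one_add_one_eq_two, mul_comm z 2] at h
    exact h.mono_left nhdsWithin_le_nhds
  rw [Real.log_div ha.ne' hb.ne']
  refine (hnum.div hden hlog).congr fun n => ?_
  simp only [Pi.div_apply, div_eq_mul_inv, mul_inv, inv_inv]
  ring
end

section
/- Let z be a real number with 0 < |z| < 1. Consider the generalized continued fraction over ℝ with head term 0, first partial numerator a₁ = 2z and first partial denominator b₁ = 1, and for k ≥ 1, (k+1)-th partial numerator a_{k+1} = −k²·z² and (k+1)-th partial denominator b_{k+1} = 2k + 1. Then the sequence of its convergents tends to log((1+z)/(1−z)). -/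
open Filter Topology

/-- The coefficient of `z ^ (2 * k)` in the `n`-th normalized remainder of Euler's continued
fraction for the logarithm. In closed form it is `2 (n + 2k)! / ((2k)‼ (2n + 2k + 1)‼)`. -/
noncomputable def eulerLogCoeff : ℕ → ℕ → ℝ
  | 0, k => 2 / (2 * k + 1)
  | n + 1, k => eulerLogCoeff n k * ((n + 1 + 2 * k) / (2 * n + 2 * k + 3))

lemma eulerLogCoeff_nonneg (n k : ℕ) : 0 ≤ eulerLogCoeff n k := by
  induction n with
  | zero => rw [eulerLogCoeff]; positivity
  | succ n ih => rw [eulerLogCoeff]; positivity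

lemma eulerLogCoeff_le (n k : ℕ) : eulerLogCoeff n k ≤ eulerLogCoeff 0 k := by
  induction n with
  | zero => rfl
  | succ n ih =>
    rw [eulerLogCoeff]
    refine (mul_le_of_le_one_right (eulerLogCoeff_nonneg n k) ?_).trans ih
    rw [div_le_one (by positivity)]
    have : (0 : ℝ) ≤ n := n.cast_nonneg
    linarith

lemma eulerLogCoeff_succ_right (n k : ℕ) :
    eulerLogCoeff n (k + 1) = eulerLogCoeff n k *
      ((n + 2 * k + 1) * (n + 2 * k + 2) / ((2 * k + 2) * (2 * n + 2 * k + 3))) := by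
  induction n with
  | zero =>
    simp only [eulerLogCoeff]
    push_cast
    field_simp
    ring
  | succ n ih =>
    simp only [eulerLogCoeff, ih]
    push_cast
    field_simp
    ring

lemma eulerLogCoeff_recurrence (n k : ℕ) :
    (n + 2) * eulerLogCoeff (n + 2) k =
      (2 * n + 3) * eulerLogCoeff (n + 1) (k + 1) - (n + 1) * eulerLogCoeff n (k + 1) := by
  simp only [eulerLogCoeff, eulerLogCoeff_succ_right]
  push_cast
  field_simp
  ring

lemma eulerLogCoeff_recurrence_zero (n : ℕ) :
    (2 * n + 3) * eulerLogCoeff (n + 1) 0 - (n + 1) * eulerLogCoeff n 0 = 0 := by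
  simp only [eulerLogCoeff]
  push_cast
  field_simp
  ring

lemma hasSum_eulerLogCoeff_zero {z : ℝ} (h0 : z ≠ 0) (h1 : |z| < 1) :
    HasSum (fun k => eulerLogCoeff 0 k * z ^ (2 * k)) (Real.log ((1 + z) / (1 - z)) / z) := by
  obtain ⟨hl, hr⟩ := abs_lt.1 h1
  rw [Real.log_div (by linarith) (by linarith)]
  refine ((Real.hasSum_log_sub_log_of_abs_lt_one h1).div_const z).congr_fun ?_
  intro k
  simp only [eulerLogCoeff]
  field_simp
  ring

/-- Solutions of the three-term recurrence started at `log ((1 + z) / (1 - z))` and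
`log ((1 + z) / (1 - z)) - 2 * z` have an explicit power series. -/
lemma hasSum_eulerLogCoeff {z : ℝ} (h0 : z ≠ 0) (h1 : |z| < 1) {R : ℕ → ℝ}
    (hR0 : R 0 = Real.log ((1 + z) / (1 - z)))
    (hR1 : R 1 = Real.log ((1 + z) / (1 - z)) - 2 * z)
    (hR : ∀ n : ℕ, R (n + 2) = (2 * n + 3) * R (n + 1) - (n + 1) ^ 2 * z ^ 2 * R n) (n : ℕ) :
    HasSum (fun k => eulerLogCoeff n k * z ^ (2 * k)) (R n / (n.factorial * z ^ (2 * n + 1))) := by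
  induction n using Nat.twoStepInduction with
  | zero => simpa [hR0] using hasSum_eulerLogCoeff_zero h0 h1
  | one =>
    have h := (hasSum_nat_add_iff' 1).2 (hasSum_eulerLogCoeff_zero h0 h1)
    convert! h.div_const (z ^ 2) using 1
    · ext k
      simp only [eulerLogCoeff]
      push_cast
      field_simp
      ring
    · simp only [hR1, Finset.sum_range_one, eulerLogCoeff]
      push_cast
      field_simp
      simp
  | more n ih ih' =>
    have h := ((hasSum_nat_add_iff' 1).2
      ((ih'.mul_left (2 * n + 3 : ℝ)).sub (ih.mul_left (n + 1 : ℝ)))).div_const ((n + 2) * z ^ 2)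
    convert! h using 1
    · ext k
      rw [eq_div_iff (by positivity)]
      linear_combination z ^ (2 * k + 2) * eulerLogCoeff_recurrence n k
    · have hzero := eulerLogCoeff_recurrence_zero n
      simp only [Finset.sum_range_one, mul_zero, pow_zero, mul_one, hzero, sub_zero, hR,
        Nat.factorial_succ]
      push_cast
      field_simp
      ring

/-- Positive lower bound for the continuants. -/
lemma factorial_le_of_recurrence {z : ℝ} (h1 : |z| < 1) {B : ℕ → ℝ} (hB0 : B 0 = 1) (hB1 : B 1 = 1)
    (hB : ∀ n : ℕ, B (n + 2) = (2 * n + 3) * B (n + 1) - (n + 1) ^ 2 * z ^ 2 * B n) (n : ℕ) :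
    (n.factorial : ℝ) ≤ B n := by
  have hz : z ^ 2 ≤ 1 := (sq_le_one_iff_abs_le_one z).2 h1.le
  suffices h : ∀ n : ℕ, (n.factorial : ℝ) ≤ B n ∧ (n + 1) * B n ≤ B (n + 1) from (h n).1
  intro n
  induction n with
  | zero => simp [hB0, hB1]
  | succ n ih =>
    obtain ⟨ih1, ih2⟩ := ih
    have hf : (0 : ℝ) ≤ n.factorial := by positivity
    have hn : (0 : ℝ) ≤ n := n.cast_nonneg
    constructor
    · rw [Nat.factorial_succ]
      push_cast
      nlinarith
    · have h2 : (n + 1) * (z ^ 2 * ((n + 1) * B n)) ≤ (n + 1) * B (n + 1) := by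
        gcongr
        nlinarith [mul_nonneg hn (hf.trans ih1)]
      rw [hB]
      push_cast
      nlinarith

theorem euler_sect13_log_cf (z : ℝ) (h0 : 0 < |z|) (h1 : |z| < 1) :
    Filter.Tendsto
      (GenContFract.convs
        (⟨0, Stream'.Seq.ofStream
            (fun k : ℕ =>
              if k = 0 then ⟨2 * z, 1⟩
              else ⟨-(k : ℝ) ^ 2 * z ^ 2, 2 * (k : ℝ) + 1⟩)⟩ :
          GenContFract ℝ))
      Filter.atTop (𝓝 (Real.log ((1 + z) / (1 - z)))) := by
  have hz : z ≠ 0 := abs_pos.1 h0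
  set L := Real.log ((1 + z) / (1 - z)) with hL
  set g : GenContFract ℝ := ⟨0, Stream'.Seq.ofStream
            (fun k : ℕ =>
              if k = 0 then ⟨2 * z, 1⟩
              else ⟨-(k : ℝ) ^ 2 * z ^ 2, 2 * (k : ℝ) + 1⟩)⟩ with hg
  have hs0 : g.s.get? 0 = some ⟨2 * z, 1⟩ := rfl
  have hs (n : ℕ) : g.s.get? (n + 1) =
      some ⟨-((n + 1 : ℕ) : ℝ) ^ 2 * z ^ 2, 2 * ((n + 1 : ℕ) : ℝ) + 1⟩ := rfl
  have hA0 : g.nums 0 = 0 := rfl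
  have hA1 : g.nums 1 = 2 * z := by rw [GenContFract.first_num_eq hs0]; simp [hg]
  have hB1 : g.dens 1 = 1 := GenContFract.first_den_eq hs0
  have hA (n : ℕ) : g.nums (n + 2) =
      (2 * n + 3) * g.nums (n + 1) - (n + 1) ^ 2 * z ^ 2 * g.nums n := by
    rw [GenContFract.nums_recurrence (hs n) rfl rfl]; push_cast; ring
  have hB (n : ℕ) : g.dens (n + 2) =
      (2 * n + 3) * g.dens (n + 1) - (n + 1) ^ 2 * z ^ 2 * g.dens n := by
    rw [GenContFract.dens_recurrence (hs n) rfl rfl]; push_cast; ring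
  have hfac := factorial_le_of_recurrence h1 (B := g.dens) rfl hB1 hB
  have hsum := hasSum_eulerLogCoeff hz h1 (R := fun n => g.dens n * L - g.nums n)
    (by simp [hA0, hL]) (by simp [hA1, hB1, hL]) (fun n => by simp only [hA, hB]; ring)
  have hbound (n : ℕ) : ‖g.convs n - L‖ ≤ L / z * |z| ^ (2 * n + 1) := by
    have hf : (0 : ℝ) < n.factorial := by positivity
    have hBpos : 0 < g.dens n := hf.trans_le (hfac n)
    have hzk (k : ℕ) : 0 ≤ z ^ (2 * k) := (even_two_mul k).pow_nonneg z
    obtain ⟨S, hS⟩ : ∃ S, S = (g.dens n * L - g.nums n) / (n.factorial * z ^ (2 * n + 1)) :=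
      ⟨_, rfl⟩
    have hSn : HasSum (fun k => eulerLogCoeff n k * z ^ (2 * k)) S := hS ▸ hsum n
    have hS0 : 0 ≤ S := hSn.nonneg fun k => mul_nonneg (eulerLogCoeff_nonneg n k) (hzk k)
    have hSL : S ≤ L / z := hasSum_le
      (fun k => mul_le_mul_of_nonneg_right (eulerLogCoeff_le n k) (hzk k))
      hSn (hasSum_eulerLogCoeff_zero hz h1)
    have heq : g.convs n - L = -(S * z ^ (2 * n + 1) * (n.factorial / g.dens n)) := by
      rw [GenContFract.conv_eq_num_div_den, hS]
      field_simp
      ring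
    rw [heq, norm_neg, norm_mul, norm_mul, norm_pow, Real.norm_of_nonneg hS0, Real.norm_eq_abs,
      Real.norm_of_nonneg (by positivity)]
    refine (mul_le_of_le_one_right (by positivity) ((div_le_one hBpos).2 (hfac n))).trans ?_
    gcongr
  have hpow : Tendsto (fun n : ℕ => L / z * |z| ^ (2 * n + 1)) atTop (𝓝 0) := by
    have := (tendsto_pow_atTop_nhds_zero_of_lt_one h0.le h1).comp
      (tendsto_atTop_mono (fun n : ℕ => (by simp; omega : id n ≤ 2 * n + 1)) tendsto_id)
    simpa using this.const_mul (L / z)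
  exact tendsto_iff_norm_sub_tendsto_zero.2
    (squeeze_zero (fun _ => norm_nonneg _) hbound hpow)
end

section
/- Let v be a real number. Consider the generalized continued fraction over ℝ with head term 1 whose k-th partial numerator (k = 1, 2, 3, …) is v² and whose k-th partial denominator is 2k + 1. Then the sequence of its convergents tends to v·(exp(2v) + 1)/(exp(2v) − 1) if v ≠ 0, i.e. for all nonzero real v the convergents of this continued fraction tend to v·(exp(2v) + 1)/(exp(2v) − 1). -/
open Filter Topology

/-- The remainder functions of the continued fraction of `x * coth x`: the `n`-th continuants
`(A, B)` satisfy `A * sinh x - B * (x * cosh x) = ± cothRemainder (n + 1) x`. -/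
noncomputable def cothRemainder : ℕ → ℝ → ℝ
  | 0, x => Real.sinh x
  | 1, x => x * Real.cosh x - Real.sinh x
  | n + 2, x => x ^ 2 * cothRemainder n x - (2 * n + 3) * cothRemainder (n + 1) x

theorem cothRemainder_succ_zero (n : ℕ) : cothRemainder (n + 1) 0 = 0 := by
  induction n with
  | zero => simp [cothRemainder]
  | succ n ih => simp [cothRemainder, ih]

theorem hasDerivAt_cothRemainder_zero (x : ℝ) :
    HasDerivAt (cothRemainder 0) (Real.cosh x) x := by
  have h : cothRemainder 0 = Real.sinh := by funext y; simp [cothRemainder]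
  rw [h]
  exact Real.hasDerivAt_sinh x

theorem hasDerivAt_cothRemainder_one (x : ℝ) :
    HasDerivAt (cothRemainder 1) (x * cothRemainder 0 x) x := by
  have h : cothRemainder 1 = fun y => y * Real.cosh y - Real.sinh y := by
    funext y; simp [cothRemainder]
  rw [h]
  refine (((hasDerivAt_id' x).mul (Real.hasDerivAt_cosh x)).sub
    (Real.hasDerivAt_sinh x)).congr_deriv ?_
  simp [cothRemainder]

theorem HasDerivAt.cothRemainder_add_two {n : ℕ} {x d e : ℝ}
    (hd : HasDerivAt (cothRemainder n) d x) (he : HasDerivAt (cothRemainder (n + 1)) e x) :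
    HasDerivAt (cothRemainder (n + 2))
      (2 * x * cothRemainder n x + x ^ 2 * d - (2 * n + 3) * e) x := by
  have h : cothRemainder (n + 2) =
      fun y => y ^ 2 * cothRemainder n y - (2 * n + 3) * cothRemainder (n + 1) y := by
    funext y; rw [cothRemainder]
  rw [h]
  refine (((hasDerivAt_pow 2 x).mul hd).sub (he.const_mul (2 * (n : ℝ) + 3))).congr_deriv ?_
  norm_num

theorem hasDerivAt_cothRemainder_succ (n : ℕ) (x : ℝ) :
    HasDerivAt (cothRemainder (n + 1)) (x * cothRemainder n x) x := by
  induction n using Nat.twoStepInduction with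
  | zero => exact hasDerivAt_cothRemainder_one x
  | one =>
    refine ((hasDerivAt_cothRemainder_zero x).cothRemainder_add_two
      (hasDerivAt_cothRemainder_one x)).congr_deriv ?_
    simp only [cothRemainder]
    push_cast
    ring
  | more n ih₀ ih₁ =>
    refine (ih₀.cothRemainder_add_two ih₁).congr_deriv ?_
    rw [cothRemainder]
    push_cast
    ring

theorem abs_cothRemainder_le (b : ℝ) (n : ℕ) :
    ∀ x ∈ Set.Icc 0 b, |cothRemainder n x| ≤ Real.sinh b * ((x ^ 2 / 2) ^ n / n.factorial) := by
  induction n with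
  | zero =>
    intro x hx
    simpa [cothRemainder, abs_of_nonneg (Real.sinh_nonneg_iff.2 hx.1)] using hx.2
  | succ n ih =>
    refine image_norm_le_of_norm_deriv_right_le_deriv_boundary
      (f' := fun x => x * cothRemainder n x)
      (B' := fun x => x * (Real.sinh b * ((x ^ 2 / 2) ^ n / n.factorial)))
      (fun x _ => (hasDerivAt_cothRemainder_succ n x).continuousAt.continuousWithinAt)
      (fun x _ => (hasDerivAt_cothRemainder_succ n x).hasDerivWithinAt) ?_ (fun x => ?_)
      (fun x hx => ?_)
    · simp [cothRemainder_succ_zero]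
    · refine (((((hasDerivAt_pow 2 x).div_const 2).pow (n + 1)).div_const
        ((n + 1).factorial : ℝ)).const_mul (Real.sinh b)).congr_deriv ?_
      have : (n.factorial : ℝ) ≠ 0 := by positivity
      rw [Nat.factorial_succ]
      push_cast
      field_simp
    · rw [Real.norm_eq_abs, abs_mul, abs_of_nonneg hx.1]
      exact mul_le_mul_of_nonneg_left (ih x (Set.Ico_subset_Icc_self hx)) hx.1

theorem tendsto_cothRemainder {x : ℝ} (hx : 0 ≤ x) :
    Tendsto (fun n => cothRemainder n x) atTop (𝓝 0) := by
  refine squeeze_zero_norm (fun n => abs_cothRemainder_le x n x ⟨hx, le_rfl⟩) ?_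
  simpa using (FloorSemiring.tendsto_pow_div_factorial_atTop (x ^ 2 / 2)).const_mul (Real.sinh x)

/-- Euler's continued fraction `1 + v² / (3 + v² / (5 + v² / (7 + ⋯)))`. -/
noncomputable def cothContFract (v : ℝ) : GenContFract ℝ :=
  ⟨1, Stream'.Seq.ofStream (fun k : ℕ => ⟨v ^ 2, 2 * ((k : ℝ) + 1) + 1⟩)⟩

theorem cothContFract_contsAux_add_two (v : ℝ) (n : ℕ) :
    (cothContFract v).contsAux (n + 2) =
      ⟨(2 * n + 3) * ((cothContFract v).contsAux (n + 1)).a +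
          v ^ 2 * ((cothContFract v).contsAux n).a,
        (2 * n + 3) * ((cothContFract v).contsAux (n + 1)).b +
          v ^ 2 * ((cothContFract v).contsAux n).b⟩ := by
  have h : (cothContFract v).s.get? n = some ⟨v ^ 2, 2 * ((n : ℝ) + 1) + 1⟩ := rfl
  rw [GenContFract.contsAux_recurrence h rfl rfl]
  congr 2 <;> ring

theorem cothContFract_contsAux_sub (v : ℝ) (n : ℕ) :
    ((cothContFract v).contsAux n).a * Real.sinh v -
      ((cothContFract v).contsAux n).b * (v * Real.cosh v) = (-1) ^ n * cothRemainder n v := by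
  induction n using Nat.twoStepInduction with
  | zero => simp [cothRemainder]
  | one => simp [cothRemainder, cothContFract]
  | more n ih₀ ih₁ =>
    rw [cothContFract_contsAux_add_two, cothRemainder]
    linear_combination (2 * (n : ℝ) + 3) * ih₁ + v ^ 2 * ih₀

theorem one_le_cothContFract_contsAux_b (v : ℝ) (n : ℕ) :
    0 ≤ ((cothContFract v).contsAux n).b ∧ 1 ≤ ((cothContFract v).contsAux (n + 1)).b := by
  induction n with
  | zero => simp
  | succ n ih =>
    refine ⟨by linarith, ?_⟩
    rw [cothContFract_contsAux_add_two]
    have h₀ := mul_nonneg (sq_nonneg v) ih.1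
    have h₁ := mul_nonneg n.cast_nonneg (zero_le_one.trans ih.2)
    dsimp only
    linarith

theorem tendsto_cothContFract_convs {v : ℝ} (hv : 0 < v) :
    Tendsto (cothContFract v).convs atTop (𝓝 (v * Real.cosh v / Real.sinh v)) := by
  have hs : 0 < Real.sinh v := Real.sinh_pos_iff.2 hv
  refine tendsto_iff_norm_sub_tendsto_zero.2 ?_
  have hlim : Tendsto (fun n => |cothRemainder (n + 1) v| / Real.sinh v) atTop (𝓝 0) := by
    simpa using (((tendsto_add_atTop_iff_nat 1).2 (tendsto_cothRemainder hv.le)).abs).div_const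
      (Real.sinh v)
  refine squeeze_zero (fun _ => norm_nonneg _) (fun n => ?_) hlim
  have hb := (one_le_cothContFract_contsAux_b v n).2
  have hsub := cothContFract_contsAux_sub v (n + 1)
  rw [GenContFract.conv_eq_conts_a_div_conts_b, GenContFract.nth_cont_eq_succ_nth_contAux,
    div_sub_div _ _ (by positivity) hs.ne', hsub, norm_div, norm_mul, norm_mul, norm_pow,
    norm_neg, norm_one, one_pow, one_mul, Real.norm_eq_abs, Real.norm_eq_abs, Real.norm_eq_abs,
    abs_of_pos hs, abs_of_pos (zero_lt_one.trans_le hb)]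
  exact div_le_div_of_nonneg_left (abs_nonneg _) hs (le_mul_of_one_le_left hs.le hb)

theorem mul_cosh_div_sinh_eq (v : ℝ) :
    v * Real.cosh v / Real.sinh v = v * (Real.exp (2 * v) + 1) / (Real.exp (2 * v) - 1) := by
  have hc : Real.exp (2 * v) + 1 = 2 * Real.exp v * Real.cosh v := by
    rw [Real.cosh_eq, two_mul v, Real.exp_add, Real.exp_neg]
    field_simp
  have hs : Real.exp (2 * v) - 1 = 2 * Real.exp v * Real.sinh v := by
    rw [Real.sinh_eq, two_mul v, Real.exp_add, Real.exp_neg]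
    field_simp
  rw [hc, hs, mul_left_comm, mul_div_mul_left _ _ (by positivity)]

theorem euler_sect14_cf (v : ℝ) (hv : v ≠ 0) :
    Filter.Tendsto
      (GenContFract.convs
        (⟨1, Stream'.Seq.ofStream
            (fun k : ℕ => ⟨v ^ 2, 2 * ((k : ℝ) + 1) + 1⟩)⟩ :
          GenContFract ℝ))
      Filter.atTop
      (𝓝 (v * (Real.exp (2 * v) + 1) / (Real.exp (2 * v) - 1))) := by
  rw [← mul_cosh_div_sinh_eq]
  change Tendsto (cothContFract v).convs _ _
  rcases hv.lt_or_gt with h | h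
  · have hneg := tendsto_cothContFract_convs (neg_pos.2 h)
    rwa [Real.cosh_neg, Real.sinh_neg, neg_mul, neg_div_neg_eq, cothContFract, neg_sq] at hneg
  · exact tendsto_cothContFract_convs h
end
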